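/- Let A be a noetherian local ring and M and N finitely generated non-zero A-modules such that Tor^A_i(M, N) = 0 for all i > 0. If M has finite projective dimension and M ⊗_A N is almost Cohen-Macaulay, then N is almost Cohen-Macaulay. In particular, a noetherian local ring having an almost Cohen-Macaulay module of finite projective dimension is an almost Cohen-Macaulay ring. -/

import Mathlib

noncomputable section

open TensorProduct

universe u v w





/-- The depth of the ideal `I` on the module `M`: the supremum of lengths of
`M`-regular sequences with entries in `I`. -/
noncomputable def idealDepth (A : Type u) [CommRing A] (I : Ideal A)
    (M : Type v) [AddCommGroup M] [Module A M] : ℕ∞ :=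
  sSup {n : ℕ∞ | ∃ rs : List A, (rs.length : ℕ∞) = n ∧ (∀ r ∈ rs, r ∈ I) ∧
    RingTheory.Sequence.IsRegular M rs}

/-- The depth of a module over a local ring. -/
noncomputable def localDepth (A : Type u) [CommRing A] [IsLocalRing A]
    (M : Type v) [AddCommGroup M] [Module A M] : ℕ∞ :=
  idealDepth A (IsLocalRing.maximalIdeal A) M

/-- The (Krull) dimension of a module, i.e. the Krull dimension of its support. -/
noncomputable def supportDim (A : Type u) [CommRing A]
    (M : Type v) [AddCommGroup M] [Module A M] : WithBot ℕ∞ :=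
  Order.krullDim (Module.support A M)

/-- `depth (M_P)` : the depth of the localization of `M` at a prime `P`,
over the local ring `A_P`. -/
noncomputable def depthAt (A : Type u) [CommRing A]
    (M : Type v) [AddCommGroup M] [Module A M] (P : PrimeSpectrum A) : ℕ∞ :=
  localDepth (Localization.AtPrime P.asIdeal) (LocalizedModule P.asIdeal.primeCompl M)

/-- `ht_M(P) = dim (M_P)` : the height of a prime `P` in the support of `M`,
i.e. the dimension of the localized module `M_P` over `A_P`. -/
noncomputable def heightAt (A : Type u) [CommRing A]
    (M : Type v) [AddCommGroup M] [Module A M] (P : PrimeSpectrum A) : WithBot ℕ∞ :=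
  supportDim (Localization.AtPrime P.asIdeal) (LocalizedModule P.asIdeal.primeCompl M)

/-- Serre's condition `(S_n)` for a module: for every `P` in the support,
`depth (M_P) ≥ min (n, ht_M(P))`. -/
def SerreCondS (A : Type u) [CommRing A] (n : ℕ)
    (M : Type v) [AddCommGroup M] [Module A M] : Prop :=
  ∀ P ∈ Module.support A M,
    min (n : WithBot ℕ∞) (heightAt A M P) ≤ (depthAt A M P : WithBot ℕ∞)

/-- The condition `(C_n)` for a module: for every `P` in the support,
`depth (M_P) ≥ min (n, ht_M(P)) - 1`, equivalently
`min (n, ht_M(P)) ≤ depth (M_P) + 1`. -/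
def CondC (A : Type u) [CommRing A] (n : ℕ)
    (M : Type v) [AddCommGroup M] [Module A M] : Prop :=
  ∀ P ∈ Module.support A M,
    min (n : WithBot ℕ∞) (heightAt A M P) ≤ (depthAt A M P : WithBot ℕ∞) + 1

/-- A module `M` is almost Cohen-Macaulay if `depth(P, M) = depth (M_P)` for every
`P` in the support of `M` (Kang's definition). -/
def IsAlmostCMModule (A : Type u) [CommRing A]
    (M : Type v) [AddCommGroup M] [Module A M] : Prop :=
  ∀ P ∈ Module.support A M, idealDepth A P.asIdeal M = depthAt A M P

/-- A module `M` is Cohen-Macaulay if `depth (M_P) = dim (M_P)` for every `P` in its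
support. -/
def IsCMModule (A : Type u) [CommRing A]
    (M : Type v) [AddCommGroup M] [Module A M] : Prop :=
  ∀ P ∈ Module.support A M, (depthAt A M P : WithBot ℕ∞) = heightAt A M P

/-- A ring is almost Cohen-Macaulay if it is an almost Cohen-Macaulay module over
itself. -/
abbrev IsAlmostCMRing (A : Type u) [CommRing A] : Prop := IsAlmostCMModule A A

/-- A ring is Cohen-Macaulay if it is a Cohen-Macaulay module over itself, i.e. all its
localizations at primes have depth equal to dimension. -/
abbrev IsCMRing (A : Type u) [CommRing A] : Prop := IsCMModule A A

/-- A ring satisfies `(C_n)` if it does so as a module over itself. -/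
abbrev RingCondC (A : Type u) [CommRing A] (n : ℕ) : Prop := CondC A n A

/-- A ring satisfies `(S_n)` if it does so as a module over itself. -/
abbrev RingSerreCondS (A : Type u) [CommRing A] (n : ℕ) : Prop := SerreCondS A n A





open CategoryTheory


/-- The `i`-th Ext group `Ext_A^i(M, N)`. -/
noncomputable def ExtGroup (A : Type u) [CommRing A] (M N : Type u)
    [AddCommGroup M] [Module A M] [AddCommGroup N] [Module A N] (i : ℕ) : Type u :=
  ((Ext A (ModuleCat.{u} A) i).obj (Opposite.op (ModuleCat.of A M))).obj (ModuleCat.of A N)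

/-- The grade of `M` with respect to `N` : `grade(M, N) = inf { i | Ext^i_A(M, N) ≠ 0 }`. -/
noncomputable def extGrade (A : Type u) [CommRing A] (M N : Type u)
    [AddCommGroup M] [Module A M] [AddCommGroup N] [Module A N] : ℕ∞ :=
  sInf {n : ℕ∞ | ∃ i : ℕ, n = i ∧ Nontrivial (ExtGroup A M N i)}

/-- The projective dimension of `M`, characterized by vanishing of Ext. -/
noncomputable def projDim (A : Type u) [CommRing A] (M : Type u)
    [AddCommGroup M] [Module A M] : ℕ∞ :=
  sInf {n : ℕ∞ | ∃ d : ℕ, n = d ∧ ∀ i : ℕ, d < i → ∀ Y : ModuleCat.{u} A,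
    Subsingleton (((Ext A (ModuleCat.{u} A) i).obj (Opposite.op (ModuleCat.of A M))).obj Y)}

/-- `M` is `N`-perfect if `grade(M, N) = pd(M) < ∞`. -/
def IsPerfectFor (A : Type u) [CommRing A] (M N : Type u)
    [AddCommGroup M] [Module A M] [AddCommGroup N] [Module A N] : Prop :=
  projDim A M ≠ ⊤ ∧ extGrade A M N = projDim A M

/-- The `i`-th Tor group `Tor^A_i(M, N)`. -/
noncomputable def TorGroup (A : Type u) [CommRing A] (M N : Type u)
    [AddCommGroup M] [Module A M] [AddCommGroup N] [Module A N] (i : ℕ) : Type u :=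
  ((Tor (ModuleCat.{u} A) i).obj (ModuleCat.of A M)).obj (ModuleCat.of A N)


/-- A finitely generated module over a noetherian local ring is almost Cohen-Macaulay
iff `dim M ≤ depth M + 1`. -/
def IsLocalACM (A : Type u) [CommRing A] [IsLocalRing A]
    (M : Type v) [AddCommGroup M] [Module A M] : Prop :=
  supportDim A M ≤ (localDepth A M : WithBot ℕ∞) + 1

/-- A noetherian local ring is Cohen-Macaulay if its depth equals its dimension. -/
def IsLocalCMRing (A : Type u) [CommRing A] [IsLocalRing A] : Prop :=
  (localDepth A A : WithBot ℕ∞) = ringKrullDim A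

set_option linter.unusedSectionVars false

/-- The length of the subquotient `Z / (B ∩ Z)`. -/
def relLen {A : Type u} [CommRing A] {X : Type v} [AddCommGroup X] [Module A X]
    (Z B : Submodule A X) : ℕ∞ :=
  Module.length A (Z ⧸ B.submoduleOf Z)

section RelLen

variable {A : Type u} [CommRing A] {X : Type v} [AddCommGroup X] [Module A X]
  {X' : Type w} [AddCommGroup X'] [Module A X']

theorem relLen_le_of_surj (φ : X →ₗ[A] X') {Z B : Submodule A X} {Z' B' : Submodule A X'}
    (hZ : ∀ z ∈ Z, φ z ∈ Z') (hB : ∀ z ∈ Z, z ∈ B → φ z ∈ B')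
    (hs : ∀ z' ∈ Z', ∃ z ∈ Z, z' - φ z ∈ B') : relLen Z' B' ≤ relLen Z B := by
  refine Module.length_le_of_surjective
    (Submodule.mapQ (B.submoduleOf Z) (B'.submoduleOf Z') (φ.restrict hZ) ?_) ?_
  · rintro ⟨z, hz⟩ hzB
    exact hB z hz hzB
  · intro y
    obtain ⟨⟨z', hz'⟩, rfl⟩ := Submodule.Quotient.mk_surjective _ y
    obtain ⟨z, hz, h⟩ := hs z' hz'
    refine ⟨Submodule.Quotient.mk ⟨z, hz⟩, ?_⟩
    rw [Submodule.mapQ_apply, eq_comm, Submodule.Quotient.eq]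
    exact h

theorem relLen_eq_of_bij (φ : X →ₗ[A] X') {Z B : Submodule A X} {Z' B' : Submodule A X'}
    (hZ : ∀ z ∈ Z, φ z ∈ Z') (hB : ∀ z ∈ Z, (φ z ∈ B' ↔ z ∈ B))
    (hs : ∀ z' ∈ Z', ∃ z ∈ Z, z' - φ z ∈ B') : relLen Z' B' = relLen Z B := by
  refine le_antisymm (relLen_le_of_surj φ hZ (fun z hz h => (hB z hz).2 h) hs) ?_
  refine Module.length_le_of_injective
    (Submodule.mapQ (B.submoduleOf Z) (B'.submoduleOf Z') (φ.restrict hZ) ?_) ?_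
  · rintro ⟨z, hz⟩ hzB
    exact (hB z hz).2 hzB
  · rw [← LinearMap.ker_eq_bot, LinearMap.ker_eq_bot']
    intro y hy
    obtain ⟨⟨z, hz⟩, rfl⟩ := Submodule.Quotient.mk_surjective _ y
    rw [Submodule.mapQ_apply, Submodule.Quotient.mk_eq_zero] at hy
    rw [Submodule.Quotient.mk_eq_zero]
    exact (hB z hz).1 hy

theorem relLen_add {B Y Z : Submodule A X} (h1 : B ≤ Y) (h2 : Y ≤ Z) :
    relLen Z B = relLen Z Y + relLen Y B := by
  rw [add_comm]
  refine Module.length_eq_add_of_exact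
    (Submodule.mapQ (B.submoduleOf Y) (B.submoduleOf Z) (Submodule.inclusion h2) ?_)
    (Submodule.mapQ (B.submoduleOf Z) (Y.submoduleOf Z) LinearMap.id ?_) ?_ ?_ ?_
  · exact fun z hz => hz
  · exact fun z hz => h1 hz
  · rw [← LinearMap.ker_eq_bot, LinearMap.ker_eq_bot']
    intro y hy
    obtain ⟨z, rfl⟩ := Submodule.Quotient.mk_surjective _ y
    exact (Submodule.Quotient.mk_eq_zero _).2 ((Submodule.Quotient.mk_eq_zero _).1 hy : _)
  · intro y
    obtain ⟨z, rfl⟩ := Submodule.Quotient.mk_surjective _ y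
    exact ⟨Submodule.Quotient.mk z, rfl⟩
  · intro y
    obtain ⟨⟨z, hz⟩, rfl⟩ := Submodule.Quotient.mk_surjective _ y
    refine (Submodule.Quotient.mk_eq_zero (Y.submoduleOf Z)).trans ?_
    constructor
    · intro h
      exact ⟨Submodule.Quotient.mk ⟨z, h⟩, rfl⟩
    · rintro ⟨y, hy⟩
      obtain ⟨⟨t, ht⟩, rfl⟩ := Submodule.Quotient.mk_surjective _ y
      have : t - z ∈ B := (Submodule.Quotient.eq (B.submoduleOf Z)).1 hy
      have h3 : z = t - (t - z) := by abel
      change z ∈ Y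
      rw [h3]
      exact Y.sub_mem ht (h1 this)

theorem relLen_map (φ : X →ₗ[A] X') {B Z : Submodule A X} (h : B ≤ Z)
    (hk : ∀ z ∈ Z, φ z = 0 → z ∈ B) : relLen (Z.map φ) (B.map φ) = relLen Z B := by
  refine relLen_eq_of_bij φ (fun z hz => ⟨z, hz, rfl⟩) (fun z hz => ⟨?_, fun hz => ⟨z, hz, rfl⟩⟩) ?_
  · rintro ⟨b, hb, hbz⟩
    have := hk (z - b) (Z.sub_mem hz (h hb)) (by rw [map_sub, hbz, sub_self])
    simpa using B.add_mem this hb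
  · rintro _ ⟨z, hz, rfl⟩
    exact ⟨z, hz, by simp⟩

theorem relLen_sup (P B : Submodule A X) : relLen (P ⊔ B) B = relLen P (P ⊓ B) := by
  refine relLen_eq_of_bij LinearMap.id (fun z hz => (le_sup_left : P ≤ P ⊔ B) hz)
    (fun z hz => ⟨fun h => ⟨hz, h⟩, fun h => h.2⟩) ?_
  intro z hz
  obtain ⟨p, hp, b, hb, rfl⟩ := Submodule.mem_sup.1 hz
  exact ⟨p, hp, by simpa using hb⟩

theorem relLen_mono_left {B Z Z' : Submodule A X} (h : Z ≤ Z') : relLen Z B ≤ relLen Z' B :=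
  Module.length_le_of_injective
    (Submodule.mapQ (B.submoduleOf Z) (B.submoduleOf Z') (Submodule.inclusion h) (fun _ hz => hz))
    (by
      rw [← LinearMap.ker_eq_bot, LinearMap.ker_eq_bot']
      intro y hy
      obtain ⟨z, rfl⟩ := Submodule.Quotient.mk_surjective _ y
      exact (Submodule.Quotient.mk_eq_zero _).2 ((Submodule.Quotient.mk_eq_zero _).1 hy : _))

theorem relLen_anti_right {B B' : Submodule A X} (Z : Submodule A X) (h : B ≤ B') :
    relLen Z B' ≤ relLen Z B :=
  relLen_le_of_surj LinearMap.id (fun _ hz => hz) (fun _ _ hb => h hb)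
    (fun z hz => ⟨z, hz, by simp⟩)

theorem relLen_eq_zero {B Z : Submodule A X} (h : Z ≤ B) : relLen Z B = 0 := by
  rw [relLen, Module.length_eq_zero_iff, Submodule.Quotient.subsingleton_iff]
  exact Submodule.submoduleOf_eq_top.2 h

theorem relLen_le_length (Z B : Submodule A X) : relLen Z B ≤ Module.length A X :=
  (Module.length_le_of_surjective _ (Submodule.mkQ_surjective _)).trans
    (Module.length_le_of_injective Z.subtype Z.injective_subtype)

theorem relLen_top (B : Submodule A X) : relLen ⊤ B = Module.length A (X ⧸ B) := by
  refine le_antisymm ?_ ?_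
  · refine (relLen_eq_of_bij (Z := ⊤) (B := B) (Z' := ⊤) (B' := ⊥) B.mkQ (by simp) ?_ ?_).symm.le.trans
      (relLen_le_length _ _)
    · intro z _
      simp
    · intro z _
      obtain ⟨z, rfl⟩ := Submodule.mkQ_surjective _ z
      exact ⟨z, trivial, by simp⟩
  · refine Module.length_le_of_surjective
      (Submodule.mapQ (B.submoduleOf ⊤) B (Submodule.subtype ⊤) (fun _ h => h)) ?_
    intro y
    obtain ⟨z, rfl⟩ := Submodule.Quotient.mk_surjective _ y
    exact ⟨Submodule.Quotient.mk ⟨z, trivial⟩, rfl⟩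

end RelLen

section Ladder

variable {A : Type u} [CommRing A]
  {C₂ C₁ C₀ C₂' C₁' C₀' : Type*} [AddCommGroup C₂] [Module A C₂]
  [AddCommGroup C₁] [Module A C₁] [AddCommGroup C₀] [Module A C₀] [AddCommGroup C₂'] [Module A C₂']
  [AddCommGroup C₁'] [Module A C₁'] [AddCommGroup C₀'] [Module A C₀']

/-- The length of the connecting map. -/
theorem relLen_connecting (d : C₂ →ₗ[A] C₁) (d' : C₂' →ₗ[A] C₁') (f₂ : C₂ →ₗ[A] C₂')
    (f₁ : C₁ →ₗ[A] C₁') (S₂ : Submodule A C₂) (S₁ : Submodule A C₁)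
    (hd : ∀ v ∈ S₂, d v ∈ S₁) (hf : ∀ v ∈ S₂, f₁ (d v) = d' (f₂ v)) :
    relLen (S₂.map f₂ ⊓ LinearMap.ker d') ((S₂ ⊓ LinearMap.ker d).map f₂) =
      relLen (S₁ ⊓ LinearMap.ker f₁ ⊓ S₂.map d) ((S₂ ⊓ LinearMap.ker f₂).map d) := by
  let T := S₂ ⊓ LinearMap.ker (d' ∘ₗ f₂)
  let Y := (S₂ ⊓ LinearMap.ker d) ⊔ (S₂ ⊓ LinearMap.ker f₂)
  have hYT : Y ≤ T := by
    refine sup_le ?_ ?_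
    · rintro v ⟨h1, h2⟩
      refine ⟨h1, ?_⟩
      change d' (f₂ v) = 0
      rw [← hf v h1, show d v = 0 from h2, map_zero]
    · rintro v ⟨h1, h2⟩
      refine ⟨h1, ?_⟩
      change d' (f₂ v) = 0
      rw [show f₂ v = 0 from h2, map_zero]
  have e1 : T.map f₂ = S₂.map f₂ ⊓ LinearMap.ker d' := by
    ext y
    constructor
    · rintro ⟨v, ⟨h1, h2⟩, rfl⟩
      exact ⟨⟨v, h1, rfl⟩, h2⟩
    · rintro ⟨⟨v, h1, rfl⟩, h2⟩
      exact ⟨v, ⟨h1, h2⟩, rfl⟩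
  have e2 : Y.map f₂ = (S₂ ⊓ LinearMap.ker d).map f₂ := by
    rw [Submodule.map_sup, sup_eq_left]
    rintro _ ⟨v, ⟨h1, h2⟩, rfl⟩
    rw [show f₂ v = 0 from h2]
    exact zero_mem _
  have e3 : T.map d = S₁ ⊓ LinearMap.ker f₁ ⊓ S₂.map d := by
    ext y
    constructor
    · rintro ⟨v, ⟨h1, h2⟩, rfl⟩
      exact ⟨⟨hd v h1, (hf v h1).trans h2⟩, ⟨v, h1, rfl⟩⟩
    · rintro ⟨⟨_, h2⟩, ⟨v, h1, rfl⟩⟩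
      exact ⟨v, ⟨h1, (hf v h1).symm.trans h2⟩, rfl⟩
  have e4 : Y.map d = (S₂ ⊓ LinearMap.ker f₂).map d := by
    rw [Submodule.map_sup, sup_eq_right]
    rintro _ ⟨v, ⟨h1, h2⟩, rfl⟩
    rw [show d v = 0 from h2]
    exact zero_mem _
  rw [← e1, ← e2, ← e3, ← e4, relLen_map f₂ hYT, relLen_map d hYT]
  · exact fun z hz h => Submodule.mem_sup_left ⟨hz.1, h⟩
  · exact fun z hz h => Submodule.mem_sup_right ⟨hz.1, h⟩

/-- The homology of `S` cut by the homology of the image of `f` and of its kernel. -/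
theorem relLen_homology_split (d₂ : C₂ →ₗ[A] C₁) (d₁ : C₁ →ₗ[A] C₀) (d₂' : C₂' →ₗ[A] C₁')
    (f₂ : C₂ →ₗ[A] C₂') (f₁ : C₁ →ₗ[A] C₁')
    (S₂ : Submodule A C₂) (S₁ : Submodule A C₁)
    (hd : ∀ v ∈ S₂, d₂ v ∈ S₁) (hdd : ∀ v ∈ S₂, d₁ (d₂ v) = 0)
    (hf : ∀ v ∈ S₂, f₁ (d₂ v) = d₂' (f₂ v)) :
    relLen (S₁ ⊓ LinearMap.ker d₁) (S₂.map d₂) =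
      relLen ((S₁ ⊓ LinearMap.ker d₁).map f₁) ((S₂.map f₂).map d₂') +
      relLen (S₁ ⊓ LinearMap.ker f₁ ⊓ LinearMap.ker d₁)
        (S₁ ⊓ LinearMap.ker f₁ ⊓ S₂.map d₂) := by
  have hBZ : S₂.map d₂ ≤ S₁ ⊓ LinearMap.ker d₁ := by
    rintro _ ⟨v, hv, rfl⟩
    exact ⟨hd v hv, hdd v hv⟩
  have hYZ : (S₁ ⊓ LinearMap.ker f₁ ⊓ LinearMap.ker d₁) ⊔ S₂.map d₂ ≤ S₁ ⊓ LinearMap.ker d₁ :=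
    sup_le (inf_le_inf_right _ inf_le_left) hBZ
  rw [relLen_add le_sup_right hYZ]
  congr 1
  · rw [← relLen_map f₁ hYZ]
    · congr 1
      ext y
      constructor
      · rintro ⟨v, hv, rfl⟩
        obtain ⟨t, ht, _, ⟨s, hs, rfl⟩, rfl⟩ := Submodule.mem_sup.1 hv
        refine ⟨f₂ s, ⟨s, hs, rfl⟩, ?_⟩
        rw [map_add, hf s hs, show f₁ t = 0 from ht.1.2, zero_add]
      · rintro ⟨_, ⟨s, hs, rfl⟩, rfl⟩
        exact ⟨d₂ s, Submodule.mem_sup_right ⟨s, hs, rfl⟩, hf s hs⟩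
    · exact fun z hz h => Submodule.mem_sup_left ⟨⟨hz.1, h⟩, hz.2⟩
  · rw [relLen_sup]
    congr 1
    ext y
    constructor
    · rintro ⟨h1, h2⟩
      exact ⟨h1.1, h2⟩
    · rintro ⟨h1, h2⟩
      exact ⟨⟨h1, (hBZ h2).2⟩, h2⟩

/-- The Euler characteristic relation at one spot of a short exact sequence of complexes. -/
theorem relLen_homology_add (d₂ : C₂ →ₗ[A] C₁) (d₁ : C₁ →ₗ[A] C₀) (d₂' : C₂' →ₗ[A] C₁')
    (d₁' : C₁' →ₗ[A] C₀') (f₂ : C₂ →ₗ[A] C₂') (f₁ : C₁ →ₗ[A] C₁') (f₀ : C₀ →ₗ[A] C₀')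
    (S₂ : Submodule A C₂) (S₁ : Submodule A C₁)
    (hd : ∀ v ∈ S₂, d₂ v ∈ S₁) (hdd : ∀ v ∈ S₂, d₁ (d₂ v) = 0)
    (hf : ∀ v ∈ S₂, f₁ (d₂ v) = d₂' (f₂ v)) (hf' : ∀ v ∈ S₁, f₀ (d₁ v) = d₁' (f₁ v)) :
    relLen (S₁ ⊓ LinearMap.ker d₁) (S₂.map d₂) +
      relLen (S₁.map f₁ ⊓ LinearMap.ker d₁') ((S₁ ⊓ LinearMap.ker d₁).map f₁) +
      relLen (S₂.map f₂ ⊓ LinearMap.ker d₂') ((S₂ ⊓ LinearMap.ker d₂).map f₂) =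
    relLen (S₁ ⊓ LinearMap.ker f₁ ⊓ LinearMap.ker d₁) ((S₂ ⊓ LinearMap.ker f₂).map d₂) +
      relLen (S₁.map f₁ ⊓ LinearMap.ker d₁') ((S₂.map f₂).map d₂') := by
  have h1 : (S₂.map f₂).map d₂' ≤ (S₁ ⊓ LinearMap.ker d₁).map f₁ := by
    rintro _ ⟨_, ⟨s, hs, rfl⟩, rfl⟩
    exact ⟨d₂ s, ⟨hd s hs, hdd s hs⟩, hf s hs⟩
  have h2 : (S₁ ⊓ LinearMap.ker d₁).map f₁ ≤ S₁.map f₁ ⊓ LinearMap.ker d₁' := by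
    rintro _ ⟨v, ⟨h1, h2⟩, rfl⟩
    exact ⟨⟨v, h1, rfl⟩, (hf' v h1).symm.trans (by rw [show d₁ v = 0 from h2, map_zero])⟩
  have h3 : (S₂ ⊓ LinearMap.ker f₂).map d₂ ≤ S₁ ⊓ LinearMap.ker f₁ ⊓ S₂.map d₂ := by
    rintro _ ⟨v, ⟨h1, h2⟩, rfl⟩
    exact ⟨⟨hd v h1, (hf v h1).trans (by rw [show f₂ v = 0 from h2, map_zero])⟩, ⟨v, h1, rfl⟩⟩
  have h4 : S₁ ⊓ LinearMap.ker f₁ ⊓ S₂.map d₂ ≤ S₁ ⊓ LinearMap.ker f₁ ⊓ LinearMap.ker d₁ := by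
    rintro _ ⟨h1, ⟨v, hv, rfl⟩⟩
    exact ⟨h1, hdd v hv⟩
  rw [relLen_homology_split d₂ d₁ d₂' f₂ f₁ S₂ S₁ hd hdd hf,
    relLen_connecting d₂ d₂' f₂ f₁ S₂ S₁ hd hf, relLen_add h1 h2, relLen_add h3 h4]
  abel

end Ladder

section

open scoped Pointwise

section MatrixComplex

variable {A : Type u} [CommRing A] {ι : Type w} [Fintype ι]

/-- The action of a square matrix on vectors with entries in a module. -/
def matAct (D : Matrix ι ι A) (N : Type v) [AddCommGroup N] [Module A N] :
    (ι → N) →ₗ[A] (ι → N) where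
  toFun v a := ∑ b, D a b • v b
  map_add' v w := by
    ext a
    simp [smul_add, Finset.sum_add_distrib]
  map_smul' c v := by
    ext a
    simp [Finset.smul_sum, smul_comm c]

/-- Vectors supported in degree `i`. -/
def degSub (A : Type u) [CommRing A] {ι : Type w} (deg : ι → ℕ) (N : Type v) [AddCommGroup N]
    [Module A N] (i : ℕ) : Submodule A (ι → N) where
  carrier := {v | ∀ b, deg b ≠ i → v b = 0}
  add_mem' hv hw b hb := by simp [hv b hb, hw b hb]
  zero_mem' b hb := rfl
  smul_mem' c v hv b hb := by simp [hv b hb]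

/-- A matrix of degree `-1`. -/
def IsLowering (deg : ι → ℕ) (D : Matrix ι ι A) : Prop :=
  ∀ a b, D a b ≠ 0 → deg b = deg a + 1

/-- Multiplication by `z` is null-homotopic on the complex given by `D`. -/
def NullHtpy (deg : ι → ℕ) [DecidableEq ι] (D : Matrix ι ι A) (z : A) : Prop :=
  ∃ H : Matrix ι ι A, IsLowering deg H.transpose ∧ D * H + H * D = z • (1 : Matrix ι ι A)

/-- The length of the `i`-th homology of the complex of free modules given by `D`, with
coefficients in `N`. -/
def hLen (deg : ι → ℕ) (D : Matrix ι ι A) (N : Type v) [AddCommGroup N] [Module A N] (i : ℕ) :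
    ℕ∞ :=
  relLen (degSub A deg N i ⊓ LinearMap.ker (matAct D N)) ((degSub A deg N (i + 1)).map (matAct D N))

variable {N : Type v} [AddCommGroup N] [Module A N] {deg : ι → ℕ} {D : Matrix ι ι A}

theorem matAct_apply (D : Matrix ι ι A) (v : ι → N) (a : ι) :
    matAct D N v a = ∑ b, D a b • v b := rfl

theorem matAct_mul (D E : Matrix ι ι A) (v : ι → N) :
    matAct (D * E) N v = matAct D N (matAct E N v) := by
  ext a
  simp only [matAct_apply, Matrix.mul_apply, Finset.sum_smul, Finset.smul_sum, mul_smul]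
  exact Finset.sum_comm

theorem matAct_add (D E : Matrix ι ι A) (v : ι → N) :
    matAct (D + E) N v = matAct D N v + matAct E N v := by
  ext a
  simp [matAct_apply, add_smul, Finset.sum_add_distrib]

theorem matAct_smul_one [DecidableEq ι] (z : A) (v : ι → N) :
    matAct (z • (1 : Matrix ι ι A)) N v = z • v := by
  ext a
  simp [matAct_apply, Matrix.one_apply, Finset.sum_ite_eq]

theorem matAct_sq (h : D * D = 0) (v : ι → N) : matAct D N (matAct D N v) = 0 := by
  rw [← matAct_mul, h]
  ext a
  simp [matAct_apply]

theorem IsLowering.matAct_mem (h : IsLowering deg D) {i : ℕ} {v : ι → N}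
    (hv : v ∈ degSub A deg N (i + 1)) : matAct D N v ∈ degSub A deg N i := by
  intro a ha
  rw [matAct_apply]
  refine Finset.sum_eq_zero fun b _ => ?_
  by_cases hD : D a b = 0
  · rw [hD, zero_smul]
  · rw [hv b (by rw [h a b hD]; simpa using ha), smul_zero]

theorem IsLowering.matAct_transpose_mem {H : Matrix ι ι A} (h : IsLowering deg H.transpose) {i : ℕ}
    {v : ι → N} (hv : v ∈ degSub A deg N i) : matAct H N v ∈ degSub A deg N (i + 1) := by
  intro a ha
  rw [matAct_apply]
  refine Finset.sum_eq_zero fun b _ => ?_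
  by_cases hD : H a b = 0
  · rw [hD, zero_smul]
  · rw [hv b fun hb => ha (by rw [h b a hD, hb]), smul_zero]

theorem NullHtpy.smul_mem [DecidableEq ι] {z : A} (h : NullHtpy deg D z) {i : ℕ} {v : ι → N}
    (hv : v ∈ degSub A deg N i ⊓ LinearMap.ker (matAct D N)) :
    z • v ∈ (degSub A deg N (i + 1)).map (matAct D N) := by
  obtain ⟨H, hH, hz⟩ := h
  refine ⟨matAct H N v, hH.matAct_transpose_mem hv.1, ?_⟩
  rw [← matAct_smul_one, ← hz, matAct_add, matAct_mul, matAct_mul H D,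
    show matAct D N v = 0 from hv.2, map_zero, add_zero]

/-- The coordinatewise map. -/
def piMap (ι : Type w) {N : Type*} [AddCommGroup N] [Module A N] {N' : Type*} [AddCommGroup N']
    [Module A N'] (f : N →ₗ[A] N') : (ι → N) →ₗ[A] (ι → N') :=
  f.compLeft ι

variable {N' : Type*} [AddCommGroup N'] [Module A N'] {N'' : Type*} [AddCommGroup N'']
  [Module A N'']

theorem piMap_apply (f : N →ₗ[A] N') (v : ι → N) (a : ι) : piMap ι f v a = f (v a) := rfl

theorem piMap_matAct (f : N →ₗ[A] N') (v : ι → N) :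
    piMap ι f (matAct D N v) = matAct D N' (piMap ι f v) := by
  ext a
  simp [piMap_apply, matAct_apply]

theorem degSub_map_piMap {f : N →ₗ[A] N'} (hf : Function.Surjective f) (i : ℕ) :
    (degSub A deg N i).map (piMap ι f) = degSub A deg N' i := by
  classical
  ext y
  constructor
  · rintro ⟨v, hv, rfl⟩ b hb
    rw [piMap_apply, hv b hb, map_zero]
  · intro hy
    choose g hg using hf
    refine ⟨fun b => if deg b = i then g (y b) else 0, fun b hb => if_neg hb, ?_⟩
    ext b
    rw [piMap_apply]
    split_ifs with hb
    · rw [hg]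
    · rw [map_zero, hy b hb]

theorem relLen_ker_piMap {j : N' →ₗ[A] N} {f : N →ₗ[A] N''} (hj : Function.Injective j)
    (hjf : Function.Exact j f) (i : ℕ) :
    relLen (degSub A deg N i ⊓ LinearMap.ker (piMap ι f) ⊓ LinearMap.ker (matAct D N))
      ((degSub A deg N (i + 1) ⊓ LinearMap.ker (piMap ι f)).map (matAct D N)) =
      hLen deg D N' i := by
  have lift (k : ℕ) {v : ι → N} (hv : v ∈ degSub A deg N k ⊓ LinearMap.ker (piMap ι f)) :
      ∃ w ∈ degSub A deg N' k, piMap ι j w = v := by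
    have h1 : ∀ b, ∃ n, j n = v b := fun b => (hjf (v b)).1 (congrFun hv.2 b)
    choose w hw using h1
    refine ⟨w, fun b hb => hj ?_, funext hw⟩
    rw [hw, hv.1 b hb, map_zero]
  have inj : Function.Injective (piMap ι j) := fun v w h =>
    funext fun b => hj (congrFun h b)
  have mem (k : ℕ) {w : ι → N'} (hw : w ∈ degSub A deg N' k) :
      piMap ι j w ∈ degSub A deg N k ⊓ LinearMap.ker (piMap ι f) := by
    refine ⟨fun b hb => ?_, ?_⟩
    · rw [piMap_apply, hw b hb, map_zero]
    · exact funext fun b => (hjf _).2 ⟨w b, rfl⟩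
  refine relLen_eq_of_bij (piMap ι j) (fun w hw => ⟨mem i hw.1, ?_⟩) (fun w hw => ⟨?_, ?_⟩) ?_
  · change matAct D N _ = 0
    rw [← piMap_matAct, show matAct D N' w = 0 from hw.2, map_zero]
  · rintro ⟨v, hv, hvw⟩
    obtain ⟨t, ht, rfl⟩ := lift _ hv
    rw [← piMap_matAct] at hvw
    exact ⟨t, ht, inj hvw⟩
  · rintro ⟨t, ht, rfl⟩
    exact ⟨piMap ι j t, mem _ ht, (piMap_matAct _ _).symm⟩
  · rintro v hv
    obtain ⟨t, ht, rfl⟩ := lift _ hv.1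
    refine ⟨t, ⟨ht, inj ?_⟩, by simp⟩
    rw [piMap_matAct, map_zero]
    exact hv.2

theorem hLen_le_add {j : N' →ₗ[A] N} {f : N →ₗ[A] N''} (hj : Function.Injective j)
    (hf : Function.Surjective f) (hjf : Function.Exact j f) (hD : IsLowering deg D)
    (hDD : D * D = 0) (i : ℕ) :
    hLen deg D N i ≤ hLen deg D N' i + hLen deg D N'' i := by
  rw [hLen, relLen_homology_split (matAct D N) (matAct D N) (matAct D N'') (piMap ι f) (piMap ι f)
    _ _ (fun v hv => hD.matAct_mem hv) (fun v _ => matAct_sq hDD v)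
    (fun v _ => piMap_matAct f v), add_comm]
  refine add_le_add ?_ ?_
  · rw [← relLen_ker_piMap (D := D) (deg := deg) hj hjf i]
    refine relLen_anti_right _ ?_
    rintro _ ⟨v, ⟨h1, h2⟩, rfl⟩
    refine ⟨⟨hD.matAct_mem h1, ?_⟩, ⟨v, h1, rfl⟩⟩
    change piMap ι f _ = 0
    rw [piMap_matAct, show piMap ι f v = 0 from h2, map_zero]
  · rw [degSub_map_piMap hf]
    refine relLen_mono_left ?_
    rintro _ ⟨v, ⟨h1, h2⟩, rfl⟩
    refine ⟨(degSub_map_piMap hf i).le ⟨v, h1, rfl⟩, ?_⟩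
    change matAct D N'' _ = 0
    rw [← piMap_matAct, show matAct D N v = 0 from h2, map_zero]

theorem hLen_eq_zero_of_lt {r : ℕ} (hr : ∀ b, deg b ≤ r) {i : ℕ} (hi : r < i) :
    hLen deg D N i = 0 :=
  relLen_eq_zero fun v hv => by
    rw [show v = 0 from funext fun b => hv.1 b fun h => by have := hr b; omega]
    exact zero_mem _

theorem hLen_le_length (i : ℕ) : hLen deg D N i ≤ Fintype.card ι * Module.length A N := by
  refine (relLen_le_length _ _).trans ?_
  rw [Module.length_pi, ENat.card_eq_coe_fintype_card]

/-- If `x` is `N`-regular and kills `H_i` then `H_{i+1}` of `N / xN` surjects onto `H_i`. -/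
theorem hLen_le_hLen_quotSMulTop_succ (hD : IsLowering deg D) (hDD : D * D = 0) {x : A}
    (hx : IsSMulRegular N x) (i : ℕ)
    (hk : ∀ v ∈ degSub A deg N i ⊓ LinearMap.ker (matAct D N),
      x • v ∈ (degSub A deg N (i + 1)).map (matAct D N)) :
    hLen deg D N i ≤ hLen deg D (QuotSMulTop x N) (i + 1) := by
  let f : N →ₗ[A] QuotSMulTop x N := Submodule.mkQ _
  have hf : Function.Surjective f := Submodule.mkQ_surjective _
  have hjf : Function.Exact (LinearMap.lsmul A N x) f := by
    intro n
    rw [show f n = 0 ↔ n ∈ x • (⊤ : Submodule A N) from Submodule.Quotient.mk_eq_zero _,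
      Submodule.mem_smul_pointwise_iff_exists]
    simp
  rw [← relLen_ker_piMap (D := D) (deg := deg) (j := LinearMap.lsmul A N x) hx hjf i]
  have h1 := relLen_connecting (matAct D N) (matAct D (QuotSMulTop x N)) (piMap ι f) (piMap ι f)
    (degSub A deg N (i + 1)) (degSub A deg N i) (fun v hv => hD.matAct_mem hv)
    (fun v _ => piMap_matAct f v)
  refine (relLen_mono_left ?_).trans (h1.symm.le.trans ?_)
  · rintro v hv
    refine ⟨hv.1, ?_⟩
    have h2 : ∀ b, ∃ n, x • n = v b := fun b => (hjf (v b)).1 (congrFun hv.1.2 b)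
    choose w hw using h2
    obtain rfl : x • w = v := funext hw
    refine hk w ⟨fun b hb => ?_, ?_⟩
    · have h3 := hv.1.1 b hb
      exact hx (h3.trans (smul_zero x).symm)
    · have h4 : matAct D N (x • w) = 0 := hv.2
      rw [map_smul] at h4
      exact funext fun b => hx ((congrFun h4 b).trans (smul_zero x).symm)
  · rw [degSub_map_piMap hf]
    refine relLen_anti_right _ ?_
    rintro _ ⟨v, hv, rfl⟩
    obtain ⟨w, hw, rfl⟩ := (degSub_map_piMap hf (i + 1 + 1)).ge hv
    exact ⟨matAct D N w, ⟨hD.matAct_mem hw, matAct_sq hDD w⟩, piMap_matAct _ _⟩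

theorem hLen_quotSMulTop_pow_le (hD : IsLowering deg D) (hDD : D * D = 0) {x : A}
    (hx : IsSMulRegular N x) (i q : ℕ) :
    hLen deg D (QuotSMulTop (x ^ q) N) i ≤ q * hLen deg D (QuotSMulTop x N) i := by
  induction q with
  | zero =>
    have : Subsingleton (QuotSMulTop (x ^ 0) N) := by
      rw [Submodule.Quotient.subsingleton_iff, pow_zero, one_smul]
    refine (hLen_le_length i).trans ?_
    rw [Module.length_eq_zero, mul_zero, Nat.cast_zero, zero_mul]
  | succ q ih =>
    have hmem (y : A) (n : N) : n ∈ y • (⊤ : Submodule A N) ↔ ∃ t, y • t = n := by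
      rw [Submodule.mem_smul_pointwise_iff_exists]
      simp
    let j : QuotSMulTop (x ^ q) N →ₗ[A] QuotSMulTop (x ^ (q + 1)) N :=
      Submodule.mapQ _ _ (LinearMap.lsmul A N x) (by
        intro n hn
        obtain ⟨t, rfl⟩ := (hmem _ _).1 hn
        refine (hmem _ _).2 ⟨t, ?_⟩
        rw [pow_succ', mul_smul]
        rfl)
    let f : QuotSMulTop (x ^ (q + 1)) N →ₗ[A] QuotSMulTop x N :=
      Submodule.mapQ _ _ LinearMap.id (by
        intro n hn
        obtain ⟨t, rfl⟩ := (hmem _ _).1 hn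
        refine (hmem _ _).2 ⟨x ^ q • t, ?_⟩
        rw [pow_succ', mul_smul])
    have hj : Function.Injective j := by
      rw [← LinearMap.ker_eq_bot, LinearMap.ker_eq_bot']
      intro y hy
      obtain ⟨n, rfl⟩ := Submodule.Quotient.mk_surjective _ y
      obtain ⟨t, ht⟩ := (hmem _ _).1 ((Submodule.Quotient.mk_eq_zero _).1 hy)
      refine (Submodule.Quotient.mk_eq_zero _).2 ((hmem _ _).2 ⟨t, hx ?_⟩)
      rw [pow_succ', mul_smul] at ht
      exact ht
    have hf : Function.Surjective f := by
      intro y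
      obtain ⟨n, rfl⟩ := Submodule.Quotient.mk_surjective _ y
      exact ⟨Submodule.Quotient.mk n, rfl⟩
    have hjf : Function.Exact j f := by
      intro y
      obtain ⟨n, rfl⟩ := Submodule.Quotient.mk_surjective _ y
      refine (Submodule.Quotient.mk_eq_zero (x • (⊤ : Submodule A N))).trans ((hmem _ _).trans ?_)
      constructor
      · rintro ⟨t, ht⟩
        exact ⟨Submodule.Quotient.mk t, by
          obtain rfl : x • t = n := ht
          rfl⟩
      · rintro ⟨y, hy⟩
        obtain ⟨t, rfl⟩ := Submodule.Quotient.mk_surjective _ y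
        obtain ⟨s, hs⟩ := (hmem _ _).1 ((Submodule.Quotient.eq (x ^ (q + 1) • ⊤)).1 hy)
        refine ⟨t - x ^ q • s, ?_⟩
        rw [smul_sub, ← mul_smul, ← pow_succ', hs]
        exact sub_sub_cancel _ _
    refine (hLen_le_add hj hf hjf hD hDD i).trans ?_
    rw [Nat.cast_add, Nat.cast_one, add_mul, one_mul]
    gcongr

end MatrixComplex

end

section Frobenius

variable {A : Type u} [CommRing A] {ι : Type w} [Fintype ι] {deg : ι → ℕ} {D : Matrix ι ι A}

theorem IsLowering.map (h : IsLowering deg D) {B : Type*} [CommRing B] (φ : A →+* B) :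
    IsLowering deg (D.map φ) := fun a b hab => h a b fun h0 => hab (by simp [h0])

theorem NullHtpy.map [DecidableEq ι] {z : A} (h : NullHtpy deg D z) {B : Type*} [CommRing B]
    (φ : A →+* B) : NullHtpy deg (D.map φ) (φ z) := by
  obtain ⟨H, hH, hz⟩ := h
  refine ⟨H.map φ, hH.map φ, ?_⟩
  rw [← Matrix.map_mul, ← Matrix.map_mul, ← Matrix.map_add φ (map_add φ), hz]
  ext a b
  simp [Matrix.one_apply, apply_ite φ]

theorem map_mul_self_eq_zero (h : D * D = 0) {B : Type*} [CommRing B] (φ : A →+* B) :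
    D.map φ * D.map φ = 0 := by
  rw [← Matrix.map_mul, h]
  ext a b
  simp

theorem length_ne_top_of_supportDim_le_zero [IsNoetherianRing A] (N : Type v) [AddCommGroup N]
    [Module A N] [Module.Finite A N] (h : Module.supportDim A N ≤ (0 : ℕ)) :
    Module.length A N ≠ ⊤ := by
  rw [Module.supportDim_eq_ringKrullDim_quotient_annihilator, ← Ring.krullDimLE_iff] at h
  let := Module.quotientAnnihilator (R := A) (M := N)
  have : IsScalarTower A (A ⧸ Module.annihilator A N) N :=
    Module.IsTorsionBySet.isScalarTower _
  have : Module.Finite (A ⧸ Module.annihilator A N) N :=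
    Module.Finite.of_restrictScalars_finite A _ _
  have : IsArtinianRing (A ⧸ Module.annihilator A N) :=
    isArtinianRing_iff_krullDimLE_zero.2 h
  rw [Module.length_eq_of_surjective (R := A ⧸ Module.annihilator A N) Ideal.Quotient.mk_surjective]
  exact Module.length_ne_top

/-- Growth of the lengths of the homology of the Frobenius twists of a complex which is exact
on the punctured spectrum. -/
theorem exists_hLen_frobenius_le [IsNoetherianRing A] [IsLocalRing A] [DecidableEq ι]
    (p : ℕ) [Fact p.Prime] [CharP A p] (hD : IsLowering deg D) (hDD : D * D = 0)
    {r : ℕ} (hr : ∀ b, deg b ≤ r)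
    (hJ : ∀ P : Ideal A, P.IsPrime → P ≠ IsLocalRing.maximalIdeal A →
      ∃ x, x ∉ P ∧ NullHtpy deg D x) (e : ℕ) :
    ∀ (N : Type u) [AddCommGroup N] [Module A N], Module.Finite A N →
      Module.supportDim A N ≤ (e : ℕ) → ∃ C : ℕ, ∀ n i : ℕ,
        hLen deg (D.map (iterateFrobenius A p n)) N i ≤ (C * (p ^ n) ^ e : ℕ) ∧
        (r + 1 ≤ i + e →
          (p ^ n : ℕ) * hLen deg (D.map (iterateFrobenius A p n)) N i ≤ (C * (p ^ n) ^ e : ℕ)) := by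
  induction e with
  | zero =>
    intro N _ _ hN hdim
    have hfin := length_ne_top_of_supportDim_le_zero N hdim
    obtain ⟨l, hl⟩ := ENat.ne_top_iff_exists.1 hfin
    refine ⟨Fintype.card ι * l, fun n i => ⟨?_, fun hi => ?_⟩⟩
    · refine (hLen_le_length i).trans ?_
      rw [← hl]
      simp
    · rw [hLen_eq_zero_of_lt hr (by omega), mul_zero]
      exact zero_le
  | succ e ih =>
    intro N _ _ hN
    induction hN using IsNoetherianRing.induction_on_isQuotientEquivQuotientPrime A with
    | subsingleton N =>
      intro _
      refine ⟨0, fun n i => ?_⟩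
      have : hLen deg (D.map (iterateFrobenius A p n)) N i = 0 := by
        refine le_antisymm ((hLen_le_length i).trans ?_) zero_le
        rw [Module.length_eq_zero, mul_zero]
      rw [this]
      simp
    | exact N₁ N₂ N₃ f g hf hg hfg ih₁ ih₃ =>
      intro hdim
      obtain ⟨C₁, h₁⟩ := ih₁ ((Module.supportDim_le_of_injective f hf).trans hdim)
      obtain ⟨C₃, h₃⟩ := ih₃ ((Module.supportDim_le_of_surjective g hg).trans hdim)
      refine ⟨C₁ + C₃, fun n i => ?_⟩
      have key := hLen_le_add hf hg hfg (hD.map (iterateFrobenius A p n))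
        (map_mul_self_eq_zero hDD _) i
      rw [add_mul, Nat.cast_add]
      refine ⟨key.trans (add_le_add (h₁ n i).1 (h₃ n i).1), fun hi => ?_⟩
      refine (mul_le_mul_right key _).trans ?_
      rw [mul_add]
      exact add_le_add ((h₁ n i).2 hi) ((h₃ n i).2 hi)
    | quotient N P eP =>
      intro hdim
      by_cases hP : P.1 = IsLocalRing.maximalIdeal A
      · refine ⟨Fintype.card ι, fun n i => ?_⟩
        have hl : Module.length A N = 1 := by
          rw [eP.length_eq, hP]
          have : IsSimpleModule A (A ⧸ IsLocalRing.maximalIdeal A) :=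
            isSimpleModule_iff_isCoatom.2 (IsLocalRing.maximalIdeal.isMaximal A).out
          exact Module.length_eq_one A _
        have h1 : hLen deg (D.map (iterateFrobenius A p n)) N i ≤ (Fintype.card ι : ℕ) := by
          simpa [hl] using hLen_le_length (deg := deg) (D := D.map (iterateFrobenius A p n))
            (N := N) i
        have hq : 1 ≤ p ^ n := Nat.one_le_pow _ _ (Fact.out : p.Prime).pos
        refine ⟨h1.trans (Nat.cast_le.2 (Nat.le_mul_of_pos_right _ (by positivity))), fun _ => ?_⟩
        refine (mul_le_mul_right h1 _).trans ?_
        rw [← Nat.cast_mul, mul_comm]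
        refine Nat.cast_le.2 (Nat.mul_le_mul_left _ ?_)
        rw [pow_succ]
        exact Nat.le_mul_of_pos_left _ (by positivity)
      · obtain ⟨x, hxP, hx⟩ := hJ P.1 P.2 hP
        have hreg : IsSMulRegular N x := by
          rw [isSMulRegular_iff_right_eq_zero_of_smul]
          intro n hn
          rw [← eP.map_eq_zero_iff]
          have h1 : x • eP n = 0 := by rw [← map_smul, hn, map_zero]
          obtain ⟨a, ha⟩ := Ideal.Quotient.mk_surjective (eP n)
          rw [← ha] at h1 ⊢
          have h2 : x * a ∈ P.1 := Ideal.Quotient.eq_zero_iff_mem.1 h1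
          exact Ideal.Quotient.eq_zero_iff_mem.2 ((P.2.mem_or_mem h2).resolve_left hxP)
        have hdim' : Module.supportDim A (QuotSMulTop x N) ≤ (e : ℕ) := by
          have h1 := Module.supportDim_quotSMulTop_succ_le_of_notMem_minimalPrimes (R := A) (M := N)
            (x := x) (by
              intro p hp
              rw [eP.annihilator_eq, Ideal.annihilator_quotient,
                Ideal.minimalPrimes_eq_subsingleton_self] at hp
              rw [Set.mem_singleton_iff.1 hp]
              exact hxP)
          have h2 := h1.trans hdim
          rw [Nat.cast_add, Nat.cast_one] at h2
          exact ENat.WithBot.add_le_add_one_right_iff.1 h2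
        obtain ⟨C, hC⟩ := ih (QuotSMulTop x N) inferInstance hdim'
        refine ⟨C, fun n i => ?_⟩
        have key : hLen deg (D.map (iterateFrobenius A p n)) N i ≤
            (p ^ n : ℕ) * hLen deg (D.map (iterateFrobenius A p n)) (QuotSMulTop x N) (i + 1) := by
          have hn := hx.map (iterateFrobenius A p n)
          rw [iterateFrobenius_def] at hn
          exact (hLen_le_hLen_quotSMulTop_succ (hD.map _) (map_mul_self_eq_zero hDD _)
            (hreg.pow _) i fun v hv => hn.smul_mem hv).trans
            (hLen_quotSMulTop_pow_le (hD.map _) (map_mul_self_eq_zero hDD _) hreg _ _)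
        have e1 : C * (p ^ n) ^ (e + 1) = p ^ n * (C * (p ^ n) ^ e) := by ring
        rw [e1, Nat.cast_mul]
        refine ⟨key.trans (mul_le_mul_right (hC n (i + 1)).1 _), fun hi => ?_⟩
        exact mul_le_mul_right (key.trans ((hC n (i + 1)).2 (by omega))) _

end Frobenius

section LowerBound

variable {A : Type u} [CommRing A]

theorem exists_mem_support_le_supportDim_quotient {N : Type v} [AddCommGroup N] [Module A N]
    {d : ℕ} (h : (d : ℕ) ≤ Module.supportDim A N) :
    ∃ P ∈ Module.support A N, (d : ℕ) ≤ Module.supportDim A (A ⧸ P.asIdeal) := by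
  obtain ⟨l, hl⟩ := Order.le_krullDim_iff.1 h
  refine ⟨l.head.1, l.head.2, Order.le_krullDim_iff.2 ?_⟩
  let l' : LTSeries (Module.support A (A ⧸ l.head.1.asIdeal)) :=
    { length := l.length
      toFun i := ⟨(l i).1, by
        rw [Module.mem_support_iff_of_finite, Ideal.annihilator_quotient]
        exact LTSeries.head_le l i⟩
      step := l.step }
  exact ⟨l', hl⟩

theorem add_pow_succ_le (m k d : ℕ) :
    (m + k) ^ (d + 1) ≤ m ^ (d + 1) + (d + 1) * k * (m + k) ^ d := by
  induction d with
  | zero => simp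
  | succ d ih =>
    have h1 : m ^ (d + 1) ≤ (m + k) ^ (d + 1) := Nat.pow_le_pow_left (by omega) _
    calc (m + k) ^ (d + 1 + 1) = (m + k) * (m + k) ^ (d + 1) := by ring
      _ ≤ (m + k) * (m ^ (d + 1) + (d + 1) * k * (m + k) ^ d) := by gcongr
      _ = m ^ (d + 1 + 1) + k * m ^ (d + 1) + (d + 1) * k * (m + k) ^ (d + 1) := by ring
      _ ≤ m ^ (d + 1 + 1) + k * (m + k) ^ (d + 1) + (d + 1) * k * (m + k) ^ (d + 1) := by gcongr
      _ = _ := by ring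

theorem exists_pow_sub_colon_le [IsNoetherianRing A] (I : Ideal A) (P : Ideal A) [P.IsPrime]
    {x : A} (hx : x ∉ P) : ∃ k, ∀ n a, k ≤ n → x * a ∈ P ⊔ I ^ n → a ∈ P ⊔ I ^ (n - k) := by
  let N : Submodule A (A ⧸ P) := LinearMap.range (LinearMap.lsmul A (A ⧸ P) x)
  obtain ⟨k, hk⟩ := Ideal.exists_pow_inf_eq_pow_smul I N
  refine ⟨k, fun n a hn ha => ?_⟩
  have h1 : (Ideal.Quotient.mk P (x * a)) ∈ I ^ n • (⊤ : Submodule A (A ⧸ P)) ⊓ N := by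
    refine ⟨?_, ⟨Ideal.Quotient.mk P a, rfl⟩⟩
    obtain ⟨b, hb, c, hc, hbc⟩ := Submodule.mem_sup.1 ha
    have : Ideal.Quotient.mk P (x * a) = c • (1 : A ⧸ P) := by
      rw [← hbc, map_add, Ideal.Quotient.eq_zero_iff_mem.2 hb, zero_add, Algebra.smul_def, mul_one]
      rfl
    rw [this]
    exact Submodule.smul_mem_smul hc trivial
  rw [hk n hn] at h1
  have h2 : Ideal.Quotient.mk P (x * a) ∈ I ^ (n - k) • N :=
    Submodule.smul_mono le_rfl inf_le_right h1
  have h3 : N = Submodule.map (LinearMap.lsmul A (A ⧸ P) x) ⊤ := by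
    rw [Submodule.map_top]
  rw [h3, ← Submodule.map_smul''] at h2
  obtain ⟨y, hy, hya⟩ := h2
  have h4 : (⊤ : Submodule A (A ⧸ P)) = Submodule.map P.mkQ ⊤ := by
    rw [Submodule.map_top, Submodule.range_mkQ]
  rw [h4, ← Submodule.map_smul''] at hy
  obtain ⟨b, hb, rfl⟩ := hy
  have hb' : b ∈ I ^ (n - k) := by simpa using hb
  have h5 : x * (a - b) ∈ P := by
    rw [← Ideal.Quotient.eq_zero_iff_mem, mul_sub, map_sub, ← hya, sub_eq_zero]
    rfl
  have h6 := ((inferInstance : P.IsPrime).mem_or_mem h5).resolve_left hx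
  have : a = (a - b) + b := by ring
  rw [this]
  exact Submodule.add_mem_sup h6 hb'

/-- The Hilbert-Samuel function grows at least like a polynomial of degree the dimension. -/
theorem exists_pow_le_length_quotient_pow [IsNoetherianRing A] [IsLocalRing A] (d : ℕ) :
    ∀ I : Ideal A, (d : ℕ) ≤ Module.supportDim A (A ⧸ I) →
      ∃ C : ℕ, ∀ n : ℕ, 1 ≤ n →
        ((n ^ d : ℕ) : ℕ∞) ≤ C * relLen ⊤ (I ⊔ IsLocalRing.maximalIdeal A ^ n) := by
  have hpos : ∀ I : Ideal A, I ≠ ⊤ → ∀ n : ℕ, 1 ≤ n →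
      1 ≤ relLen ⊤ (I ⊔ IsLocalRing.maximalIdeal A ^ n) := by
    intro I hI n hn
    rw [relLen_top, Order.one_le_iff_ne_zero, Ne, Module.length_eq_zero_iff,
      Submodule.Quotient.subsingleton_iff]
    refine fun h => (IsLocalRing.maximalIdeal.isMaximal A).ne_top (top_le_iff.1 (h.symm.le.trans ?_))
    exact sup_le (IsLocalRing.le_maximalIdeal hI) (Ideal.pow_le_self (by omega))
  have hne : ∀ (d : ℕ) (I : Ideal A), (d : ℕ) ≤ Module.supportDim A (A ⧸ I) → I ≠ ⊤ := by
    rintro d I h rfl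
    rw [Module.supportDim_eq_bot_of_subsingleton, le_bot_iff] at h
    exact WithBot.coe_ne_bot h
  induction d with
  | zero =>
    intro I hI
    refine ⟨1, fun n hn => ?_⟩
    simpa using hpos I (hne 0 I hI) n hn
  | succ d ih =>
    intro I hI
    obtain ⟨P, hPI, hP⟩ := exists_mem_support_le_supportDim_quotient hI
    rw [Module.mem_support_iff_of_finite, Ideal.annihilator_quotient] at hPI
    have hPm : P.asIdeal ≠ IsLocalRing.maximalIdeal A := by
      intro h
      rw [h, Module.supportDim_quotient_eq_ringKrullDim,
        (ringKrullDim_eq_zero_of_isField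
          ((Ideal.Quotient.maximal_ideal_iff_isField_quotient _).1
            (IsLocalRing.maximalIdeal.isMaximal A)))] at hP
      have : (d + 1 : ℕ) ≤ 0 := by exact_mod_cast hP
      omega
    obtain ⟨x, hxm, hxP⟩ := SetLike.exists_of_lt
      (lt_of_le_of_ne (IsLocalRing.le_maximalIdeal P.2.ne_top) hPm)
    have hJ : (d : ℕ) ≤ Module.supportDim A (A ⧸ (P.asIdeal ⊔ Ideal.span {x})) := by
      have h1 := Module.supportDim_le_supportDim_quotSMulTop_succ (M := A ⧸ P.asIdeal) hxm
      have h2 : Module.supportDim A (QuotSMulTop x (A ⧸ P.asIdeal)) ≤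
          Module.supportDim A (A ⧸ (P.asIdeal ⊔ Ideal.span {x})) := by
        have hsub : ∀ Q ∈ Module.support A (QuotSMulTop x (A ⧸ P.asIdeal)),
            Q ∈ Module.support A (A ⧸ (P.asIdeal ⊔ Ideal.span {x})) := by
          intro Q hQ
          rw [Module.support_quotSMulTop] at hQ
          have hQ1 := hQ.1
          rw [Module.mem_support_iff_of_finite, Ideal.annihilator_quotient] at hQ1 ⊢
          refine sup_le hQ1 ?_
          rw [Ideal.span_le]
          exact hQ.2
        exact Order.krullDim_le_of_strictMono (fun Q => ⟨Q.1, hsub Q.1 Q.2⟩) (fun _ _ h => h)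
      have h3 := hP.trans (h1.trans (add_le_add_left h2 1))
      push_cast at h3
      exact ENat.WithBot.add_le_add_one_right_iff.1 h3
    obtain ⟨C₀, hC₀⟩ := ih _ hJ
    obtain ⟨k₀, hk₀⟩ := exists_pow_sub_colon_le (IsLocalRing.maximalIdeal A) P.asIdeal hxP
    let k := k₀ + 1
    let m := IsLocalRing.maximalIdeal A
    let f := fun n => relLen (⊤ : Submodule A A) (P.asIdeal ⊔ m ^ n)
    let g := fun n => relLen (⊤ : Submodule A A) (P.asIdeal ⊔ Ideal.span {x} ⊔ m ^ n)
    have hfg : ∀ n, g (n + k) + f n ≤ f (n + k) := by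
      intro n
      have h1 : f (n + k) = _ := relLen_add (Z := ⊤) (B := P.asIdeal ⊔ m ^ (n + k))
        (Y := P.asIdeal ⊔ Ideal.span {x} ⊔ m ^ (n + k)) (sup_le_sup_right le_sup_left _) le_top
      rw [h1]
      refine add_le_add le_rfl ?_
      have h2 : relLen (Submodule.map (LinearMap.lsmul A A x) ⊤) (P.asIdeal ⊔ m ^ (n + k)) ≤
          relLen (P.asIdeal ⊔ Ideal.span {x} ⊔ m ^ (n + k)) (P.asIdeal ⊔ m ^ (n + k)) := by
        refine relLen_mono_left ?_
        rintro _ ⟨a, -, rfl⟩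
        exact Submodule.mem_sup_left (Submodule.mem_sup_right
          (Ideal.mul_mem_right _ _ (Ideal.mem_span_singleton_self x)))
      refine le_trans ?_ h2
      let B : Submodule A A :=
        Submodule.comap (LinearMap.lsmul A A x) (P.asIdeal ⊔ m ^ (n + k) : Ideal A)
      have h3 : relLen ⊤ B =
          relLen (Submodule.map (LinearMap.lsmul A A x) ⊤) (P.asIdeal ⊔ m ^ (n + k)) := by
        symm
        refine relLen_eq_of_bij (LinearMap.lsmul A A x) (fun z hz => ⟨z, hz, rfl⟩)
          (fun z _ => Iff.rfl) ?_
        rintro _ ⟨z, hz, rfl⟩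
        exact ⟨z, hz, by simp⟩
      rw [← h3]
      refine relLen_anti_right _ fun a ha => ?_
      have := hk₀ (n + k) a (by omega) ha
      have hle : m ^ (n + k - k₀) ≤ m ^ n := Ideal.pow_le_pow_right (by omega)
      exact (sup_le_sup_left hle P.asIdeal) this
    let C := k ^ (d + 1) + (d + 1) * k * C₀
    have key : ∀ n : ℕ, 1 ≤ n → ((n ^ (d + 1) : ℕ) : ℕ∞) ≤ C * f n := by
      intro n
      induction n using Nat.strong_induction_on with
      | _ n IH =>
        intro hn
        by_cases hnk : n ≤ k
        · have h1 : n ^ (d + 1) ≤ C := (Nat.pow_le_pow_left hnk _).trans (Nat.le_add_right _ _)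
          calc ((n ^ (d + 1) : ℕ) : ℕ∞) ≤ C * 1 := by rw [mul_one]; exact_mod_cast h1
            _ ≤ C * f n := by gcongr; exact hpos _ P.2.ne_top n hn
        · obtain ⟨m', rfl⟩ : ∃ m', n = m' + k := ⟨n - k, by omega⟩
          have h1 := IH m' (by omega) (by omega)
          have h2 := hC₀ (m' + k) hn
          calc (((m' + k) ^ (d + 1) : ℕ) : ℕ∞)
              ≤ ((m' ^ (d + 1) + (d + 1) * k * (m' + k) ^ d : ℕ) : ℕ∞) := by
                exact_mod_cast add_pow_succ_le m' k d
            _ = (m' ^ (d + 1) : ℕ) + ((d + 1) * k : ℕ) * ((m' + k) ^ d : ℕ) := by push_cast; ring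
            _ ≤ C * f m' + ((d + 1) * k : ℕ) * (C₀ * g (m' + k)) := by gcongr
            _ = C * f m' + ((d + 1) * k * C₀ : ℕ) * g (m' + k) := by push_cast; ring
            _ ≤ C * f m' + C * g (m' + k) := by
                gcongr
                exact Nat.le_add_left _ _
            _ = C * (g (m' + k) + f m') := by ring
            _ ≤ C * f (m' + k) := by gcongr; exact hfg m'
    refine ⟨C, fun n hn => (key n hn).trans ?_⟩
    gcongr
    exact relLen_anti_right _ (sup_le_sup_right hPI _)

end LowerBound

section CharP

variable {A : Type u} [CommRing A] {ι : Type w} [Fintype ι] {deg : ι → ℕ} {D : Matrix ι ι A}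

theorem IsLowering.degSub_zero_le_ker (hD : IsLowering deg D) {N : Type v} [AddCommGroup N]
    [Module A N] : degSub A deg N 0 ≤ LinearMap.ker (matAct D N) := by
  intro v hv
  rw [LinearMap.mem_ker]
  ext a
  rw [matAct_apply]
  refine Finset.sum_eq_zero fun b _ => ?_
  by_cases hab : D a b = 0
  · rw [hab, zero_smul]
  · rw [hv b (by rw [hD a b hab]; omega), smul_zero]

theorem relLen_top_le_hLen_zero [DecidableEq ι] (hD : IsLowering deg D) {a : ι} (ha : deg a = 0)
    {I : Ideal A} (hI : ∀ b, D a b ∈ I) : relLen ⊤ I ≤ hLen deg D A 0 := by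
  refine relLen_le_of_surj (LinearMap.proj a) (by simp) ?_ ?_
  · rintro _ - ⟨v, -, rfl⟩
    exact Submodule.sum_mem _ fun b _ => Ideal.mul_mem_right _ _ (hI b)
  · intro z _
    have h0 : (Pi.single a z : ι → A) ∈ degSub A deg A 0 := by
      intro b hb
      rw [Pi.single_eq_of_ne]
      rintro rfl
      exact hb ha
    exact ⟨Pi.single a z, ⟨h0, hD.degSub_zero_le_ker h0⟩, by simp⟩

variable [IsNoetherianRing A] [IsLocalRing A] [DecidableEq ι]

theorem exists_pow_le_hLen_frobenius_zero (p : ℕ) [Fact p.Prime] [CharP A p] (hD : IsLowering deg D) {a : ι} (ha : deg a = 0)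
    (haD : ∀ b, D a b ∈ IsLocalRing.maximalIdeal A) {e : ℕ} (he : (e : ℕ) ≤ ringKrullDim A) :
    ∃ C : ℕ, ∀ n, (((p ^ n) ^ e : ℕ) : ℕ∞) ≤
      C * hLen deg (D.map (iterateFrobenius A p n)) A 0 := by
  have he' : (e : ℕ) ≤ Module.supportDim A (A ⧸ (⊥ : Ideal A)) := by
    rw [Module.supportDim_quotient_eq_ringKrullDim]
    refine he.trans (ringKrullDim_eq_of_ringEquiv (RingEquiv.quotientBot A).symm).le
  obtain ⟨C, hC⟩ := exists_pow_le_length_quotient_pow e ⊥ he'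
  refine ⟨C, fun n => (hC (p ^ n) (Nat.one_le_pow _ _ (Fact.out : p.Prime).pos)).trans ?_⟩
  gcongr
  rw [bot_sup_eq]
  refine relLen_top_le_hLen_zero (hD.map _) ha fun b => ?_
  rw [Matrix.map_apply, iterateFrobenius_def]
  exact Ideal.pow_mem_pow (haD b) _

/-- The new intersection theorem in characteristic `p`. -/
theorem ringKrullDim_le_of_charP (p : ℕ) [Fact p.Prime] [CharP A p] (hD : IsLowering deg D) (hDD : D * D = 0)
    {r : ℕ} (hr : ∀ b, deg b ≤ r)
    (hJ : ∀ P : Ideal A, P.IsPrime → P ≠ IsLocalRing.maximalIdeal A →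
      ∃ x, x ∉ P ∧ NullHtpy deg D x) {a : ι} (ha : deg a = 0)
    (haD : ∀ b, D a b ∈ IsLocalRing.maximalIdeal A) : ringKrullDim A ≤ r := by
  by_contra hlt
  obtain ⟨e, he⟩ : ∃ e : ℕ, ringKrullDim A = e := by
    have h1 : ringKrullDim A ≠ ⊤ := ringKrullDim_ne_top
    have h2 : ringKrullDim A ≠ ⊥ := ringKrullDim_ne_bot
    generalize ringKrullDim A = x at h1 h2
    induction x with
    | bot => exact absurd rfl h2
    | coe x =>
      induction x with
      | top => exact absurd rfl h1
      | coe x => exact ⟨x, rfl⟩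
  have her : r + 1 ≤ e := by
    rw [he] at hlt
    by_contra h
    exact hlt (by exact_mod_cast (by omega : e ≤ r))
  obtain ⟨C, hC⟩ := exists_pow_le_hLen_frobenius_zero p hD ha haD he.ge
  obtain ⟨C', hC'⟩ := exists_hLen_frobenius_le p hD hDD hr hJ e A inferInstance
    (by rw [Module.supportDim_self_eq_ringKrullDim, he])
  have key : ∀ n, p ^ n ≤ C * C' := by
    intro n
    have h1 := hC n
    have h2 := (hC' n 0).2 (by omega)
    have h3 : ((p ^ n * (p ^ n) ^ e : ℕ) : ℕ∞) ≤ ((C * C' * (p ^ n) ^ e : ℕ) : ℕ∞) := by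
      calc ((p ^ n * (p ^ n) ^ e : ℕ) : ℕ∞) = (p ^ n : ℕ) * ((p ^ n) ^ e : ℕ) := by push_cast; ring
        _ ≤ (p ^ n : ℕ) * (C * hLen deg (D.map (iterateFrobenius A p n)) A 0) := by gcongr
        _ = C * ((p ^ n : ℕ) * hLen deg (D.map (iterateFrobenius A p n)) A 0) := by ring
        _ ≤ C * ((C' * (p ^ n) ^ e : ℕ) : ℕ∞) := by gcongr
        _ = _ := by push_cast; ring
    exact Nat.le_of_mul_le_mul_right (by exact_mod_cast h3)
      (pow_pos (pow_pos (Fact.out : p.Prime).pos _) _)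
  exact absurd (key (C * C')) (not_le.2 (Nat.lt_pow_self (Fact.out : p.Prime).one_lt))

end CharP

section Euler

variable {A : Type u} [CommRing A] {C : ℕ → Type v} [∀ n, AddCommGroup (C n)]
  [∀ n, Module A (C n)] {C' : ℕ → Type w} [∀ n, AddCommGroup (C' n)] [∀ n, Module A (C' n)]

/-- The length of the `n`-th homology of a family of submodules stable under a differential. -/
def subLen (d : ∀ n, C n →ₗ[A] C (n - 1)) (W : ∀ n, Submodule A (C n)) (n : ℕ) : ℕ∞ :=
  relLen (W n ⊓ LinearMap.ker (d n)) ((W (n + 1)).map (d (n + 1)))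

/-- The alternating sum of the first `L + 1` values of `h`. -/
def altSum (L : ℕ) (h : ℕ → ℕ∞) : ℤ :=
  ∑ n ∈ Finset.range (L + 1), (-1) ^ n * ((h n).toNat : ℤ)

theorem altSum_telescope (L : ℕ) (κ : ℕ → ℤ) :
    ∑ n ∈ Finset.range (L + 1), (-1) ^ n * (κ n + κ (n + 1)) = κ 0 + (-1) ^ L * κ (L + 1) := by
  induction L with
  | zero => simp
  | succ L ih =>
    rw [Finset.sum_range_succ, ih]
    ring

theorem altSum_subLen_add {d : ∀ n, C n →ₗ[A] C (n - 1)} {d' : ∀ n, C' n →ₗ[A] C' (n - 1)}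
    {f : ∀ n, C n →ₗ[A] C' n} {W : ∀ n, Submodule A (C n)} {L : ℕ}
    (hd : ∀ n, ∀ v ∈ W (n + 1), d (n + 1) v ∈ W n)
    (hdd : ∀ n, ∀ v ∈ W (n + 1), d n (d (n + 1) v) = 0)
    (hf : ∀ n, ∀ v ∈ W n, f (n - 1) (d n v) = d' n (f n v))
    (h0 : d 0 = 0) (hL : W (L + 1) = ⊥)
    (h1 : ∀ n, subLen d (fun n => W n ⊓ LinearMap.ker (f n)) n ≠ ⊤)
    (h2 : ∀ n, subLen d' (fun n => (W n).map (f n)) n ≠ ⊤) :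
    altSum L (subLen d W) = altSum L (subLen d fun n => W n ⊓ LinearMap.ker (f n)) +
      altSum L (subLen d' fun n => (W n).map (f n)) := by
  let κ : ℕ → ℕ∞ := fun n => relLen ((W n).map (f n) ⊓ LinearMap.ker (d' n))
    ((W n ⊓ LinearMap.ker (d n)).map (f n))
  have key : ∀ n, subLen d W n + κ n + κ (n + 1) =
      subLen d (fun n => W n ⊓ LinearMap.ker (f n)) n + subLen d' (fun n => (W n).map (f n)) n :=
    fun n => relLen_homology_add (d (n + 1)) (d n) (d' (n + 1)) (d' n) (f (n + 1)) (f n)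
      (f (n - 1)) (W (n + 1)) (W n) (hd n) (hdd n) (hf (n + 1)) (hf n)
  have hfin : ∀ n, subLen d W n + κ n + κ (n + 1) ≠ ⊤ := fun n => by
    rw [key n]
    exact WithTop.add_ne_top.2 ⟨h1 n, h2 n⟩
  have hκ0 : κ 0 = 0 := by
    refine relLen_eq_zero ?_
    rintro _ ⟨hv, -⟩
    rw [h0, LinearMap.ker_zero, inf_top_eq]
    exact hv
  have hκL : κ (L + 1) = 0 := by
    refine relLen_eq_zero ?_
    rw [hL, Submodule.map_bot, bot_inf_eq]
    exact bot_le
  have keyZ : ∀ n, ((subLen d W n).toNat : ℤ) + ((κ n).toNat + (κ (n + 1)).toNat) =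
      (subLen d (fun n => W n ⊓ LinearMap.ker (f n)) n).toNat +
        (subLen d' (fun n => (W n).map (f n)) n).toNat := by
    intro n
    have h3 := WithTop.add_ne_top.1 (hfin n)
    have h4 := WithTop.add_ne_top.1 h3.1
    have := congrArg ENat.toNat (key n)
    rw [ENat.toNat_add h3.1 h3.2, ENat.toNat_add h4.1 h4.2, ENat.toNat_add (h1 n) (h2 n)] at this
    omega
  have := altSum_telescope L fun n => ((κ n).toNat : ℤ)
  simp only [hκ0, hκL] at this
  simp only [altSum]
  rw [← Finset.sum_add_distrib]
  simp only [← mul_add, ← keyZ]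
  simp only [mul_add, Finset.sum_add_distrib] at this ⊢
  rw [this]
  simp

end Euler

section Cyclic

variable {A : Type u} [CommRing A] {X : Type v} (g : Equiv.Perm X) (p : ℕ)

/-- Functions invariant under the `p`-th power of `g`. -/
def powInv (A : Type u) [CommRing A] {X : Type v} (g : Equiv.Perm X) (p : ℕ) :
    Submodule A (X → A) where
  carrier := {v | ∀ x, v ((g ^ p) x) = v x}
  add_mem' hv hw x := by simp [hv x, hw x]
  zero_mem' x := rfl
  smul_mem' c v hv x := by simp [hv x]

/-- The operator `g - 1` on functions. -/
def diffOp (A : Type u) [CommRing A] {X : Type v} (g : Equiv.Perm X) : (X → A) →ₗ[A] (X → A) :=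
  LinearMap.funLeft A A g - LinearMap.id

/-- The operator `1 + g + ⋯ + g ^ (p - 1)` on functions. -/
def normOp (A : Type u) [CommRing A] {X : Type v} (g : Equiv.Perm X) (p : ℕ) :
    (X → A) →ₗ[A] (X → A) :=
  ∑ i ∈ Finset.range p, LinearMap.funLeft A A (g ^ i : Equiv.Perm X)

theorem diffOp_apply (v : X → A) (x : X) : diffOp A g v x = v (g x) - v x := by
  simp [diffOp, LinearMap.funLeft_apply]

theorem normOp_apply (v : X → A) (x : X) :
    normOp A g p v x = ∑ i ∈ Finset.range p, v ((g ^ i) x) := by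
  simp [normOp, LinearMap.funLeft_apply]

variable {g p}

theorem mem_ker_diffOp {v : X → A} : v ∈ LinearMap.ker (diffOp A g) ↔ ∀ x, v (g x) = v x := by
  rw [LinearMap.mem_ker, funext_iff]
  simp [diffOp_apply, sub_eq_zero]

theorem apply_pow_of_mem_ker {v : X → A} (hv : v ∈ LinearMap.ker (diffOp A g)) (i : ℕ) (x : X) :
    v ((g ^ i) x) = v x := by
  induction i with
  | zero => simp
  | succ i ih => rw [pow_succ', Equiv.Perm.mul_apply, mem_ker_diffOp.1 hv, ih]

theorem ker_diffOp_le_powInv : LinearMap.ker (diffOp A g) ≤ powInv A g p :=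
  fun _ hv x => apply_pow_of_mem_ker hv p x

theorem sum_pow_succ_sub (v : X → A) (x : X) :
    normOp A g p v (g x) - normOp A g p v x = v ((g ^ p) x) - v x := by
  rw [normOp_apply, normOp_apply]
  have := Finset.sum_range_sub (fun i => v ((g ^ i) x)) p
  simp only [pow_zero, Equiv.Perm.one_apply] at this
  rw [← this, Finset.sum_sub_distrib]
  simp [pow_succ]

theorem normOp_mem_ker_diffOp {v : X → A} (hv : v ∈ powInv A g p) :
    normOp A g p v ∈ LinearMap.ker (diffOp A g) := by
  rw [mem_ker_diffOp]
  intro x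
  rw [← sub_eq_zero, sum_pow_succ_sub, hv x, sub_self]

variable {k : ℕ} [Fact p.Prime]

/-- A choice of base points for the orbits of `g`. -/
theorem exists_basePoint (g : Equiv.Perm X) (n : ℕ) (hn : 0 < n) (hg : g ^ n = 1) :
    ∃ (o : X → X) (t : X → ℕ), (∀ x, (g ^ t x) (o x) = x) ∧ ∀ x, o (g x) = o x := by
  let s : Setoid X := ⟨fun x y => ∃ i : ℕ, (g ^ i) x = y, fun x => ⟨0, rfl⟩, by
    rintro x _ ⟨i, rfl⟩
    refine ⟨n * i - i, ?_⟩
    rw [← Equiv.Perm.mul_apply, ← pow_add, Nat.sub_add_cancel (Nat.le_mul_of_pos_left i hn),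
      pow_mul, hg, one_pow, Equiv.Perm.one_apply], by
    rintro x _ _ ⟨i, rfl⟩ ⟨j, rfl⟩
    exact ⟨j + i, by rw [pow_add, Equiv.Perm.mul_apply]⟩⟩
  have h : ∀ x, ∃ i : ℕ, (g ^ i) (Quotient.mk s x).out = x := fun x => Quotient.mk_out (s := s) x
  choose t ht using h
  refine ⟨fun x => (Quotient.mk s x).out, t, ht, fun x => ?_⟩
  have : Quotient.mk s (g x) = Quotient.mk s x := (Quotient.sound (s := s) ⟨1, by simp⟩).symm
  simp only [this]

theorem modEq_of_pow_apply_eq (hg : g ^ p ^ k = 1) {x : X} (hx : g x ≠ x) {i j : ℕ}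
    (h : (g ^ i) x = (g ^ j) x) : i ≡ j [MOD p] := by
  have h1 : Function.minimalPeriod g x ∣ p ^ k := by
    rw [← Function.isPeriodicPt_iff_minimalPeriod_dvd, Function.IsPeriodicPt, Function.IsFixedPt,
      ← Equiv.Perm.coe_pow, hg, Equiv.Perm.one_apply]
  obtain ⟨m, hm, hm'⟩ := (Nat.dvd_prime_pow (Fact.out : p.Prime)).1 h1
  have h2 : p ∣ Function.minimalPeriod g x := by
    rw [hm']
    refine dvd_pow_self _ ?_
    rintro rfl
    rw [pow_zero, Function.minimalPeriod_eq_one_iff_isFixedPt] at hm'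
    exact hx hm'
  have hpos : 0 < Function.minimalPeriod g x := by
    rw [hm']
    exact pow_pos (Fact.out : p.Prime).pos _
  refine Nat.ModEq.of_dvd h2 ?_
  rw [Equiv.Perm.coe_pow, Equiv.Perm.coe_pow] at h
  rw [← Function.iterate_mod_minimalPeriod_eq, ← Function.iterate_mod_minimalPeriod_eq (n := j),
    Function.iterate_eq_iterate_iff_of_lt_minimalPeriod (Nat.mod_lt _ hpos)
      (Nat.mod_lt _ hpos)] at h
  exact h

theorem exists_diffOp_eq (hp : ∀ a : A, (p : A) * a = 0 → a = 0) (hg : g ^ p ^ k = 1) {v : X → A}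
    (hN : normOp A g p v = 0) : ∃ u ∈ powInv A g p, diffOp A g u = v := by
  obtain ⟨o, t, ht, ho⟩ := exists_basePoint g (p ^ k) (pow_pos (Fact.out : p.Prime).pos _) hg
  let S : X → ℕ → A := fun y i => ∑ j ∈ Finset.range i, v ((g ^ j) y)
  have hS : ∀ y i, S y (i + p) = S y i := by
    intro y i
    have h1 := congrFun hN ((g ^ i) y)
    rw [normOp_apply] at h1
    simp only [S, Finset.sum_range_add, add_eq_left]
    rw [Pi.zero_apply] at h1
    rw [← h1]
    refine Finset.sum_congr rfl fun j _ => ?_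
    rw [add_comm, pow_add, Equiv.Perm.mul_apply]
  have hS' : ∀ y i j, i ≡ j [MOD p] → S y i = S y j := by
    have h1 : ∀ y i m, S y (i + m * p) = S y i := by
      intro y i m
      induction m with
      | zero => simp
      | succ m ih => rw [add_mul, one_mul, ← add_assoc, hS, ih]
    have h2 : ∀ y i, S y (i % p) = S y i := fun y i => by
      conv_rhs => rw [← Nat.mod_add_div' i p, h1]
    intro y i j hij
    rw [← h2 y i, ← h2 y j, hij]
  have hS2 : ∀ y i j, (g ^ i) y = (g ^ j) y → S y i = S y j := by
    intro y i j hij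
    by_cases hy : g y = y
    · have h1 : ∀ l : ℕ, (g ^ l) y = y := fun l => by
        induction l with
        | zero => rfl
        | succ l ih => rw [pow_succ, Equiv.Perm.mul_apply, hy, ih]
      have h2 : v y = 0 := by
        have := congrFun hN y
        rw [normOp_apply] at this
        simp only [h1, Finset.sum_const, Finset.card_range, nsmul_eq_mul, Pi.zero_apply] at this
        exact hp _ this
      simp [S, h1, h2]
    · exact hS' y i j (modEq_of_pow_apply_eq hg hy hij)
  let u : X → A := fun x => S (o x) (t x)
  have hu : diffOp A g u = v := by
    ext x
    rw [diffOp_apply]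
    simp only [u]
    rw [ho, hS2 (o x) (t (g x)) (t x + 1)]
    · simp [S, Finset.sum_range_succ, ht]
    · rw [← ho x, ht, pow_succ', Equiv.Perm.mul_apply, ho x, ht]
  refine ⟨u, fun x => ?_, hu⟩
  have h1 := sum_pow_succ_sub (p := p) (g := g) u x
  have h2 : normOp A g p u (g x) - normOp A g p u x = normOp A g p v x := by
    rw [← hu]
    simp only [normOp_apply, diffOp_apply, Finset.sum_sub_distrib]
    congr 1
    refine Finset.sum_congr rfl fun j _ => ?_
    rw [← Equiv.Perm.mul_apply, ← Equiv.Perm.mul_apply, ← pow_succ, ← pow_succ']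
  rw [h2, hN, Pi.zero_apply] at h1
  exact sub_eq_zero.1 h1.symm

theorem sum_range_ite_dvd_add (t : ℕ) (c : A) :
    (∑ i ∈ Finset.range p, if p ∣ t + i then c else 0) = c := by
  have hp := (Fact.out : p.Prime).pos
  have ht := Nat.mod_lt t hp
  rw [Finset.sum_eq_single ((p - t % p) % p)]
  · rw [if_pos]
    rw [Nat.dvd_iff_mod_eq_zero, Nat.add_mod, Nat.mod_mod, ← Nat.add_mod]
    rw [Nat.add_mod, ← Nat.mod_mod t p, ← Nat.add_mod, Nat.mod_mod, Nat.add_sub_cancel' ht.le, Nat.mod_self]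
  · intro i hi hne
    rw [if_neg]
    intro hd
    refine hne ?_
    rw [Finset.mem_range] at hi
    rw [Nat.dvd_iff_mod_eq_zero, Nat.add_mod, Nat.mod_eq_of_lt hi] at hd
    rcases Nat.eq_zero_or_pos (t % p) with h0 | h0
    · rw [h0, zero_add, Nat.mod_eq_of_lt hi] at hd
      rw [h0, hd]
      simp
    · rw [Nat.mod_eq_of_lt (by omega : p - t % p < p)]
      have h3 : p ∣ t % p + i := Nat.dvd_of_mod_eq_zero hd
      obtain ⟨c, hc⟩ := h3
      have : c = 1 := by
        have h4 : c < 2 := by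
          by_contra h
          have : p * 2 ≤ p * c := Nat.mul_le_mul_left _ (by omega)
          omega
        have h5 : c ≠ 0 := by rintro rfl; omega
        omega
      subst this
      omega
  · intro h
    exact absurd (Finset.mem_range.2 (Nat.mod_lt _ hp)) h

theorem exists_normOp_eq (hg : g ^ p ^ k = 1) {v : X → A} (hv : v ∈ LinearMap.ker (diffOp A g))
    (hfix : ∀ x, g x = x → ∃ c, v x = p * c) : ∃ u ∈ powInv A g p, normOp A g p u = v := by
  classical
  obtain ⟨o, t, ht, ho⟩ := exists_basePoint g (p ^ k) (pow_pos (Fact.out : p.Prime).pos _) hg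
  choose c hc using hfix
  let u : X → A := fun x => if h : g x = x then c x h else if p ∣ t x then v x else 0
  have hpow : ∀ x, g x = x → ∀ l : ℕ, (g ^ l) x = x := fun x hx l => by
    induction l with
    | zero => rfl
    | succ l ih => rw [pow_succ, Equiv.Perm.mul_apply, hx, ih]
  have hnf : ∀ x, g x ≠ x → ∀ l : ℕ, g ((g ^ l) x) ≠ (g ^ l) x := by
    intro x hx l h
    refine hx ((g ^ l).injective ?_)
    rw [← h, ← Equiv.Perm.mul_apply, ← Equiv.Perm.mul_apply, ← pow_succ, ← pow_succ']
  have ho' : ∀ x (l : ℕ), o ((g ^ l) x) = o x := by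
    intro x l
    induction l with
    | zero => rfl
    | succ l ih => rw [pow_succ', Equiv.Perm.mul_apply, ho, ih]
  have hno : ∀ x, g x ≠ x → g (o x) ≠ o x := by
    intro x hx h
    have := hpow _ h (t x)
    rw [ht] at this
    rw [← this] at h
    exact hx h
  have htm : ∀ x, g x ≠ x → ∀ l : ℕ, t ((g ^ l) x) ≡ t x + l [MOD p] := by
    intro x hx l
    refine modEq_of_pow_apply_eq hg (hno x hx) ?_
    rw [← ho' x l, ht, add_comm, pow_add, Equiv.Perm.mul_apply, ho', ht]
  have hdvd : ∀ x, g x ≠ x → ∀ l : ℕ, u ((g ^ l) x) = if p ∣ t x + l then v x else 0 := by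
    intro x hx l
    simp only [u]
    rw [dif_neg (hnf x hx l), apply_pow_of_mem_ker hv]
    simp only [(htm x hx l).dvd_iff dvd_rfl]
  refine ⟨u, fun x => ?_, ?_⟩
  · by_cases hx : g x = x
    · rw [hpow x hx]
    · have h0 := hdvd x hx 0
      rw [hdvd x hx p]
      rw [pow_zero, Equiv.Perm.one_apply, add_zero] at h0
      rw [h0]
      simp
  · ext x
    rw [normOp_apply]
    by_cases hx : g x = x
    · simp only [hpow x hx, Finset.sum_const, Finset.card_range, nsmul_eq_mul]
      simp only [u, dif_pos hx]
      rw [← hc]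
    · simp only [hdvd x hx]
      exact sum_range_ite_dvd_add (t x) (v x)

theorem sum_normOp [Fintype X] (v : X → A) : ∑ x, normOp A g p v x = p * ∑ x, v x := by
  simp only [normOp_apply]
  rw [Finset.sum_comm]
  simp only [Equiv.sum_comp, Finset.sum_const, Finset.card_range, nsmul_eq_mul]

end Cyclic

section PermComplex

variable {A : Type u} [CommRing A]

theorem relLen_ne_top_of_forall_prime [IsNoetherianRing A] [IsLocalRing A] {Y : Type v}
    [AddCommGroup Y] [Module A Y] [Module.Finite A Y] {Z B : Submodule A Y}
    (h : ∀ P : Ideal A, P.IsPrime → P ≠ IsLocalRing.maximalIdeal A →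
      ∃ z, z ∉ P ∧ ∀ v ∈ Z, z • v ∈ B) : relLen Z B ≠ ⊤ := by
  refine length_ne_top_of_supportDim_le_zero _ ?_
  have hsub : Subsingleton (Module.support A (Z ⧸ B.submoduleOf Z)) := by
    have key : ∀ P ∈ Module.support A (Z ⧸ B.submoduleOf Z),
        P.asIdeal = IsLocalRing.maximalIdeal A := by
      intro P hP
      by_contra hne
      obtain ⟨z, hz, hzB⟩ := h P.asIdeal P.2 hne
      rw [Module.mem_support_iff_of_finite] at hP
      refine hz (hP ?_)
      rw [Module.mem_annihilator]
      intro y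
      obtain ⟨⟨y, hy⟩, rfl⟩ := Submodule.Quotient.mk_surjective _ y
      rw [← Submodule.Quotient.mk_smul]
      exact (Submodule.Quotient.mk_eq_zero _).2 (hzB y hy)
    refine ⟨fun P Q => ?_⟩
    ext1
    ext1
    rw [key _ P.2, key _ Q.2]
  exact Order.krullDim_nonpos_of_subsingleton

theorem normOp_eq_sum {X : Type v} (g : Equiv.Perm X) (p : ℕ) (v : X → A) :
    normOp A g p v = ∑ i ∈ Finset.range p, v ∘ ⇑(g ^ i) := by
  ext x
  rw [normOp_apply]
  simp

/-- Compatibility of a map between spaces of functions with permutations of the points. -/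
def Equivar {X : Type v} {Y : Type w} (g : Equiv.Perm X) (g' : Equiv.Perm Y)
    (φ : (X → A) →ₗ[A] (Y → A)) : Prop :=
  ∀ v : X → A, φ (v ∘ g) = φ v ∘ g'

namespace Equivar

variable {X : Type v} {Y : Type w} {g : Equiv.Perm X} {g' : Equiv.Perm Y}
    {φ : (X → A) →ₗ[A] (Y → A)} {p : ℕ}

theorem pow (h : Equivar g g' φ) (i : ℕ) : Equivar (g ^ i) (g' ^ i) φ := by
  induction i with
  | zero => exact fun v => rfl
  | succ i ih =>
    intro v
    have h1 : v ∘ ⇑(g ^ (i + 1)) = (v ∘ ⇑(g ^ i)) ∘ g := by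
      rw [pow_succ]
      rfl
    rw [h1, h, ih, pow_succ]
    rfl

theorem mem_powInv (h : Equivar g g' φ) {v : X → A} (hv : v ∈ powInv A g p) :
    φ v ∈ powInv A g' p := by
  have h1 : v ∘ ⇑(g ^ p) = v := funext hv
  have := h.pow p v
  rw [h1] at this
  exact fun y => (congrFun this y).symm

theorem diffOp_apply (h : Equivar g g' φ) (v : X → A) :
    diffOp A g' (φ v) = φ (diffOp A g v) := by
  have : diffOp A g v = v ∘ g - v := rfl
  rw [this, map_sub, h]
  rfl

theorem normOp_apply (h : Equivar g g' φ) (v : X → A) :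
    normOp A g' p (φ v) = φ (normOp A g p v) := by
  rw [normOp_eq_sum, normOp_eq_sum, map_sum]
  exact Finset.sum_congr rfl fun i _ => (h.pow i v).symm

theorem mem_ker_diffOp (h : Equivar g g' φ) {v : X → A} (hv : v ∈ LinearMap.ker (diffOp A g)) :
    φ v ∈ LinearMap.ker (diffOp A g') := by
  rw [LinearMap.mem_ker] at hv ⊢
  rw [h.diffOp_apply, hv, map_zero]

end Equivar

variable {X : ℕ → Type v} [∀ n, Fintype (X n)]

/-- The differential of the complex given by a sequence of matrices. -/
def bdry (Δ : ∀ n, Matrix (X n) (X (n + 1)) A) : ∀ n, (X n → A) →ₗ[A] (X (n - 1) → A)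
  | 0 => 0
  | n + 1 => (Δ n).mulVecLin

variable {Δ : ∀ n, Matrix (X n) (X (n + 1)) A} {g : ∀ n, Equiv.Perm (X n)}

theorem equivar_bdry (hΔ : ∀ n x y, Δ n (g n x) (g (n + 1) y) = Δ n x y) (n : ℕ) :
    Equivar (g n) (g (n - 1)) (bdry Δ n) := by
  intro v
  cases n with
  | zero => rfl
  | succ n =>
    ext x
    change ∑ y, Δ n x y * v (g (n + 1) y) = ∑ y, Δ n (g n x) y * v y
    rw [← Equiv.sum_comp (g (n + 1)) fun y => Δ n (g n x) y * v y]
    simp only [hΔ]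

variable {ι : Type w} [Fintype ι] {deg : ι → ℕ}

/-- Restriction of a function to chosen points, modulo an ideal. -/
def fixRes (I : Ideal A) (c : ∀ n b, deg b = n → X n) (n : ℕ) : (X n → A) →ₗ[A] (ι → A ⧸ I) where
  toFun v b := if h : deg b = n then Ideal.Quotient.mk I (v (c n b h)) else 0
  map_add' v w := by
    ext b
    simp only [Pi.add_apply]
    split_ifs <;> simp
  map_smul' a v := by
    ext b
    simp only [Pi.smul_apply, RingHom.id_apply]
    split_ifs
    · simp only [smul_eq_mul, map_mul]
      rfl
    · simp

theorem fixRes_apply {I : Ideal A} {c : ∀ n b, deg b = n → X n} {n : ℕ} (v : X n → A) {b : ι}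
    (h : deg b = n) : fixRes I c n v b = Ideal.Quotient.mk I (v (c n b h)) := dif_pos h

theorem sum_sub_sum_fixed_mem {p : ℕ} [Fact p.Prime] {k : ℕ} {X : Type v} [Fintype X]
    {g : Equiv.Perm X} (hg : g ^ p ^ k = 1) [DecidablePred fun x => g x = x]
    {v : X → A} (hv : v ∈ LinearMap.ker (diffOp A g)) :
    ∑ x, v x - ∑ x with g x = x, v x ∈ Ideal.span {(p : A)} := by
  rw [mem_ker_diffOp] at hv
  let v' : X → A := fun x => if g x = x then 0 else v x
  have h1 : ∑ x, v x - ∑ x with g x = x, v x = ∑ x, v' x := by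
    rw [Finset.sum_filter, ← Finset.sum_sub_distrib]
    refine Finset.sum_congr rfl fun x _ => ?_
    simp only [v']
    split_ifs <;> simp
  obtain ⟨u, -, hu⟩ := exists_normOp_eq (p := p) (v := v') hg
    (by
      rw [mem_ker_diffOp]
      intro x
      simp only [v', (g.injective.eq_iff : g (g x) = g x ↔ _), hv])
    (fun x hx => ⟨0, by simp [v', hx]⟩)
  rw [h1, ← hu, sum_normOp]
  exact Ideal.mul_mem_right _ _ (Ideal.mem_span_singleton_self _)

theorem altSum_hLen_eq_zero [IsNoetherianRing A] [IsLocalRing A] {p : ℕ} [Fact p.Prime] {k : ℕ}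
    (hp : ∀ a : A, (p : A) * a = 0 → a = 0) (hg : ∀ n, g n ^ p ^ k = 1)
    (hΔ : ∀ n x y, Δ n (g n x) (g (n + 1) y) = Δ n x y)
    (hΔΔ : ∀ n v, bdry Δ n (bdry Δ (n + 1) v) = 0)
    (hS : ∀ P : Ideal A, P.IsPrime → P ≠ IsLocalRing.maximalIdeal A →
      ∃ z, z ∉ P ∧ ∀ n, ∃ S : (X n → A) →ₗ[A] (X (n + 1) → A), Equivar (g n) (g (n + 1)) S ∧
        ∀ v, bdry Δ n v = 0 → bdry Δ (n + 1) (S v) = z • v)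
    {L : ℕ} (hL : IsEmpty (X (L + 1))) {D : Matrix ι ι A} (hD : IsLowering deg D)
    (c : ∀ n b, deg b = n → X n) (hcg : ∀ n b h, g n (c n b h) = c n b h)
    (hgc : ∀ n x, g n x = x → ∃ b h, c n b h = x)
    (hc : ∀ n b h b' h', c n b h = c n b' h' → b = b')
    (hcD : ∀ n b h b' h', Δ n (c n b h) (c (n + 1) b' h') = D b b')
    (hfin : ∀ n, hLen deg D (A ⧸ Ideal.span {(p : A)}) n ≠ ⊤) :
    altSum L (hLen deg D (A ⧸ Ideal.span {(p : A)})) = 0 := by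
  classical
  let B := A ⧸ Ideal.span {(p : A)}
  let ρ := fixRes (A := A) (Ideal.span {(p : A)}) c
  have hE := equivar_bdry hΔ
  have hbot : ∀ W : Submodule A (X (L + 1) → A), W = ⊥ := fun W => Subsingleton.elim _ _
  -- finiteness of the homology of equivariant subcomplexes
  have hfinW : ∀ W : ∀ n, Submodule A (X n → A),
      (∀ n m (φ : (X n → A) →ₗ[A] (X m → A)), Equivar (g n) (g m) φ →
        ∀ v ∈ W n, φ v ∈ W m) → ∀ n, subLen (bdry Δ) W n ≠ ⊤ := by
    intro W hW n
    refine relLen_ne_top_of_forall_prime fun P hP hPm => ?_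
    obtain ⟨z, hz, hSz⟩ := hS P hP hPm
    obtain ⟨S, hSe, hSz⟩ := hSz n
    refine ⟨z, hz, ?_⟩
    rintro v ⟨h1, h2⟩
    exact ⟨S v, hW _ _ S hSe v h1, hSz v h2⟩
  let E' := fun n => powInv A (g n) p
  let EG := fun n => LinearMap.ker (diffOp A (g n))
  let Eδ := fun n => (powInv A (g n) p).map (diffOp A (g n))
  let EN := fun n => (powInv A (g n) p).map (normOp A (g n) p)
  have hEG : ∀ n, subLen (bdry Δ) EG n ≠ ⊤ := hfinW EG fun n m φ h v hv => h.mem_ker_diffOp hv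
  have hEδ : ∀ n, subLen (bdry Δ) Eδ n ≠ ⊤ := hfinW Eδ fun n m φ h v ⟨u, hu, huv⟩ =>
    ⟨φ u, h.mem_powInv hu, by rw [h.diffOp_apply, huv]⟩
  have hEN : ∀ n, subLen (bdry Δ) EN n ≠ ⊤ := hfinW EN fun n m φ h v ⟨u, hu, huv⟩ =>
    ⟨φ u, h.mem_powInv hu, by rw [h.normOp_apply, huv]⟩
  have e1 : (fun n => E' n ⊓ LinearMap.ker (diffOp A (g n))) = EG :=
    funext fun n => inf_eq_right.2 ker_diffOp_le_powInv
  have e2 : (fun n => E' n ⊓ LinearMap.ker (normOp A (g n) p)) = Eδ := by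
    funext n
    refine le_antisymm ?_ ?_
    · rintro v ⟨-, h2⟩
      obtain ⟨u, hu, huv⟩ := exists_diffOp_eq hp (hg n) (LinearMap.mem_ker.1 h2)
      exact ⟨u, hu, huv⟩
    · rintro _ ⟨u, hu, rfl⟩
      refine ⟨?_, ?_⟩
      · intro x
        rw [diffOp_apply, diffOp_apply, hu x, ← Equiv.Perm.mul_apply, ← pow_succ', pow_succ,
          Equiv.Perm.mul_apply, hu]
      · change normOp A (g n) p (diffOp A (g n) u) = 0
        have h1 : Equivar (A := A) (g n) (g n) (diffOp A (g n)) := fun v => rfl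
        rw [h1.normOp_apply]
        exact normOp_mem_ker_diffOp hu
  have e3 : (fun n => EG n ⊓ LinearMap.ker (ρ n)) = EN := by
    funext n
    refine le_antisymm ?_ ?_
    · rintro v ⟨h1, h2⟩
      refine exists_normOp_eq (hg n) h1 fun x hx => ?_
      obtain ⟨b, h, rfl⟩ := hgc n x hx
      have h3 : ρ n v b = 0 := congrFun (show ρ n v = 0 from h2) b
      rw [fixRes_apply v h, Ideal.Quotient.eq_zero_iff_mem, Ideal.mem_span_singleton'] at h3
      obtain ⟨a, ha⟩ := h3
      exact ⟨a, by rw [← ha, mul_comm]⟩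
    · rintro _ ⟨u, hu, rfl⟩
      refine ⟨normOp_mem_ker_diffOp hu, ?_⟩
      change ρ n (normOp A (g n) p u) = 0
      ext b
      by_cases h : deg b = n
      · rw [fixRes_apply _ h, Pi.zero_apply, Ideal.Quotient.eq_zero_iff_mem, normOp_apply]
        have h1 : ∀ i : ℕ, ((g n) ^ i) (c n b h) = c n b h := fun i => by
          induction i with
          | zero => rfl
          | succ i ih => rw [pow_succ, Equiv.Perm.mul_apply, hcg, ih]
        simp only [h1, Finset.sum_const, Finset.card_range, nsmul_eq_mul]
        exact Ideal.mul_mem_right _ _ (Ideal.mem_span_singleton_self _)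
      · exact dif_neg h
  have hinj : ∀ n b h b' h', c n b h = c n b' h' ↔ b = b' :=
    fun n b h b' h' => ⟨hc n b h b' h', by rintro rfl; rfl⟩
  have e4 : ∀ n, (EG n).map (ρ n) = degSub A deg B n := by
    intro n
    refine le_antisymm ?_ ?_
    · rintro _ ⟨v, -, rfl⟩ b hb
      exact dif_neg hb
    · intro v hv
      choose v' hv' using fun b => Ideal.Quotient.mk_surjective (v b)
      let v'' : X n → A := fun x => ∑ b, if h : deg b = n then (if c n b h = x then v' b else 0) else 0
      refine ⟨v'', ?_, ?_⟩
      · refine mem_ker_diffOp.2 fun x => Finset.sum_congr rfl fun b _ => ?_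
        split_ifs with h h1 h2 h2
        · rfl
        · rw [← hcg] at h1
          exact absurd ((g n).injective h1) h2
        · rw [← h2, hcg] at h1
          exact absurd rfl h1
        · rfl
        · rfl
      · ext b
        by_cases h : deg b = n
        · rw [fixRes_apply _ h, ← hv']
          congr 1
          simp only [v'']
          rw [Finset.sum_eq_single b]
          · simp [h]
          · intro b' _ hb'
            split_ifs with h1 h2
            · exact absurd (hc _ _ _ _ _ h2) hb'
            · rfl
            · rfl
          · simp
        · exact (dif_neg h).trans (hv b h).symm
  have hcomm : ∀ n, ∀ v ∈ EG n, ρ (n - 1) (bdry Δ n v) = matAct D B (ρ n v) := by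
    intro n v hv
    have hvn : ρ n v ∈ degSub A deg B n := by
      rw [← e4]
      exact ⟨v, hv, rfl⟩
    cases n with
    | zero => exact (map_zero _).trans (hD.degSub_zero_le_ker hvn).symm
    | succ n =>
      ext b
      by_cases h : deg b = n
      · change ρ n _ b = _
        rw [fixRes_apply _ h, matAct_apply]
        have h1 := sum_sub_sum_fixed_mem (hg (n + 1))
          (v := fun y => Δ n (c n b h) y * v y) (mem_ker_diffOp.2 fun y => by
            rw [mem_ker_diffOp.1 hv]
            conv_lhs => rw [← hcg, hΔ])
        rw [← Ideal.Quotient.eq] at h1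
        refine h1.trans ?_
        have h2 : ∑ y with g (n + 1) y = y, Δ n (c n b h) y * v y =
            ∑ b', if h' : deg b' = n + 1 then D b b' * v (c (n + 1) b' h') else 0 := by
          have h3 : (Finset.univ.filter fun y => g (n + 1) y = y) =
              (Finset.univ : Finset {b' // deg b' = n + 1}).image
                fun b' => c (n + 1) b'.1 b'.2 := by
            ext y
            simp only [Finset.mem_filter, Finset.mem_univ, true_and, Finset.mem_image,
              Subtype.exists]
            refine ⟨hgc (n + 1) y, ?_⟩
            rintro ⟨b', h', rfl⟩
            exact hcg _ _ _
          rw [h3, Finset.sum_image (fun b' _ b'' _ h => Subtype.ext (hc _ _ _ _ _ h)),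
            Finset.sum_dite, Finset.sum_const_zero, add_zero]
          simp only [hcD]
          refine Finset.sum_bij (fun b' _ => ⟨b'.1, by simpa using b'.2⟩) (by simp) ?_ ?_ ?_
          · intro b' _ b'' _ h
            simpa [Subtype.ext_iff] using h
          · rintro ⟨b', hb'⟩ _
            exact ⟨⟨b', by simpa using hb'⟩, by simp, rfl⟩
          · intros
            rfl
        rw [h2, map_sum]
        refine Finset.sum_congr rfl fun b' _ => ?_
        by_cases h' : deg b' = n + 1
        · rw [dif_pos h', fixRes_apply _ h', map_mul]
          rfl
        · rw [dif_neg h', hvn b' h', smul_zero, map_zero]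
      · have h1 : ρ n (bdry Δ (n + 1) v) b = 0 := dif_neg h
        exact h1.trans (hD.matAct_mem hvn b h).symm
  have e5 : subLen (fun _ => matAct D B) (fun n => (EG n).map (ρ n)) = hLen deg D B := by
    funext n
    rw [subLen, e4, e4]
    rfl
  have x1 := altSum_subLen_add (d := bdry Δ) (d' := bdry Δ) (f := fun n => diffOp A (g n)) (W := E')
    (L := L) (fun n v hv => (hE (n + 1)).mem_powInv hv) (fun n v _ => hΔΔ n v)
    (fun n v _ => (hE n).diffOp_apply v) rfl (hbot _) (by rw [e1]; exact hEG) hEδ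
  have x2 := altSum_subLen_add (d := bdry Δ) (d' := bdry Δ) (f := fun n => normOp A (g n) p)
    (W := E') (L := L) (fun n v hv => (hE (n + 1)).mem_powInv hv) (fun n v _ => hΔΔ n v)
    (fun n v _ => (hE n).normOp_apply v) rfl (hbot _) (by rw [e2]; exact hEδ) hEN
  have x3 := altSum_subLen_add (d := bdry Δ) (d' := fun _ => matAct D B) (f := ρ)
    (W := EG) (L := L) (fun n v hv => (hE (n + 1)).mem_ker_diffOp hv) (fun n v _ => hΔΔ n v)
    hcomm rfl (hbot _) (by rw [e3]; exact hEN) (by rw [e5]; exact hfin)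
  rw [e1] at x1
  rw [e2] at x2
  rw [e3, e5] at x3
  have x1' : altSum L (subLen (bdry Δ) E') = altSum L (subLen (bdry Δ) EG) +
    altSum L (subLen (bdry Δ) Eδ) := x1
  have x2' : altSum L (subLen (bdry Δ) E') = altSum L (subLen (bdry Δ) Eδ) +
    altSum L (subLen (bdry Δ) EN) := x2
  have x3' : altSum L (subLen (bdry Δ) EG) = altSum L (subLen (bdry Δ) EN) +
    altSum L (hLen deg D B) := x3
  change altSum L (hLen deg D B) = 0
  linarith

end PermComplex

section WordIndex

/-- The index set of the `n`-th level of the simplicial module attached to a complex: an element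
of `ι` decorated with a word of length `n` in two letters. -/
def WIdx (ι : Type w) : ℕ → Type w
  | 0 => ι
  | n + 1 => WIdx ι n ⊕ WIdx ι n

variable {A : Type u} [CommRing A] {ι : Type w}

instance instFintypeWIdx [Fintype ι] : ∀ n, Fintype (WIdx ι n)
  | 0 => inferInstanceAs (Fintype ι)
  | n + 1 =>
    have := instFintypeWIdx n
    inferInstanceAs (Fintype (WIdx ι n ⊕ WIdx ι n))

instance instDecidableEqWIdx [DecidableEq ι] : ∀ n, DecidableEq (WIdx ι n)
  | 0 => inferInstanceAs (DecidableEq ι)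
  | n + 1 =>
    have := instDecidableEqWIdx n
    inferInstanceAs (DecidableEq (WIdx ι n ⊕ WIdx ι n))

/-- The degree of the base element minus the number of occurrences of the second letter. -/
def wWt (deg : ι → ℕ) : ∀ n, WIdx ι n → ℤ
  | 0, x => deg x
  | n + 1, Sum.inl x => wWt deg n x
  | n + 1, Sum.inr x => wWt deg n x - 1

/-- Whether the `i`-th letter is the second one. -/
def wBit : ∀ n, ℕ → WIdx ι n → Bool
  | 0, _, _ => true
  | _ + 1, 0, Sum.inl _ => false
  | _ + 1, 0, Sum.inr _ => true
  | n + 1, i + 1, Sum.inl x => wBit n i x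
  | n + 1, i + 1, Sum.inr x => wBit n i x

/-- The constant word in the second letter. -/
def wTop : ∀ n, ι → WIdx ι n
  | 0, b => b
  | n + 1, b => Sum.inr (wTop n b)

theorem wTop_injective : ∀ n, Function.Injective (wTop (ι := ι) n)
  | 0 => Function.injective_id
  | n + 1 => Sum.inr_injective.comp (wTop_injective n)

theorem wWt_wTop (deg : ι → ℕ) : ∀ n b, wWt deg n (wTop n b) = deg b - n
  | 0, b => by simp [wWt, wTop]
  | n + 1, b => by
    rw [wTop, wWt, wWt_wTop deg n b]
    push_cast
    ring

theorem wBit_wTop : ∀ n i (b : ι), wBit n i (wTop n b)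
  | 0, _, _ => rfl
  | _ + 1, 0, _ => rfl
  | n + 1, i + 1, b => wBit_wTop n i b

theorem exists_wTop_eq : ∀ n (x : WIdx ι n), (∀ i, wBit n i x) → ∃ b, wTop n b = x
  | 0, x, _ => ⟨x, rfl⟩
  | _ + 1, Sum.inl _, h => (Bool.false_ne_true (h 0)).elim
  | n + 1, Sum.inr x, h => by
    obtain ⟨b, hb⟩ := exists_wTop_eq n x fun i => h (i + 1)
    exact ⟨b, congrArg Sum.inr hb⟩

theorem wWt_add_count_le {deg : ι → ℕ} {r : ℕ} (hr : ∀ b, deg b ≤ r) :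
    ∀ n (x : WIdx ι n), wWt deg n x + ∑ i ∈ Finset.range n, ((wBit n i x).toNat : ℤ) ≤ r
  | 0, x => by simpa [wWt] using hr x
  | n + 1, Sum.inl x => by
    have h := wWt_add_count_le hr n x
    rw [Finset.sum_range_succ']
    change wWt deg n x + (∑ i ∈ Finset.range n, ((wBit n i x).toNat : ℤ) + 0) ≤ r
    linarith
  | n + 1, Sum.inr x => by
    have h := wWt_add_count_le hr n x
    rw [Finset.sum_range_succ']
    change wWt deg n x - 1 + (∑ i ∈ Finset.range n, ((wBit n i x).toNat : ℤ) + 1) ≤ r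
    linarith

section Matrices

variable [Fintype ι] [DecidableEq ι]

/-- The block diagonal extension of a matrix to words of length `n`. -/
def wDiag (M : Matrix ι ι A) : ∀ n, Matrix (WIdx ι n) (WIdx ι n) A
  | 0 => M
  | n + 1 => Matrix.fromBlocks (wDiag M n) 0 0 (wDiag M n)

/-- The reduced alternating sum of the faces. -/
def wAlt (A : Type u) [CommRing A] (ι : Type w) [DecidableEq ι] :
    ∀ n, Matrix (WIdx ι n) (WIdx ι n) A
  | 0 => 0
  | n + 1 => Matrix.fromBlocks (wAlt A ι n) 0 1 (-wAlt A ι n)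

/-- The zeroth face. -/
def wZero (D : Matrix ι ι A) (n : ℕ) : Matrix (WIdx ι n) (WIdx ι (n + 1)) A :=
  Matrix.fromCols 1 (wDiag D n - wAlt A ι n)

/-- The other faces. -/
def wFace (A : Type u) [CommRing A] (ι : Type w) [DecidableEq ι] :
    ∀ n, ℕ → Matrix (WIdx ι n) (WIdx ι (n + 1)) A
  | _, 0 => Matrix.fromCols 1 0
  | 0, _ + 1 => 0
  | n + 1, j + 1 => Matrix.fromBlocks (wFace A ι n j) 0 0 (wFace A ι n j)

/-- The homotopy. -/
def wHtpy (D H : Matrix ι ι A) (n : ℕ) : Matrix (WIdx ι (n + 1)) (WIdx ι n) A :=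
  Matrix.fromRows (wDiag H n * (wDiag D n + wAlt A ι n)) (wDiag H n)

theorem wBlocks_mul {n : ℕ} {m k : Type w} (P Q : Matrix m (WIdx ι n) A)
    (R S : Matrix k (WIdx ι n) A) (P' R' Q' S' : Matrix (WIdx ι n) (WIdx ι n) A) :
    (Matrix.fromBlocks P Q R S : Matrix (m ⊕ k) (WIdx ι (n + 1)) A) *
      (Matrix.fromBlocks P' Q' R' S' : Matrix (WIdx ι (n + 1)) (WIdx ι (n + 1)) A) =
      Matrix.fromBlocks (P * P' + Q * R') (P * Q' + Q * S') (R * P' + S * R') (R * Q' + S * S') :=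
  Matrix.fromBlocks_multiply _ _ _ _ _ _ _ _

theorem wBlocks_one (n : ℕ) : (1 : Matrix (WIdx ι (n + 1)) (WIdx ι (n + 1)) A) =
    Matrix.fromBlocks 1 0 0 1 :=
  Matrix.fromBlocks_one.symm

theorem wDiag_mul (M N : Matrix ι ι A) : ∀ n, wDiag (M * N) n = wDiag M n * wDiag N n
  | 0 => rfl
  | n + 1 => by
    simp only [wDiag]
    refine Eq.trans ?_ (wBlocks_mul _ _ _ _ _ _ _ _).symm
    simp [wDiag_mul M N n]
    rfl

theorem wDiag_add (M N : Matrix ι ι A) : ∀ n, wDiag (M + N) n = wDiag M n + wDiag N n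
  | 0 => rfl
  | n + 1 => by
    simp only [wDiag]
    refine Eq.trans ?_ (Matrix.fromBlocks_add _ _ _ _ _ _ _ _).symm
    simp [wDiag_add M N n]
    rfl

theorem wDiag_zero : ∀ n, wDiag (0 : Matrix ι ι A) n = 0
  | 0 => rfl
  | n + 1 => by
    simp only [wDiag, wDiag_zero n]
    exact Matrix.fromBlocks_zero

theorem wDiag_smul_one (z : A) : ∀ n, wDiag (z • (1 : Matrix ι ι A)) n = z • 1
  | 0 => rfl
  | n + 1 => by
    simp only [wDiag, wDiag_smul_one z n]
    rw [wBlocks_one]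
    refine Eq.trans ?_ (Matrix.fromBlocks_smul _ _ _ _ _).symm
    simp
    rfl

theorem wAlt_mul_self : ∀ n, wAlt A ι n * wAlt A ι n = 0
  | 0 => zero_mul _
  | n + 1 => by
    refine (wBlocks_mul _ _ _ _ _ _ _ _).trans
      ((Matrix.fromBlocks_inj.2 ⟨?_, ?_, ?_, ?_⟩).trans Matrix.fromBlocks_zero) <;>
    simp [wAlt_mul_self n]

theorem wAlt_mul_wDiag (M : Matrix ι ι A) : ∀ n, wAlt A ι n * wDiag M n = wDiag M n * wAlt A ι n
  | 0 => (zero_mul _).trans (mul_zero _).symm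
  | n + 1 => by
    refine (wBlocks_mul _ _ _ _ _ _ _ _).trans (Eq.trans ?_ (wBlocks_mul _ _ _ _ _ _ _ _).symm)
    simp [wAlt_mul_wDiag M n]

theorem wCols_mul {n : ℕ} {m k l : Type w} (P Q : Matrix m (WIdx ι n) A)
    (P' R' : Matrix (WIdx ι n) k A) (Q' S' : Matrix (WIdx ι n) l A)  :
    (Matrix.fromCols P Q : Matrix m (WIdx ι (n + 1)) A) *
      (Matrix.fromBlocks P' Q' R' S' : Matrix (WIdx ι (n + 1)) (k ⊕ l) A) =
      Matrix.fromCols (P * P' + Q * R') (P * Q' + Q * S') :=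
  Matrix.fromCols_mul_fromBlocks _ _ _ _ _ _

theorem wCols_mul_wRows {n : ℕ} {m k : Type w} (P Q : Matrix m (WIdx ι n) A)
    (P' R' : Matrix (WIdx ι n) k A) :
    (Matrix.fromCols P Q : Matrix m (WIdx ι (n + 1)) A) *
      (Matrix.fromRows P' R' : Matrix (WIdx ι (n + 1)) k A) = P * P' + Q * R' :=
  Matrix.fromCols_mul_fromRows _ _ _ _

theorem wBlocks_mul_wRows {n : ℕ} {m k l : Type w} (P Q : Matrix m (WIdx ι n) A)
    (R S : Matrix l (WIdx ι n) A) (P' R' : Matrix (WIdx ι n) k A) :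
    (Matrix.fromBlocks P Q R S : Matrix (m ⊕ l) (WIdx ι (n + 1)) A) *
      (Matrix.fromRows P' R' : Matrix (WIdx ι (n + 1)) k A) =
      Matrix.fromRows (P * P' + Q * R') (R * P' + S * R') :=
  Matrix.fromBlocks_mul_fromRows _ _ _ _ _ _

theorem wFace_mul_wDiag (M : Matrix ι ι A) :
    ∀ n j, wFace A ι n j * wDiag M (n + 1) = wDiag M n * wFace A ι n j
  | n, 0 => by
    rw [wFace.eq_1, wDiag.eq_2]
    refine (wCols_mul _ _ _ _ _ _).trans (Eq.trans ?_ (Matrix.mul_fromCols _ _ _).symm)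
    simp
  | 0, _ + 1 => (Matrix.zero_mul _).trans (Matrix.mul_zero _).symm
  | n + 1, j + 1 => by
    refine (wBlocks_mul _ _ _ _ _ _ _ _).trans (Eq.trans ?_
      (Matrix.fromBlocks_multiply _ _ _ _ _ _ _ _).symm)
    simp [wFace_mul_wDiag M n j]

theorem wFace_mul_wAlt :
    ∀ n j, wFace A ι n j * wAlt A ι (n + 1) = wAlt A ι n * wFace A ι n j
  | n, 0 => by
    rw [wFace.eq_1, wAlt.eq_2]
    refine (wCols_mul _ _ _ _ _ _).trans (Eq.trans ?_ (Matrix.mul_fromCols _ _ _).symm)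
    simp
  | 0, _ + 1 => (Matrix.zero_mul _).trans (Matrix.mul_zero _).symm
  | n + 1, j + 1 => by
    refine (wBlocks_mul _ _ _ _ _ _ _ _).trans (Eq.trans ?_
      (Matrix.fromBlocks_multiply _ _ _ _ _ _ _ _).symm)
    simp [wFace_mul_wAlt n j]

theorem wFace_mul_wZero (D : Matrix ι ι A) (n j : ℕ) :
    wFace A ι n j * wZero D (n + 1) = wZero D n * wFace A ι (n + 1) (j + 1) := by
  refine (Matrix.mul_fromCols _ _ _).trans (Eq.trans ?_ (wCols_mul _ _ _ _ _ _).symm)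
  rw [Matrix.mul_sub, wFace_mul_wDiag, wFace_mul_wAlt]
  simp [Matrix.sub_mul]

theorem wZero_mul_wZero {D : Matrix ι ι A} (hD : D * D = 0) (n : ℕ) :
    wZero D n * wZero D (n + 1) = wZero D n * wFace A ι (n + 1) 0 := by
  refine (Matrix.mul_fromCols _ _ _).trans (Eq.trans ?_ (Matrix.mul_fromCols _ _ _).symm)
  congr 1
  rw [Matrix.mul_sub]
  have h1 : wZero D n * wDiag D (n + 1) = _ := wCols_mul _ _ _ _ _ _
  have h2 : wZero D n * wAlt A ι (n + 1) = _ := wCols_mul _ _ _ _ _ _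
  rw [Matrix.mul_zero, sub_eq_zero]
  refine h1.trans (Eq.trans ((Matrix.fromCols_ext_iff _ _ _ _).2 ⟨?_, ?_⟩) h2.symm)
  · simp
  · simp only [Matrix.mul_zero, zero_add, sub_mul, mul_neg]
    rw [← wDiag_mul, hD, wDiag_zero, wAlt_mul_self, wAlt_mul_wDiag]
    abel

theorem wZero_mul_wHtpy {D H : Matrix ι ι A} {z : A} (hH : D * H + H * D = z • 1) (n : ℕ) :
    wZero D n * wHtpy D H n = z • 1 := by
  refine (wCols_mul_wRows _ _ _ _).trans ?_
  rw [sub_mul, Matrix.one_mul, mul_add, wAlt_mul_wDiag, ← wDiag_mul, ← wDiag_mul,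
    ← wDiag_smul_one z n, ← hH, wDiag_add]
  abel

theorem wFace_zero_mul_wHtpy {D H : Matrix ι ι A} (hD : D * D = 0) (n : ℕ) :
    wFace A ι (n + 1) 0 * wHtpy D H (n + 1) = wHtpy D H n * wZero D n := by
  have h0 : wFace A ι (n + 1) 0 * wHtpy D H (n + 1) =
      wDiag H (n + 1) * (wDiag D (n + 1) + wAlt A ι (n + 1)) :=
    (wCols_mul_wRows _ _ _ _).trans (by simp)
  have h1 : wDiag D (n + 1) + wAlt A ι (n + 1) = _ := Matrix.fromBlocks_add _ _ _ _ _ _ _ _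
  have h2 : wDiag H (n + 1) * (wDiag D (n + 1) + wAlt A ι (n + 1)) = _ :=
    (congrArg _ h1).trans (wBlocks_mul _ _ _ _ _ _ _ _)
  refine (h0.trans h2).trans (Eq.trans ?_ (Matrix.fromRows_mul_fromCols _ _ _ _).symm)
  have h3 : (wDiag D n + wAlt A ι n) * (wDiag D n - wAlt A ι n) = 0 := by
    rw [add_mul, mul_sub, mul_sub, wAlt_mul_self, wAlt_mul_wDiag, ← wDiag_mul, hD, wDiag_zero]
    abel
  have h4 : wDiag H n * (wDiag D n + wAlt A ι n) * (wDiag D n - wAlt A ι n) = 0 := by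
    rw [Matrix.mul_assoc, h3, Matrix.mul_zero]
  refine Matrix.fromBlocks_inj.2 ⟨?_, ?_, ?_, ?_⟩ <;>
    simp [← sub_eq_add_neg, h4]

theorem wFace_succ_mul_wHtpy (D H : Matrix ι ι A) (n j : ℕ) :
    wFace A ι (n + 1) (j + 1) * wHtpy D H (n + 1) = wHtpy D H n * wFace A ι n j := by
  refine (wBlocks_mul_wRows _ _ _ _ _ _).trans (Eq.trans ?_ (Matrix.fromRows_mul _ _ _).symm)
  simp only [Matrix.zero_mul, add_zero, zero_add]
  rw [← Matrix.mul_assoc, wFace_mul_wDiag, Matrix.mul_assoc, Matrix.mul_add, wFace_mul_wDiag,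
    wFace_mul_wAlt, ← Matrix.add_mul, Matrix.mul_assoc]

theorem wFace_zero_mul_wHtpy_zero (D H : Matrix ι ι A) :
    wFace A ι 0 0 * wHtpy D H 0 = wDiag (H * D) 0 := by
  refine (wCols_mul_wRows _ _ _ _).trans ?_
  rw [wAlt.eq_1, add_zero, Matrix.zero_mul, add_zero, Matrix.one_mul, wDiag_mul]

end Matrices
end WordIndex

section Weights

variable {A : Type u} [CommRing A] {ι : Type w} [Fintype ι] [DecidableEq ι] {deg : ι → ℕ}

theorem wWt_of_wDiag_ne_zero {M : Matrix ι ι A} {e : ℤ}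
    (h : ∀ a b, M a b ≠ 0 → (deg b : ℤ) = deg a + e) :
    ∀ n x y, wDiag M n x y ≠ 0 → wWt deg n y = wWt deg n x + e
  | 0, x, y, hxy => h x y hxy
  | n + 1, Sum.inl x, Sum.inl y, hxy => wWt_of_wDiag_ne_zero h n x y hxy
  | n + 1, Sum.inl x, Sum.inr y, hxy => (hxy rfl).elim
  | n + 1, Sum.inr x, Sum.inl y, hxy => (hxy rfl).elim
  | n + 1, Sum.inr x, Sum.inr y, hxy => by
    have := wWt_of_wDiag_ne_zero h n x y hxy
    rw [wWt, wWt]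
    linarith

theorem wWt_of_wAlt_ne_zero :
    ∀ n x y, wAlt A ι n x y ≠ 0 → wWt deg n y = wWt deg n x + 1
  | 0, x, y, hxy => (hxy rfl).elim
  | n + 1, Sum.inl x, Sum.inl y, hxy => wWt_of_wAlt_ne_zero n x y hxy
  | n + 1, Sum.inl x, Sum.inr y, hxy => (hxy rfl).elim
  | n + 1, Sum.inr x, Sum.inl y, hxy => by
    have h1 : x = y := by
      by_contra hne
      exact hxy (Matrix.one_apply_ne hne)
    rw [wWt, wWt, h1]
    ring
  | n + 1, Sum.inr x, Sum.inr y, hxy => by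
    have := wWt_of_wAlt_ne_zero n x y (neg_ne_zero.1 hxy)
    rw [wWt, wWt]
    linarith

theorem wWt_of_wZero_ne_zero {D : Matrix ι ι A} (hD : IsLowering deg D) (n : ℕ) :
    ∀ x y, wZero D n x y ≠ 0 → wWt deg (n + 1) y = wWt deg n x
  | x, Sum.inl y, hxy => by
    have h1 : x = y := by
      by_contra hne
      exact hxy (Matrix.one_apply_ne hne)
    rw [wWt, h1]
  | x, Sum.inr y, hxy => by
    have h1 : wDiag D n x y - wAlt A ι n x y ≠ 0 := hxy
    rw [wWt]
    by_cases h2 : wDiag D n x y = 0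
    · have := wWt_of_wAlt_ne_zero (deg := deg) n x y fun h3 => h1 (by rw [h2, h3, sub_zero])
      linarith
    · have := wWt_of_wDiag_ne_zero (e := 1) (fun a b h => by exact_mod_cast hD a b h) n x y h2
      linarith

theorem wWt_of_wHtpy_ne_zero {D H : Matrix ι ι A} (hD : IsLowering deg D)
    (hH : IsLowering deg H.transpose) (n : ℕ) :
    ∀ x y, wHtpy D H n x y ≠ 0 → wWt deg n y = wWt deg (n + 1) x := by
  have hH' : ∀ a b, H a b ≠ 0 → (deg b : ℤ) = deg a + -1 := fun a b h => by
    have := hH b a h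
    omega
  intro x y hxy
  match x, hxy with
  | Sum.inl x, hxy =>
    have h1 : ∑ k, wDiag H n x k * (wDiag D n k y + wAlt A ι n k y) ≠ 0 := hxy
    obtain ⟨k, -, hk⟩ := Finset.exists_ne_zero_of_sum_ne_zero h1
    have h2 := wWt_of_wDiag_ne_zero hH' n x k (left_ne_zero_of_mul hk)
    have h3 := right_ne_zero_of_mul hk
    rw [wWt]
    by_cases h4 : wDiag D n k y = 0
    · have := wWt_of_wAlt_ne_zero (deg := deg) n k y fun h5 => h3 (by rw [h4, h5, zero_add])
      linarith
    · have := wWt_of_wDiag_ne_zero (e := 1) (fun a b h => by exact_mod_cast hD a b h) n k y h4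
      linarith
  | Sum.inr x, hxy =>
    have h1 : wDiag H n x y ≠ 0 := hxy
    have h2 := wWt_of_wDiag_ne_zero hH' n x y h1
    rw [wWt]
    linarith

theorem exists_wFace_eq_one : ∀ n j (y : WIdx ι (n + 1)), wBit (n + 1) j y = false →
    ∃ x, wFace A ι n j x y = 1 ∧ ∀ y', y' ≠ y → wFace A ι n j x y' = 0
  | n, 0, Sum.inl y, _ => by
    refine ⟨y, ?_, fun y' h => ?_⟩
    · rw [wFace.eq_1]
      exact Matrix.one_apply_eq y
    rw [wFace.eq_1]
    match y' with
    | Sum.inl y' => exact Matrix.one_apply_ne fun h' => h (congrArg Sum.inl h'.symm)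
    | Sum.inr y' => rfl
  | _, 0, Sum.inr y, h => (Bool.true_eq_false.mp h).elim
  | 0, _ + 1, Sum.inl _, h => (Bool.true_eq_false.mp h).elim
  | 0, _ + 1, Sum.inr _, h => (Bool.true_eq_false.mp h).elim
  | n + 1, j + 1, Sum.inl y, h => by
    obtain ⟨x, hx, hx'⟩ := exists_wFace_eq_one n j y h
    refine ⟨Sum.inl x, hx, fun y' h => ?_⟩
    match y' with
    | Sum.inl y' => exact hx' y' fun h' => h (congrArg Sum.inl h')
    | Sum.inr y' => rfl
  | n + 1, j + 1, Sum.inr y, h => by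
    obtain ⟨x, hx, hx'⟩ := exists_wFace_eq_one n j y h
    refine ⟨Sum.inr x, hx, fun y' h => ?_⟩
    match y' with
    | Sum.inr y' => exact hx' y' fun h' => h (congrArg Sum.inr h')
    | Sum.inl y' => rfl

theorem wBit_of_wFace_ne_zero : ∀ n j (x : WIdx ι n) (y : WIdx ι (n + 1)),
    wFace A ι n j x y ≠ 0 → wBit (n + 1) j y = false
  | n, 0, x, Sum.inl y, _ => rfl
  | n, 0, x, Sum.inr y, h => by
    rw [wFace.eq_1] at h
    exact (h rfl).elim
  | 0, _ + 1, _, _, h => (h rfl).elim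
  | n + 1, j + 1, Sum.inl x, Sum.inl y, h => wBit_of_wFace_ne_zero n j x y h
  | n + 1, j + 1, Sum.inl x, Sum.inr y, h => (h rfl).elim
  | n + 1, j + 1, Sum.inr x, Sum.inl y, h => (h rfl).elim
  | n + 1, j + 1, Sum.inr x, Sum.inr y, h => wBit_of_wFace_ne_zero n j x y h

theorem wAlt_wTop : ∀ n (b b' : ι), wAlt A ι n (wTop n b) (wTop n b') = 0
  | 0, _, _ => rfl
  | n + 1, b, b' => neg_eq_zero.2 (wAlt_wTop n b b')

theorem wDiag_wTop (M : Matrix ι ι A) :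
    ∀ n (b b' : ι), wDiag M n (wTop n b) (wTop n b') = M b b'
  | 0, _, _ => rfl
  | n + 1, b, b' => wDiag_wTop M n b b'

theorem wZero_wTop (D : Matrix ι ι A) (n : ℕ) (b b' : ι) :
    wZero D n (wTop n b) (wTop (n + 1) b') = D b b' := by
  change wDiag D n (wTop n b) (wTop n b') - wAlt A ι n (wTop n b) (wTop n b') = D b b'
  rw [wAlt_wTop, wDiag_wTop, sub_zero]

end Weights

section Kron

variable {A : Type u} [CommRing A] {J : Type} [Fintype J] [DecidableEq J] {X Y Z : Type w}

/-- The tensor power of a matrix. -/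
def kron (J : Type) [Fintype J] (M : Matrix X Y A) : Matrix (J → X) (J → Y) A :=
  fun t t' => ∏ j, M (t j) (t' j)

theorem kron_mul [Fintype Y] (M : Matrix X Y A) (N : Matrix Y Z A) :
    kron J (M * N) = kron J M * kron J N := by
  ext t t'
  simp only [kron, Matrix.mul_apply, Finset.prod_univ_sum, ← Finset.prod_mul_distrib]
  exact Finset.sum_congr (by ext; simp) fun _ _ => rfl

theorem kron_smul_one [DecidableEq X] (z : A) :
    kron J (z • (1 : Matrix X X A)) = z ^ Fintype.card J • 1 := by
  ext t t'
  simp only [kron, Matrix.smul_apply, Matrix.one_apply, smul_eq_mul, Finset.prod_mul_distrib,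
    Finset.prod_const, Finset.card_univ]
  congr 1
  by_cases h : t = t'
  · simp [h]
  · rw [if_neg h]
    obtain ⟨j, hj⟩ := Function.ne_iff.1 h
    exact Finset.prod_eq_zero (Finset.mem_univ j) (if_neg hj)

theorem ne_zero_of_kron_ne_zero {M : Matrix X Y A} {t : J → X} {t' : J → Y}
    (h : kron J M t t' ≠ 0) (j : J) : M (t j) (t' j) ≠ 0 :=
  fun h0 => h (Finset.prod_eq_zero (Finset.mem_univ j) h0)

/-- Extension of a function by zero. -/
def zeroExt {Y : Type w} (P : Y → Prop) (v : {y // P y} → A) (y : Y) : A :=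
  open Classical in if h : P y then v ⟨y, h⟩ else 0

theorem mulVec_zeroExt [Fintype Y] (P : Y → Prop) [Fintype {y // P y}] (M : Matrix X Y A)
    (v : {y // P y} → A) (x : X) :
    (M.mulVec (zeroExt P v)) x = ∑ y : {y // P y}, M x y.1 * v y := by
  classical
  have h1 : ∀ y : {y // P y}, M x y.1 * v y = M x y.1 * zeroExt P v y.1 := fun y => by
    rw [zeroExt, dif_pos y.2]
  have h2 : ∀ y : {y // ¬ P y}, M x y.1 * zeroExt P v y.1 = 0 := fun y => by
    rw [zeroExt, dif_neg y.2, mul_zero]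
  have h3 := Fintype.sum_subtype_add_sum_subtype P fun y => M x y * zeroExt P v y
  rw [Fintype.sum_eq_zero _ h2, add_zero] at h3
  rw [Fintype.sum_congr _ _ h1]
  exact h3.symm.trans (Finset.sum_congr (Finset.ext fun _ => by simp) fun _ _ => rfl)

theorem zeroExt_comp_val {P : Y → Prop} {u : Y → A} (hu : ∀ y, ¬ P y → u y = 0) :
    zeroExt P (fun y => u y.1) = u := by
  funext y
  by_cases h : P y
  · rw [zeroExt, dif_pos h]
  · rw [zeroExt, dif_neg h, hu y h]

theorem zeroExt_of_not {P : Y → Prop} (v : {y // P y} → A) {y : Y} (h : ¬ P y) :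
    zeroExt P v y = 0 := dif_neg h

end Kron

section TensorPower

variable {A : Type u} [CommRing A] {J : Type} [Fintype J] [DecidableEq J] [Nonempty J]
  {ι : Type w} [Fintype ι] [DecidableEq ι] {deg : ι → ℕ}

/-- The tuples of words that index the normalized chains of weight zero. -/
def IsNormIdx (J : Type) (deg : ι → ℕ) (n : ℕ) (t : J → WIdx ι n) : Prop :=
  (∀ j, wWt deg n (t j) = 0) ∧ ∀ i, ∃ j, wBit n i (t j)

/-- Functions supported on the normalized tuples. -/
def IsNormVec (J : Type) (deg : ι → ℕ) (n : ℕ) (v : (J → WIdx ι n) → A) : Prop :=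
  ∀ t, ¬ IsNormIdx J deg n t → v t = 0

theorem isNormVec_zero_iff {v : (J → WIdx ι 0) → A} :
    IsNormVec J deg 0 v ↔ ∀ t j, wWt deg 0 (t j) ≠ 0 → v t = 0 := by
  refine ⟨fun h t j hj => h t fun ht => hj (ht.1 j), fun h t ht => ?_⟩
  by_contra hv
  exact ht ⟨fun j => by_contra fun hj => hv (h t j hj), fun i => ⟨Classical.arbitrary J, rfl⟩⟩

theorem isNormVec_succ_iff {n : ℕ} {v : (J → WIdx ι (n + 1)) → A} :
    IsNormVec J deg (n + 1) v ↔ (∀ t j, wWt deg (n + 1) (t j) ≠ 0 → v t = 0) ∧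
      ∀ i, (kron J (wFace A ι n i)).mulVec v = 0 := by
  constructor
  · refine fun h => ⟨fun t j hj => h t fun ht => hj (ht.1 j), fun i => funext fun t => ?_⟩
    refine Finset.sum_eq_zero fun t' _ => ?_
    by_cases h0 : kron J (wFace A ι n i) t t' = 0
    · exact mul_eq_zero_of_left h0 _
    · refine mul_eq_zero_of_right _ (h t' fun ht => ?_)
      obtain ⟨j, hj⟩ := ht.2 i
      have := wBit_of_wFace_ne_zero _ _ _ _ (ne_zero_of_kron_ne_zero h0 j)
      rw [this] at hj
      exact Bool.false_ne_true hj
  · rintro ⟨h1, h2⟩ t ht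
    by_contra hv
    have hw : ∀ j, wWt deg (n + 1) (t j) = 0 := fun j => by_contra fun hj => hv (h1 t j hj)
    have hb : ∃ i, ∀ j, wBit (n + 1) i (t j) = false := by
      by_contra hb
      push Not at hb
      exact ht ⟨hw, fun i => (hb i).imp fun j hj => Bool.of_not_eq_false hj⟩
    obtain ⟨i, hi⟩ := hb
    choose x hx hx' using fun j => exists_wFace_eq_one (A := A) n i (t j) (hi j)
    have h3 : ∑ t', kron J (wFace A ι n i) x t' * v t' = 0 := congrFun (h2 i) x
    rw [Finset.sum_eq_single t] at h3
    · refine hv ?_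
      simpa [kron, hx] using h3
    · intro t' _ hne
      obtain ⟨j, hj⟩ := Function.ne_iff.1 hne
      exact mul_eq_zero_of_left (Finset.prod_eq_zero (Finset.mem_univ j) (hx' j _ hj)) _
    · exact fun h => (h (Finset.mem_univ t)).elim

theorem IsNormVec.wt {n : ℕ} {v : (J → WIdx ι n) → A} (h : IsNormVec J deg n v) (t : J → WIdx ι n)
    (j : J) (hj : wWt deg n (t j) ≠ 0) : v t = 0 :=
  h t fun ht => hj (ht.1 j)

theorem kron_mulVec_wt {n m : ℕ} {M : Matrix (WIdx ι m) (WIdx ι n) A}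
    (hM : ∀ x y, M x y ≠ 0 → wWt deg n y = wWt deg m x) {v : (J → WIdx ι n) → A}
    (hv : ∀ t j, wWt deg n (t j) ≠ 0 → v t = 0) (t : J → WIdx ι m) (j : J)
    (hj : wWt deg m (t j) ≠ 0) : (kron J M).mulVec v t = 0 := by
  refine Finset.sum_eq_zero fun t' _ => ?_
  by_cases h0 : kron J M t t' = 0
  · exact mul_eq_zero_of_left h0 _
  · refine mul_eq_zero_of_right _ (hv t' j ?_)
    rwa [hM _ _ (ne_zero_of_kron_ne_zero h0 j)]

theorem IsNormVec.wZero {D : Matrix ι ι A} (hD : IsLowering deg D) {n : ℕ}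
    {v : (J → WIdx ι (n + 1)) → A} (h : IsNormVec J deg (n + 1) v) :
    IsNormVec J deg n ((kron J (wZero D n)).mulVec v) := by
  have h1 := kron_mulVec_wt (J := J) (wWt_of_wZero_ne_zero hD n) h.wt
  cases n with
  | zero => exact isNormVec_zero_iff.2 h1
  | succ n =>
    refine isNormVec_succ_iff.2 ⟨h1, fun i => ?_⟩
    rw [Matrix.mulVec_mulVec, ← kron_mul, wFace_mul_wZero, kron_mul, ← Matrix.mulVec_mulVec,
      (isNormVec_succ_iff.1 h).2, Matrix.mulVec_zero]

theorem IsNormVec.wZero_wZero {D : Matrix ι ι A} (hDD : D * D = 0) {n : ℕ}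
    {v : (J → WIdx ι (n + 2)) → A} (h : IsNormVec J deg (n + 2) v) :
    (kron J (_root_.wZero D n)).mulVec ((kron J (_root_.wZero D (n + 1))).mulVec v) = 0 := by
  rw [Matrix.mulVec_mulVec, ← kron_mul, wZero_mul_wZero hDD, kron_mul, ← Matrix.mulVec_mulVec,
    (isNormVec_succ_iff.1 h).2, Matrix.mulVec_zero]

theorem IsNormVec.wHtpy_succ {D H : Matrix ι ι A} (hD : IsLowering deg D) (hDD : D * D = 0)
    (hH : IsLowering deg H.transpose) {n : ℕ}
    {v : (J → WIdx ι (n + 1)) → A} (h : IsNormVec J deg (n + 1) v)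
    (hv : (kron J (_root_.wZero D n)).mulVec v = 0) :
    IsNormVec J deg (n + 2) ((kron J (wHtpy D H (n + 1))).mulVec v) := by
  refine isNormVec_succ_iff.2
    ⟨kron_mulVec_wt (J := J) (wWt_of_wHtpy_ne_zero hD hH (n + 1)) h.wt, fun i => ?_⟩
  rw [Matrix.mulVec_mulVec, ← kron_mul]
  cases i with
  | zero =>
    rw [wFace_zero_mul_wHtpy hDD, kron_mul, ← Matrix.mulVec_mulVec, hv, Matrix.mulVec_zero]
  | succ i =>
    rw [wFace_succ_mul_wHtpy, kron_mul, ← Matrix.mulVec_mulVec, (isNormVec_succ_iff.1 h).2,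
      Matrix.mulVec_zero]

theorem IsNormVec.wHtpy_zero {D H : Matrix ι ι A} (hD : IsLowering deg D)
    (hH : IsLowering deg H.transpose) {v : (J → WIdx ι 0) → A} (h : IsNormVec J deg 0 v) :
    IsNormVec J deg 1 ((kron J (wHtpy D H 0)).mulVec v) := by
  refine isNormVec_succ_iff.2
    ⟨kron_mulVec_wt (J := J) (wWt_of_wHtpy_ne_zero hD hH 0) h.wt, fun i => ?_⟩
  rw [Matrix.mulVec_mulVec, ← kron_mul]
  cases i with
  | zero =>
    rw [wFace_zero_mul_wHtpy_zero]
    refine funext fun t => Finset.sum_eq_zero fun t' _ => ?_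
    by_cases h0 : v t' = 0
    · exact mul_eq_zero_of_right _ h0
    · refine mul_eq_zero_of_left (by_contra fun h1 => h0 ?_) _
      have h2 := ne_zero_of_kron_ne_zero h1 (Classical.arbitrary J)
      refine h.wt t' (Classical.arbitrary J) fun h3 => h2 ?_
      refine Finset.sum_eq_zero fun b _ => mul_eq_zero_of_right _ (by_contra fun h4 => ?_)
      have h5 := hD _ _ h4
      have h6 : (deg (t' (Classical.arbitrary J)) : ℤ) = 0 := h3
      omega
  | succ i =>
    refine funext fun t => Finset.sum_eq_zero fun t' _ => mul_eq_zero_of_left ?_ _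
    refine Finset.prod_eq_zero (Finset.mem_univ (Classical.arbitrary J)) ?_
    have : (wFace A ι 0 (i + 1)) = 0 := rfl
    rw [this, Matrix.zero_mul]
    rfl

theorem kron_wZero_wHtpy {D H : Matrix ι ι A} {z : A} (hH : D * H + H * D = z • 1) {n : ℕ}
    (v : (J → WIdx ι n) → A) :
    (kron J (wZero D n)).mulVec ((kron J (wHtpy D H n)).mulVec v) = z ^ Fintype.card J • v := by
  rw [Matrix.mulVec_mulVec, ← kron_mul, wZero_mul_wHtpy hH, kron_smul_one, Matrix.smul_mulVec,
    Matrix.one_mulVec]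

theorem le_of_isNormIdx {r : ℕ} (hr : ∀ b, deg b ≤ r) {n : ℕ} {t : J → WIdx ι n}
    (ht : IsNormIdx J deg n t) : n ≤ Fintype.card J * r := by
  have h1 : ∑ j, ∑ i ∈ Finset.range n, ((wBit n i (t j)).toNat : ℤ) ≤ ∑ j : J, (r : ℤ) :=
    Finset.sum_le_sum fun j _ => by
      have := wWt_add_count_le hr n (t j)
      rwa [ht.1 j, zero_add] at this
  have h2 : ∑ i ∈ Finset.range n, (1 : ℤ) ≤
      ∑ i ∈ Finset.range n, ∑ j, ((wBit n i (t j)).toNat : ℤ) := by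
    refine Finset.sum_le_sum fun i _ => ?_
    obtain ⟨j, hj⟩ := ht.2 i
    refine le_trans ?_ (Finset.single_le_sum (f := fun j => ((wBit n i (t j)).toNat : ℤ))
      (fun j _ => Int.natCast_nonneg _) (Finset.mem_univ j))
    simp [hj]
  rw [Finset.sum_comm] at h1
  have h3 := h2.trans h1
  simp only [Finset.sum_const, Finset.card_range, nsmul_eq_mul, mul_one, Finset.card_univ] at h3
  exact_mod_cast h3

end TensorPower

section Rotation

variable {A : Type u} [CommRing A] {ι : Type w} [Fintype ι] [DecidableEq ι] {deg : ι → ℕ}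

/-- Cyclic rotation of tuples. -/
def rot (q : ℕ) (Y : Type w) : Equiv.Perm (ZMod q → Y) where
  toFun t j := t (j + 1)
  invFun t j := t (j - 1)
  left_inv t := by ext; simp
  right_inv t := by ext; simp

theorem rot_pow_apply (q : ℕ) (Y : Type w) (m : ℕ) (t : ZMod q → Y) (j : ZMod q) :
    (rot q Y ^ m) t j = t (j + m) := by
  induction m generalizing t j with
  | zero => simp
  | succ m ih =>
    rw [pow_succ, Equiv.Perm.mul_apply, ih]
    change t (j + m + 1) = _
    push_cast
    rw [add_assoc]

theorem isNormIdx_rot (q : ℕ) (deg : ι → ℕ) (n : ℕ) (t : ZMod q → WIdx ι n) :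
    IsNormIdx (ZMod q) deg n (rot q _ t) ↔ IsNormIdx (ZMod q) deg n t := by
  refine and_congr ⟨fun h j => ?_, fun h j => h _⟩
    (forall_congr' fun i => ⟨fun ⟨j, hj⟩ => ⟨_, hj⟩, fun ⟨j, hj⟩ => ⟨j - 1, ?_⟩⟩)
  · simpa [rot] using h (j - 1)
  · simpa [rot] using hj

theorem kron_rot {q : ℕ} [NeZero q] {X Y : Type w} (M : Matrix X Y A) (t : ZMod q → X)
    (t' : ZMod q → Y) : kron (ZMod q) M (rot q X t) (rot q Y t') = kron (ZMod q) M t t' :=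
  Equiv.prod_comp (Equiv.addRight (1 : ZMod q)) fun j => M (t j) (t' j)

/-- The rotation of normalized tuples. -/
def normRot (q : ℕ) (deg : ι → ℕ) (n : ℕ) : Equiv.Perm {t // IsNormIdx (ZMod q) deg n t} :=
  (rot q _).subtypePerm (isNormIdx_rot q deg n)

theorem equivar_mulVecLin {X : Type v} {Y : Type w} [Fintype X] {g : Equiv.Perm X}
    {g' : Equiv.Perm Y} {M : Matrix Y X A} (hM : ∀ y x, M (g' y) (g x) = M y x) :
    Equivar g g' M.mulVecLin := by
  intro v
  ext y
  change ∑ x, M y x * v (g x) = ∑ x, M (g' y) x * v x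
  rw [← Equiv.sum_comp g fun x => M (g' y) x * v x]
  simp only [hM]

theorem altSum_hLen_pow_eq_zero [IsNoetherianRing A] [IsLocalRing A] {p : ℕ} [Fact p.Prime]
    (hp : ∀ a : A, (p : A) * a = 0 → a = 0) {D : Matrix ι ι A} (hD : IsLowering deg D)
    (hDD : D * D = 0) {r : ℕ} (hr : ∀ b, deg b ≤ r)
    (hJ : ∀ P : Ideal A, P.IsPrime → P ≠ IsLocalRing.maximalIdeal A →
      ∃ x, x ∉ P ∧ NullHtpy deg D x) (k : ℕ)
    (hfin : ∀ n, hLen deg (D.map (· ^ p ^ k)) (A ⧸ Ideal.span {(p : A)}) n ≠ ⊤) :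
    altSum (p ^ k * r) (hLen deg (D.map (· ^ p ^ k)) (A ⧸ Ideal.span {(p : A)})) = 0 := by
  classical
  have hq : p ^ k ≠ 0 := pow_ne_zero _ (Fact.out : p.Prime).ne_zero
  generalize hqdef : p ^ k = q at *
  have : NeZero q := ⟨hq⟩
  let P := IsNormIdx (ZMod q) deg
  let X : ℕ → Type w := fun n => {t // P n t}
  let Δ : ∀ n, Matrix (X n) (X (n + 1)) A := fun n x y => kron (ZMod q) (wZero D n) x.1 y.1
  let g : ∀ n, Equiv.Perm (X n) := normRot q deg
  have hval : ∀ n x, (g n x).1 = rot q _ x.1 := fun n x => rfl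
  have hΔv : ∀ n (v : X (n + 1) → A) (x : X n), (Δ n).mulVec v x =
      (kron (ZMod q) (wZero D n)).mulVec (zeroExt (P (n + 1)) v) x.1 :=
    fun n v x => (mulVec_zeroExt _ (kron (ZMod q) (wZero D n)) v x.1).symm
  have hnorm : ∀ n (v : X n → A), IsNormVec (ZMod q) deg n (zeroExt (P n) v) :=
    fun n v t ht => zeroExt_of_not v ht
  have hext : ∀ n (v : X (n + 1) → A), zeroExt (P n) ((Δ n).mulVec v) =
      (kron (ZMod q) (wZero D n)).mulVec (zeroExt (P (n + 1)) v) := by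
    intro n v
    rw [← zeroExt_comp_val (P := P n) ((hnorm (n + 1) v).wZero hD)]
    exact congrArg _ (funext (hΔv n v))
  have hzero : ∀ n, zeroExt (P n) (0 : X n → A) = 0 :=
    fun n => zeroExt_comp_val (P := P n) (u := 0) fun _ _ => rfl
  refine altSum_hLen_eq_zero (X := X) (Δ := Δ) (g := g) (k := k) hp ?_ ?_ ?_ ?_ ?_ ?_
    (fun n b h => ⟨fun _ => wTop n b, fun _ => by rw [wWt_wTop, h, sub_self],
      fun i => ⟨0, wBit_wTop n i b⟩⟩) ?_ ?_ ?_ ?_ hfin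
  · intro n
    rw [hqdef]
    change normRot q deg n ^ q = 1
    rw [normRot, Equiv.Perm.subtypePerm_pow]
    ext x j
    change (rot q _ ^ q) x.1 j = x.1 j
    rw [rot_pow_apply, ZMod.natCast_self, add_zero]
  · intro n x y
    exact kron_rot _ _ _
  · intro n v
    match n with
    | 0 => rfl
    | n + 1 =>
      funext x
      change (Δ n).mulVec ((Δ (n + 1)).mulVec v) x = 0
      rw [hΔv, hext, (hnorm _ v).wZero_wZero hDD]
      rfl
  · intro Q hQ hQm
    obtain ⟨z, hz, H, hH, hzH⟩ := hJ Q hQ hQm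
    refine ⟨z ^ q, fun h => hz (hQ.mem_of_pow_mem _ h), fun n => ?_⟩
    let S : Matrix (X (n + 1)) (X n) A := fun x y => kron (ZMod q) (wHtpy D H n) x.1 y.1
    refine ⟨S.mulVecLin, equivar_mulVecLin fun y x => kron_rot _ _ _, fun v hv => ?_⟩
    have h1 : IsNormVec (ZMod q) deg (n + 1)
        ((kron (ZMod q) (wHtpy D H n)).mulVec (zeroExt (P n) v)) := by
      match n with
      | 0 => exact (hnorm 0 v).wHtpy_zero hD hH
      | n + 1 =>
        refine (hnorm _ v).wHtpy_succ hD hDD hH ?_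
        rw [← hext]
        have h0 : (Δ n).mulVec v = 0 := hv
        rw [h0, hzero]
    have h2 : zeroExt (P (n + 1)) (S.mulVec v) =
        (kron (ZMod q) (wHtpy D H n)).mulVec (zeroExt (P n) v) := by
      rw [← zeroExt_comp_val (P := P (n + 1)) h1]
      exact congrArg _ (funext fun x => 
        (mulVec_zeroExt _ (kron (ZMod q) (wHtpy D H n)) v x.1).symm)
    funext x
    change (Δ n).mulVec (S.mulVec v) x = _
    rw [hΔv, h2, kron_wZero_wHtpy hzH, ZMod.card]
    change z ^ q * zeroExt (P n) v x.1 = z ^ q * v x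
    exact congrArg _ (dif_pos (c := P n x.1) x.2)
  · refine ⟨fun x => ?_⟩
    have := le_of_isNormIdx hr x.2
    rw [ZMod.card] at this
    omega
  · intro a b hab
    refine hD a b fun h => hab ?_
    simp [h, hq]
  · intro n b h
    rfl
  · intro n x hx
    have h1 : ∀ j, x.1 (j + 1) = x.1 j := fun j => congrFun (congrArg Subtype.val hx) j
    have h2 : ∀ m : ℕ, x.1 (m : ZMod q) = x.1 0 := by
      intro m
      induction m with
      | zero => simp
      | succ m ih => rw [Nat.cast_succ, h1, ih]
    have h3 : ∀ j, x.1 j = x.1 0 := fun j => by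
      rw [← h2 j.val, ZMod.natCast_zmod_val]
    obtain ⟨b, hb⟩ := exists_wTop_eq n (x.1 0) fun i => by
      obtain ⟨j, hj⟩ := x.2.2 i
      rwa [h3] at hj
    refine ⟨b, ?_, Subtype.ext (funext fun j => by rw [h3, ← hb])⟩
    have h4 := x.2.1 0
    rw [← hb, wWt_wTop] at h4
    omega
  · intro n b h b' h' hbb
    exact wTop_injective n (congrFun (congrArg Subtype.val hbb) 0)
  · intro n b h b' h'
    change ∏ j : ZMod q, wZero D n (wTop n b) (wTop (n + 1) b') = _
    rw [wZero_wTop, Finset.prod_const, Finset.card_univ, ZMod.card]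
    rfl

end Rotation

section BaseChange

variable {A : Type u} [CommRing A] {ι : Type w} [Fintype ι] [DecidableEq ι] {deg : ι → ℕ}

theorem relLen_restrictScalars {B : Type v} [CommRing B] [Algebra A B]
    (hB : Function.Surjective (algebraMap A B)) {X : Type w} [AddCommGroup X] [Module A X]
    [Module B X] [IsScalarTower A B X] (Z W : Submodule B X) :
    relLen (Z.restrictScalars A) (W.restrictScalars A) = relLen Z W := by
  rw [relLen, relLen, ← Module.length_eq_of_surjective hB]
  exact (Submodule.Quotient.restrictScalarsEquiv A (W.submoduleOf Z)).length_eq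

theorem hLen_quotient_eq (I : Ideal A) (D : Matrix ι ι A) (i : ℕ) :
    hLen deg D (A ⧸ I) i = hLen deg (D.map (Ideal.Quotient.mk I)) (A ⧸ I) i := by
  rw [hLen, hLen, ← relLen_restrictScalars (A := A) Ideal.Quotient.mk_surjective]
  rfl

end BaseChange

theorem exists_ringKrullDim_eq_natCast (A : Type u) [CommRing A] [IsNoetherianRing A]
    [IsLocalRing A] : ∃ e : ℕ, ringKrullDim A = e := by
  have h1 : ringKrullDim A ≠ ⊤ := ringKrullDim_ne_top
  have h2 : ringKrullDim A ≠ ⊥ := ringKrullDim_ne_bot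
  generalize ringKrullDim A = x at h1 h2
  induction x with
  | bot => exact absurd rfl h2
  | coe x =>
    induction x with
    | top => exact absurd rfl h1
    | coe x => exact ⟨x, rfl⟩

theorem mul_le_of_altSum_eq_zero {L r : ℕ} {f : ℕ → ℕ∞} (h : altSum L f = 0)
    (hr : ∀ n, r < n → f n = 0) {q c : ℕ} (hc : ∀ n, q * (f (n + 1)).toNat ≤ c) :
    q * (f 0).toNat ≤ r * c := by
  have h1 : ((f 0).toNat : ℤ) ≤ ∑ n ∈ Finset.range L, ((f (n + 1)).toNat : ℤ) := by
    rw [altSum, Finset.sum_range_succ'] at h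
    have h2 : -∑ n ∈ Finset.range L, (-1 : ℤ) ^ (n + 1) * ((f (n + 1)).toNat : ℤ) ≤
        ∑ n ∈ Finset.range L, ((f (n + 1)).toNat : ℤ) := by
      rw [← Finset.sum_neg_distrib]
      refine Finset.sum_le_sum fun n _ => ?_
      rcases neg_one_pow_eq_or ℤ (n + 1) with h3 | h3 <;> rw [h3] <;> omega
    simp only [pow_zero, one_mul] at h
    linarith
  have h2 : ∀ n ∈ Finset.range L, q * (f (n + 1)).toNat ≤ if n < r then c else 0 := by
    intro n _
    split_ifs with h3
    · exact hc n
    · rw [hr (n + 1) (by omega)]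
      simp
  calc q * (f 0).toNat ≤ q * ∑ n ∈ Finset.range L, (f (n + 1)).toNat := by
        gcongr
        exact_mod_cast h1
    _ = ∑ n ∈ Finset.range L, q * (f (n + 1)).toNat := Finset.mul_sum _ _ _
    _ ≤ ∑ n ∈ Finset.range L, if n < r then c else 0 := Finset.sum_le_sum h2
    _ = ((Finset.range L).filter (· < r)).card * c := by
        rw [← Finset.sum_filter, Finset.sum_const, smul_eq_mul]
    _ ≤ r * c := by
        gcongr
        refine (Finset.card_le_card fun n hn => ?_).trans (Finset.card_range r).le
        exact Finset.mem_range.2 (Finset.mem_filter.1 hn).2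

section MixedChar

variable {A : Type u} [CommRing A] [IsNoetherianRing A] [IsLocalRing A] {ι : Type w} [Fintype ι]
  [DecidableEq ι] {deg : ι → ℕ} {D : Matrix ι ι A}

theorem ringKrullDim_le_of_mixedChar (p : ℕ) [Fact p.Prime]
    (hp : ∀ a : A, (p : A) * a = 0 → a = 0) (hpm : (p : A) ∈ IsLocalRing.maximalIdeal A)
    (hD : IsLowering deg D) (hDD : D * D = 0) {r : ℕ} (hr : ∀ b, deg b ≤ r)
    (hJ : ∀ P : Ideal A, P.IsPrime → P ≠ IsLocalRing.maximalIdeal A →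
      ∃ x, x ∉ P ∧ NullHtpy deg D x) {a : ι} (ha : deg a = 0)
    (haD : ∀ b, D a b ∈ IsLocalRing.maximalIdeal A) : ringKrullDim A ≤ r := by
  let I : Ideal A := Ideal.span {(p : A)}
  let B := A ⧸ I
  let π : A →+* B := Ideal.Quotient.mk I
  have hπ : Function.Surjective π := Ideal.Quotient.mk_surjective
  have hI : I ≠ ⊤ := fun h => (IsLocalRing.maximalIdeal.isMaximal A).ne_top
    (top_le_iff.1 (h ▸ (Ideal.span_singleton_le_iff_mem _).2 hpm))
  have : Nontrivial B := Ideal.Quotient.nontrivial_iff.2 hI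
  have : IsLocalRing B := IsLocalRing.of_surjective' π hπ
  have : IsLocalHom π := IsLocalHom.of_surjective π hπ
  have hp0 : (p : B) = 0 := by
    rw [← map_natCast π]
    exact Ideal.Quotient.eq_zero_iff_mem.2 (Ideal.mem_span_singleton_self _)
  have : CharP B p := (CharP.charP_iff_prime_eq_zero Fact.out).2 hp0
  obtain ⟨e, he⟩ := exists_ringKrullDim_eq_natCast B
  have hdim : ringKrullDim A ≤ e + 1 := by
    rw [← he]
    have h1 := ringKrullDim_quotient_span_singleton_succ_eq_ringKrullDim_of_mem_jacobson
      (R := A) (x := (p : A)) (fun a b hab => by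
        have := hp (a - b) (by rw [mul_sub, sub_eq_zero]; exact hab)
        exact sub_eq_zero.1 this) (by
        rw [IsLocalRing.ringJacobson_eq_maximalIdeal]
        exact hpm)
    exact h1.ge
  by_contra hlt
  have her : r ≤ e := by
    by_contra h
    exact hlt (hdim.trans (by exact_mod_cast (by omega : e + 1 ≤ r)))
  have hJB : ∀ P : Ideal B, P.IsPrime → P ≠ IsLocalRing.maximalIdeal B →
      ∃ x, x ∉ P ∧ NullHtpy deg (D.map π) x := by
    intro P hP hPm
    obtain ⟨x, hx, hxD⟩ := hJ (P.comap π) inferInstance fun h => hPm (by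
      rw [← Ideal.map_comap_of_surjective π hπ P, h,
        IsLocalRing.map_maximalIdeal_of_surjective π hπ])
    exact ⟨π x, hx, hxD.map π⟩
  obtain ⟨C, hC⟩ := exists_pow_le_hLen_frobenius_zero p (hD.map π) ha
    (fun b => (IsLocalRing.mem_maximalIdeal _).2 fun h => (haD b) (isUnit_of_map_unit π _ h)) he.ge
  obtain ⟨C', hC'⟩ := exists_hLen_frobenius_le p (hD.map π) (map_mul_self_eq_zero hDD π) hr hJB e B
    inferInstance (by rw [Module.supportDim_self_eq_ringKrullDim, he])
  have hF : ∀ k n, hLen deg (D.map (· ^ p ^ k)) B n =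
      hLen deg ((D.map π).map (iterateFrobenius B p k)) B n := by
    intro k n
    rw [hLen_quotient_eq]
    congr 1
  have hfin : ∀ k n, hLen deg (D.map (· ^ p ^ k)) B n ≠ ⊤ := fun k n => by
    rw [hF]
    exact ne_top_of_le_ne_top (ENat.natCast_ne_top _) (hC' k n).1
  have key : ∀ k, p ^ k ≤ C * (r * C') := by
    intro k
    have h1 := altSum_hLen_pow_eq_zero hp hD hDD hr hJ k (hfin k)
    have hcoe : ∀ n, ((hLen deg (D.map (· ^ p ^ k)) B n).toNat : ℕ∞) =
        hLen deg ((D.map π).map (iterateFrobenius B p k)) B n := fun n => by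
      rw [ENat.natCast_toNat (hfin k n), hF]
    have h2 := mul_le_of_altSum_eq_zero (q := p ^ k) (c := C' * (p ^ k) ^ e) h1
      (fun n hn => hLen_eq_zero_of_lt hr hn) fun n => by
        have := (hC' k (n + 1)).2 (by omega)
        rw [← hcoe] at this
        exact_mod_cast this
    have h3 := hC k
    rw [← hcoe] at h3
    have h3 : (p ^ k) ^ e ≤ C * (hLen deg (D.map (· ^ p ^ k)) B 0).toNat := by exact_mod_cast h3
    refine Nat.le_of_mul_le_mul_right (c := (p ^ k) ^ e) ?_
      (pow_pos (pow_pos (Fact.out : p.Prime).pos _) _)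
    calc p ^ k * (p ^ k) ^ e ≤ p ^ k * (C * (hLen deg (D.map (· ^ p ^ k)) B 0).toNat) := by gcongr
      _ = C * (p ^ k * (hLen deg (D.map (· ^ p ^ k)) B 0).toNat) := by ring
      _ ≤ C * (r * (C' * (p ^ k) ^ e)) := by gcongr
      _ = _ := by ring
  exact absurd (key (C * (r * C'))) (not_le.2 (Nat.lt_pow_self (Fact.out : p.Prime).one_lt))

end MixedChar

section HypersurfacePresentation
open Polynomial

/-- Pseudo-division by a polynomial with leading coefficient `b`. -/
theorem exists_pow_mul_eq_mul_add {P : Type u} [CommRing P] (g : P[X]) (b : P)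
    (hg : g.coeff g.natDegree = b) (n : ℕ) (f : P[X]) (hf : f.natDegree ≤ n) :
    ∃ (M : ℕ) (q r : P[X]), C b ^ M * f = g * q + r ∧ (r.natDegree < g.natDegree ∨
      g.natDegree = 0 ∧ r = 0) := by
  induction n generalizing f with
  | zero =>
    rcases Nat.eq_zero_or_pos g.natDegree with h0 | h0
    · refine ⟨1, f, 0, ?_, Or.inr ⟨h0, rfl⟩⟩
      rw [h0] at hg
      rw [eq_C_of_natDegree_eq_zero h0, hg]; ring
    · exact ⟨0, 0, f, by ring, Or.inl (by omega)⟩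
  | succ n ih =>
    by_cases hlt : n + 1 < g.natDegree
    · exact ⟨0, 0, f, by ring, Or.inl (by omega)⟩
    · push Not at hlt
      set c := f.coeff (n + 1) with hc
      obtain ⟨M, q, r, h, hr⟩ := ih (C b * f - g * (C c * X ^ (n + 1 - g.natDegree))) (by
        rw [natDegree_le_iff_coeff_eq_zero]
        intro N hN
        rcases Nat.lt_or_ge (n + 1) N with h | h
        · rw [coeff_sub, coeff_C_mul, coeff_eq_zero_of_natDegree_lt (lt_of_le_of_lt hf h)]
          rw [coeff_eq_zero_of_natDegree_lt (p := g * _)]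
          · simp
          · refine lt_of_le_of_lt natDegree_mul_le ?_
            have := natDegree_C_mul_X_pow_le c (n + 1 - g.natDegree)
            omega
        · have : N = n + 1 := by omega
          subst this
          rw [coeff_sub, coeff_C_mul, ← hc, mul_left_comm, coeff_C_mul]
          have : n + 1 = g.natDegree + (n + 1 - g.natDegree) := by omega
          conv_lhs => enter [2, 2, 2]; rw [this]
          rw [coeff_mul_X_pow, hg]; ring)
      refine ⟨M + 1, q + C b ^ M * (C c * X ^ (n + 1 - g.natDegree)), r, ?_, hr⟩
      linear_combination h

/-- A finite set of algebraic elements of a domain of characteristic zero generates, up to a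
denominator, a simple extension. -/
theorem exists_primitive_element_presentation {P S : Type u} [CommRing P] [IsDomain P] [CharZero P]
    [CommRing S] [IsDomain S] [Algebra P S] [FaithfulSMul P S]
    (E : Set S) (hE : E.Finite) (halg : ∀ e ∈ E, IsAlgebraic P e) :
    ∃ (θ : S) (g : P[X]) (v : P) (y : E → P[X]),
      v ≠ 0 ∧ aeval θ g = 0 ∧ aeval θ (derivative g) ≠ 0 ∧
      (∀ f : P[X], aeval θ f = 0 → ∃ M : ℕ, g ∣ C v ^ M * f) ∧
      ∀ e : E, algebraMap P S v * e = aeval θ (y e) := by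
  classical
  let F := FractionRing P
  let K := FractionRing S
  have hPK : FaithfulSMul P K := FaithfulSMul.trans P S K
  let _ : Algebra F K := FractionRing.liftAlgebra P K
  have : IsScalarTower P F K := FractionRing.isScalarTower_liftAlgebra P K
  have hSK : Function.Injective (algebraMap S K) := IsFractionRing.injective S K
  have hPF : Function.Injective (algebraMap P F) := IsFractionRing.injective P F
  have hcF : CharZero F := charZero_of_injective_algebraMap hPF
  let E' : Set K := algebraMap S K '' E
  have hE'fin : Finite E' := (hE.image _).to_subtype
  have hintegral : ∀ z ∈ E', IsIntegral F z := by
    rintro _ ⟨e, he, rfl⟩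
    have h1 : IsAlgebraic P (algebraMap S K e) := (halg e he).algebraMap
    exact IsAlgebraic.isIntegral ((IsFractionRing.isAlgebraic_iff P F K).1 h1)
  let L := IntermediateField.adjoin F E'
  have : FiniteDimensional F L := IntermediateField.finiteDimensional_adjoin hintegral
  obtain ⟨α, hα⟩ := Field.exists_primitive_element F L
  have hmul : ∀ z : K, z ∈ Algebra.adjoin F E' → ∃ p : P, p ≠ 0 ∧ ∃ s : S,
      algebraMap P K p * z = algebraMap S K s := by
    intro z hz
    induction hz using Algebra.adjoin_induction with
    | mem x hx =>
      obtain ⟨e, he, rfl⟩ := hx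
      exact ⟨1, one_ne_zero, e, by simp⟩
    | algebraMap r =>
      obtain ⟨a, b, hb, rfl⟩ := IsFractionRing.div_surjective (A := P) r
      refine ⟨b, nonZeroDivisors.ne_zero hb, algebraMap P S a, ?_⟩
      have hb' : algebraMap P K b ≠ 0 := by
        simpa using nonZeroDivisors.ne_zero hb
      rw [map_div₀, ← IsScalarTower.algebraMap_apply P F K, ← IsScalarTower.algebraMap_apply P F K,
        ← IsScalarTower.algebraMap_apply P S K]
      rw [mul_div_cancel₀ _ hb']
    | add x y _ _ hx hy =>
      obtain ⟨p, hp, s, hs⟩ := hx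
      obtain ⟨q, hq, t, ht⟩ := hy
      refine ⟨p * q, mul_ne_zero hp hq, algebraMap P S q * s + algebraMap P S p * t, ?_⟩
      simp only [map_mul, map_add, ← IsScalarTower.algebraMap_apply P S K, ← hs, ← ht]
      ring
    | mul x y _ _ hx hy =>
      obtain ⟨p, hp, s, hs⟩ := hx
      obtain ⟨q, hq, t, ht⟩ := hy
      refine ⟨p * q, mul_ne_zero hp hq, s * t, ?_⟩
      simp only [map_mul, ← hs, ← ht]
      ring
  have hadj : (Algebra.adjoin F E') = L.toSubalgebra :=
    (IntermediateField.adjoin_toSubalgebra_of_isAlgebraic (fun x hx => (hintegral x hx).isAlgebraic)).symm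
  obtain ⟨p₀, hp₀, θ, hθ⟩ := hmul (α : K) (by rw [hadj]; exact α.2)
  let Θ : K := algebraMap S K θ
  have hΘint : IsIntegral F Θ := by
    rw [show Θ = algebraMap P K p₀ * α from hθ.symm, IsScalarTower.algebraMap_apply P F K]
    exact isIntegral_algebraMap.mul ((Algebra.IsIntegral.isIntegral (R := F) α).map L.val)
  have hmem : ∀ e ∈ E, algebraMap S K e ∈ Algebra.adjoin F {Θ} := by
    intro e he
    have h1 : algebraMap S K e ∈ L := IntermediateField.subset_adjoin F E' ⟨e, he, rfl⟩
    have h2 : (⟨_, h1⟩ : L) ∈ IntermediateField.adjoin F {α} := by rw [hα]; trivial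
    have h3 : algebraMap S K e ∈ IntermediateField.adjoin F {(α : K)} := by
      have := IntermediateField.adjoin_map F {α} L.val
      rw [Set.image_singleton] at this
      change _ ∈ IntermediateField.adjoin F {L.val α}
      rw [← this]
      exact ⟨_, h2, rfl⟩
    have h4 : IntermediateField.adjoin F {(α : K)} ≤ IntermediateField.adjoin F {Θ} := by
      rw [IntermediateField.adjoin_simple_le_iff]
      have hp' : algebraMap F K (algebraMap P F p₀) ≠ 0 := by
        rw [← IsScalarTower.algebraMap_apply]; simpa using hp₀
      have : (α : K) = (algebraMap F K (algebraMap P F p₀))⁻¹ * Θ := by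
        rw [eq_inv_mul_iff_mul_eq₀ hp', ← IsScalarTower.algebraMap_apply]
        exact hθ
      rw [this]
      exact mul_mem (inv_mem (algebraMap_mem _ _)) (IntermediateField.mem_adjoin_simple_self F Θ)
    rw [← IntermediateField.adjoin_simple_toSubalgebra_of_isAlgebraic hΘint.isAlgebraic]
    exact h4 h3
  have hev : ∀ f : P[X], algebraMap S K (aeval θ f) = aeval Θ (f.map (algebraMap P F)) := by
    intro f
    rw [aeval_map_algebraMap, aeval_algebraMap_apply]
  have hclear : ∀ q : F[X], ∃ b : P, b ≠ 0 ∧ ∃ q' : P[X], q'.map (algebraMap P F) = b • q := by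
    intro q
    obtain ⟨b, hb, h⟩ := IsLocalization.integerNormalization_spec (nonZeroDivisors P) q
    exact ⟨b, nonZeroDivisors.ne_zero hb, _, h⟩
  have hy : ∀ e : E, ∃ b : P, b ≠ 0 ∧ ∃ q' : P[X], algebraMap P S b * e = aeval θ q' := by
    intro e
    have := hmem e.1 e.2
    rw [Algebra.adjoin_singleton_eq_range_aeval] at this
    obtain ⟨q, hq⟩ := this
    obtain ⟨b, hb, q', h'⟩ := hclear q
    refine ⟨b, hb, q', hSK ?_⟩
    rw [hev, h', map_mul, ← IsScalarTower.algebraMap_apply, ← hq]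
    rw [← algebraMap_smul F b q, map_smul, algebraMap_smul, Algebra.smul_def]
    rfl
  choose b hb q hq using hy
  obtain ⟨c, hc, g, hg⟩ := hclear (minpoly F Θ)
  have hgs : g.map (algebraMap P F) = C (algebraMap P F c) * minpoly F Θ := by
    rw [hg, ← algebraMap_smul F c (minpoly F Θ), smul_eq_C_mul]
  have hc' : algebraMap P F c ≠ 0 := by simpa using hc
  have hmonic := minpoly.monic hΘint
  have hdeg : g.natDegree = (minpoly F Θ).natDegree := by
    rw [← natDegree_map_eq_of_injective hPF g, hgs, natDegree_C_mul hc']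
  have hlead : g.coeff g.natDegree = c := by
    apply hPF
    rw [← coeff_map, hgs, coeff_C_mul, hdeg, hmonic.coeff_natDegree, mul_one]
  have := hE.fintype
  refine ⟨θ, g, c * ∏ e, b e, fun e => C (c * ∏ e' ∈ Finset.univ.erase e, b e') * q e,
    mul_ne_zero hc (Finset.prod_ne_zero_iff.2 fun e _ => hb e), ?_, ?_, ?_, ?_⟩
  · apply hSK
    rw [hev, hgs, map_mul, minpoly.aeval, mul_zero, map_zero]
  · intro h0
    have h1 := congrArg (algebraMap S K) h0
    rw [hev, ← derivative_map, hgs, derivative_C_mul, map_mul, map_zero, aeval_C, mul_eq_zero] at h1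
    rcases h1 with h1 | h1
    · exact hc' (by simpa using h1)
    · exact (minpoly.irreducible hΘint).separable.aeval_derivative_ne_zero (minpoly.aeval F Θ) h1
  · intro f hf
    obtain ⟨M, q₁, r, h, hr⟩ := exists_pow_mul_eq_mul_add g c hlead f.natDegree f le_rfl
    have hr0 : r = 0 := by
      rcases hr with hr | hr
      · by_contra hne
        have h2 : aeval Θ (r.map (algebraMap P F)) = 0 := by
          rw [← hev]
          have h3 := congrArg (aeval θ) h
          rw [map_mul, hf, mul_zero, map_add, map_mul] at h3
          have h4 : aeval θ g = 0 := by
            apply hSK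
            rw [hev, hgs, map_mul, minpoly.aeval, mul_zero, map_zero]
          rw [h4, zero_mul, zero_add] at h3
          rw [← h3, map_zero]
        have h5 := natDegree_le_natDegree (minpoly.degree_le_of_ne_zero F Θ
          ((Polynomial.map_ne_zero_iff hPF).2 hne) h2)
        rw [natDegree_map_eq_of_injective hPF] at h5
        omega
      · exact hr.2
    rw [hr0, add_zero] at h
    refine ⟨M, ?_⟩
    rw [C_mul, mul_pow, mul_right_comm, h]
    exact Dvd.intro _ (mul_assoc _ _ _).symm
  · intro e
    beta_reduce
    rw [map_mul (aeval θ), aeval_C, ← hq, ← Finset.mul_prod_erase Finset.univ b (Finset.mem_univ e)]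
    simp only [map_mul]
    ring

/-- A finitely generated domain of characteristic zero, inside a domain `S`, is birational to a
hypersurface over a polynomial ring, whose variables may be chosen to contain given algebraically
independent elements. -/
theorem exists_hypersurface_presentation {S : Type u} [CommRing S] [IsDomain S] [CharZero S]
    (E : Set S) (hE : E.Finite) (E₀ : Set S) (hE₀ : E₀ ⊆ E) (hind : AlgebraicIndepOn ℤ id E₀) :
    ∃ (T : Set S) (_ : E₀ ⊆ T) (_ : T ⊆ E) (θ : S) (g : (MvPolynomial T ℤ)[X])
      (v : MvPolynomial T ℤ) (y : E → (MvPolynomial T ℤ)[X]),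
      let ev := eval₂RingHom (MvPolynomial.aeval (R := ℤ) ((↑) : T → S)).toRingHom θ
      ev (C v) ≠ 0 ∧ ev g = 0 ∧ ev (derivative g) ≠ 0 ∧
      (∀ f, ev f = 0 → ∃ M : ℕ, g ∣ C v ^ M * f) ∧ ∀ e : E, ev (C v) * e = ev (y e) := by
  obtain ⟨T, hT0, hTmax⟩ := Set.Finite.exists_le_maximal
    (s := {T : Set S | T ⊆ E ∧ AlgebraicIndepOn ℤ id T})
    (hE.finite_subsets.subset fun T hT => hT.1) (a := E₀) ⟨hE₀, hind⟩
  have hTE : T ⊆ E := hTmax.prop.1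
  have hTi : AlgebraicIndependent ℤ ((↑) : T → S) := hTmax.prop.2
  let _ : Algebra (MvPolynomial T ℤ) S :=
    (MvPolynomial.aeval (R := ℤ) ((↑) : T → S)).toRingHom.toAlgebra
  have hinj : Function.Injective (algebraMap (MvPolynomial T ℤ) S) := hTi
  have : FaithfulSMul (MvPolynomial T ℤ) S := (faithfulSMul_iff_algebraMap_injective _ _).2 hinj
  have halg : ∀ e ∈ E, IsAlgebraic (MvPolynomial T ℤ) e := by
    intro e he
    by_cases heT : e ∈ T
    · have : algebraMap (MvPolynomial T ℤ) S (MvPolynomial.X ⟨e, heT⟩) = e :=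
        MvPolynomial.aeval_X _ _
      rw [← this]
      exact isAlgebraic_algebraMap _
    · by_contra hne
      have h1 : Transcendental (Algebra.adjoin ℤ (id '' T)) e := by
        rw [Set.image_id]
        intro h2
        apply hne
        obtain ⟨f, hf0, hf⟩ := h2
        let φ := (hTi.aevalEquiv.trans (Subalgebra.equivOfEq _ (Algebra.adjoin ℤ T)
          (by rw [Subtype.range_coe]))).symm
        refine ⟨f.map φ.toRingEquiv.toRingHom,
          (Polynomial.map_ne_zero_iff φ.injective).2 hf0, ?_⟩
        rw [aeval_def, eval₂_map]
        rw [aeval_def] at hf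
        have hφ : (algebraMap (MvPolynomial T ℤ) S).comp φ.toRingEquiv.toRingHom =
            algebraMap (Algebra.adjoin ℤ T) S := by
          refine RingHom.ext fun z => ?_
          obtain ⟨z, rfl⟩ := φ.symm.surjective z
          change algebraMap (MvPolynomial T ℤ) S (φ (φ.symm z)) = _
          rw [AlgEquiv.apply_symm_apply]
          exact (hTi.algebraMap_aevalEquiv z).symm
        exact hφ ▸ hf
      have h2 := AlgebraicIndepOn.insert (x := id) (i := e) hTmax.prop.2 h1
      have := hTmax.le_of_ge (y := insert e T) ⟨Set.insert_subset he hTE, h2⟩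
        (Set.subset_insert _ _)
      exact heT (this (Set.mem_insert _ _))
  obtain ⟨θ, g, v, y, hv, h1, h2, h3, h4⟩ := exists_primitive_element_presentation E hE halg
  refine ⟨T, hT0, hTE, θ, g, v, y, ?_, h1, h2, h3, ?_⟩
  · have : algebraMap (MvPolynomial T ℤ) S v ≠ 0 := by simpa using hv
    simpa [RingHom.algebraMap_toAlgebra] using this
  · intro e
    rw [coe_eval₂RingHom, eval₂_C]
    exact h4 e
end HypersurfacePresentation

section HomOfFractions

/-- Ring homomorphisms `φ : Q → S` and `ψ : Q → B` with `ker φ ≤ ker ψ` induce a homomorphism to `B`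
from any subring of `S` generated by fractions whose images in `B` make sense. -/
theorem exists_ringHom_closure {Q S B : Type*} [CommRing Q] [CommRing S] [CommRing B]
    [IsDomain B] (φ : Q →+* S) (ψ : Q →+* B) (hker : ∀ f, φ f = 0 → ψ f = 0) (w : Q)
    (hw : ψ w ≠ 0) (E : Set S) (hE : ∀ e ∈ E, ∃ y, φ w * e = φ y ∧ ψ w ∣ ψ y) :
    ∃ χ : Subring.closure E →+* B, ∀ (c : Subring.closure E) (f : Q), φ f = c → χ c = ψ f := by
  have hex : ∀ c ∈ Subring.closure E, ∃ b : B, ∃ (n : ℕ) (f : Q),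
      φ w ^ n * c = φ f ∧ ψ w ^ n * b = ψ f := by
    intro c hc
    induction hc using Subring.closure_induction with
    | mem x hx =>
      obtain ⟨y, h1, b, hb⟩ := hE x hx
      exact ⟨b, 1, y, by simpa using h1, by simpa using hb.symm⟩
    | zero => exact ⟨0, 0, 0, by simp, by simp⟩
    | one => exact ⟨1, 0, 1, by simp, by simp⟩
    | add x y _ _ hx hy =>
      obtain ⟨b, n, f, h1, h2⟩ := hx
      obtain ⟨b', n', f', h1', h2'⟩ := hy
      refine ⟨b + b', n + n', w ^ n' * f + w ^ n * f', ?_, ?_⟩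
      · rw [map_add, map_mul, map_mul, map_pow, map_pow, ← h1, ← h1']; ring
      · rw [map_add, map_mul, map_mul, map_pow, map_pow, ← h2, ← h2']; ring
    | neg x _ hx =>
      obtain ⟨b, n, f, h1, h2⟩ := hx
      exact ⟨-b, n, -f, by rw [map_neg, ← h1]; ring, by rw [map_neg, ← h2]; ring⟩
    | mul x y _ _ hx hy =>
      obtain ⟨b, n, f, h1, h2⟩ := hx
      obtain ⟨b', n', f', h1', h2'⟩ := hy
      refine ⟨b * b', n + n', f * f', ?_, ?_⟩
      · rw [map_mul, ← h1, ← h1']; ring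
      · rw [map_mul, ← h2, ← h2']; ring
  have huniq : ∀ (c : S) (b b' : B) (n n' : ℕ) (f f' : Q), φ w ^ n * c = φ f → ψ w ^ n * b = ψ f →
      φ w ^ n' * c = φ f' → ψ w ^ n' * b' = ψ f' → b = b' := by
    intro c b b' n n' f f' h1 h2 h1' h2'
    have h3 := hker (w ^ n' * f - w ^ n * f') (by
      rw [map_sub, map_mul, map_mul, map_pow, map_pow, ← h1, ← h1']; ring)
    rw [map_sub, map_mul, map_mul, map_pow, map_pow, ← h2, ← h2'] at h3
    have h4 : ψ w ^ (n + n') * (b - b') = 0 := by linear_combination h3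
    exact sub_eq_zero.1 ((mul_eq_zero.1 h4).resolve_left (pow_ne_zero _ hw))
  choose χ n f h1 h2 using hex
  refine ⟨{ toFun := fun c => χ c c.2, map_one' := ?_, map_mul' := ?_, map_zero' := ?_,
            map_add' := ?_ }, ?_⟩
  · exact huniq 1 _ _ _ 0 _ 1 (h1 1 (one_mem _)) (h2 _ _) (by simp) (by simp)
  · intro c c'
    refine huniq (c * c') _ _ _ (n _ c.2 + n _ c'.2) _ (f _ c.2 * f _ c'.2) (h1 _ (c * c').2)
      (h2 _ _) ?_ ?_
    · rw [map_mul, ← h1, ← h1]; ring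
    · rw [map_mul, ← h2, ← h2]; ring
  · exact huniq 0 _ _ _ 0 _ 0 (h1 0 (zero_mem _)) (h2 _ _) (by simp) (by simp)
  · intro c c'
    refine huniq (c + c') _ _ _ (n _ c.2 + n _ c'.2) _
      (w ^ n _ c'.2 * f _ c.2 + w ^ n _ c.2 * f _ c'.2) (h1 _ (c + c').2) (h2 _ _) ?_ ?_
    · rw [map_add, map_mul, map_mul, map_pow, map_pow, ← h1, ← h1]; ring
    · rw [map_add, map_mul, map_mul, map_pow, map_pow, ← h2, ← h2]; ring
  · intro c g hg
    exact huniq c _ _ _ 0 _ g (h1 _ c.2) (h2 _ _) (by simp [hg]) (by simp)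

end HomOfFractions

section Approximation
open Polynomial

theorem exists_fixedPoint_of_isAdicComplete {R : Type*} [CommRing R] (I : Ideal R)
    [IsAdicComplete I R] (Φ : R → R) (hΦ : ∀ x y n, x - y ∈ I ^ n → Φ x - Φ y ∈ I ^ (n + 1)) :
    ∃ s, Φ s = s := by
  let x : ℕ → R := fun n => Φ^[n] 0
  have hx : ∀ n, x (n + 1) = Φ (x n) := fun n => Function.iterate_succ_apply' Φ n 0
  have hstep : ∀ n, x (n + 1) - x n ∈ I ^ n := by
    intro n
    induction n with
    | zero => simp
    | succ n ih => have := hΦ _ _ _ ih; rwa [← hx, ← hx] at this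
  have hcau : ∀ {m n}, m ≤ n → x m ≡ x n [SMOD (I ^ m • ⊤ : Submodule R R)] := by
    intro m n hmn
    rw [SModEq.sub_mem, smul_eq_mul, Ideal.mul_top]
    induction n, hmn using Nat.le_induction with
    | base => simp
    | succ n hmn ih =>
      rw [show x m - x (n + 1) = (x m - x n) - (x (n + 1) - x n) by ring]
      exact sub_mem ih (Ideal.pow_le_pow_right hmn (hstep n))
  obtain ⟨L, hL⟩ := IsPrecomplete.prec (I := I) (M := R) inferInstance hcau
  have hL' : ∀ n, x n - L ∈ I ^ n := fun n => by
    have := hL n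
    rwa [SModEq.sub_mem, smul_eq_mul, Ideal.mul_top] at this
  refine ⟨L, sub_eq_zero.1 (IsHausdorff.haus (I := I) (M := R) inferInstance _ fun n => ?_)⟩
  rw [SModEq.zero, smul_eq_mul, Ideal.mul_top]
  have h1 := hΦ _ _ _ (hL' n)
  rw [← hx] at h1
  rw [show Φ L - L = (x (n + 1) - L) - (x (n + 1) - Φ L) by ring]
  exact Ideal.pow_le_pow_right (Nat.le_succ n) (sub_mem (hL' (n + 1)) h1)

variable {σ : Type*} {B B' : Type*} [CommRing B] [CommRing B']

/-- Evaluation of a polynomial over `ℤ[σ]` at a family `t` and an element `θ`. -/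
def evAt (t : σ → B) (θ : B) : (MvPolynomial σ ℤ)[X] →+* B :=
  eval₂RingHom (MvPolynomial.aeval (R := ℤ) t).toRingHom θ

theorem map_evAt (h : B →+* B') (t : σ → B) (θ : B) (f : (MvPolynomial σ ℤ)[X]) :
    h (evAt t θ f) = evAt (fun i => h (t i)) (h θ) f := by
  simp only [evAt, coe_eval₂RingHom, hom_eval₂]
  congr 1
  refine MvPolynomial.ringHom_ext' (RingHom.ext_int _ _) fun i => ?_
  change h (MvPolynomial.aeval t (MvPolynomial.X i)) = MvPolynomial.aeval _ (MvPolynomial.X i)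
  simp

theorem evAt_C_X (t : σ → B) (θ : B) (i : σ) : evAt t θ (C (MvPolynomial.X i)) = t i := by
  simp [evAt]

theorem evAt_sub_mem (I : Ideal B) {t t' : σ → B} {θ θ' : B} (ht : ∀ i, t i - t' i ∈ I)
    (hθ : θ - θ' ∈ I) (f : (MvPolynomial σ ℤ)[X]) : evAt t θ f - evAt t' θ' f ∈ I := by
  rw [← Ideal.Quotient.eq, map_evAt, map_evAt, Ideal.Quotient.eq.2 hθ]
  congr 2
  funext i
  exact Ideal.Quotient.eq.2 (ht i)

theorem dvd_evAt_sub {d : B} {t t' : σ → B} {θ θ' : B} (ht : ∀ i, d ∣ t i - t' i)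
    (hθ : d ∣ θ - θ') (f : (MvPolynomial σ ℤ)[X]) : d ∣ evAt t θ f - evAt t' θ' f := by
  simp only [← Ideal.mem_span_singleton] at *
  exact evAt_sub_mem _ ht hθ f

/-- Taylor expansion, uniform in the increment. -/
theorem exists_evAt_taylor (t : σ → B) (θ c : B) (g : (MvPolynomial σ ℤ)[X]) :
    ∃ k : B[X], ∀ s, evAt t (θ + c * s) g =
      evAt t θ g + evAt t θ (derivative g) * (c * s) + k.eval s * (c * s) ^ 2 := by
  let G : B[X] := g.map (MvPolynomial.aeval (R := ℤ) t).toRingHom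
  have hG : ∀ z, evAt t z g = G.eval z := fun z => (Polynomial.eval_map _ _).symm
  have hG' : ∀ z, evAt t z (derivative g) = (derivative G).eval z := fun z => by
    rw [derivative_map]
    exact (Polynomial.eval_map _ _).symm
  obtain ⟨k, hk⟩ := binomExpansion (G.map C) (C θ) (C c * X)
  refine ⟨k, fun s => ?_⟩
  have h := congrArg (eval s) hk
  have key : ∀ (F : B[X]) (z : B[X]), eval s (eval z (F.map C)) = eval (eval s z) F := by
    intro F z
    rw [Polynomial.eval_map, ← coe_evalRingHom, hom_eval₂]
    have : (evalRingHom s).comp C = RingHom.id B := by ext; simp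
    rw [this]; rfl
  rw [eval_add, eval_add, eval_mul, eval_mul, derivative_map, key, key, key] at h
  simpa [hG, hG'] using h

/-- Polynomial equations over `B` from which, by Hensel's lemma, one gets a solution in `B⟦X⟧` of
the equation `g = 0` at which the fractions `y e / v` are defined. -/
structure IsApprox {E : Type*} (g : (MvPolynomial σ ℤ)[X]) (v : MvPolynomial σ ℤ)
    (y : E → (MvPolynomial σ ℤ)[X]) (T : σ → B[X]) (θ a G Q : B[X]) (r : E → B[X]) (w : B) :
    Prop where
  monic : a.Monic
  eval_eq : evAt T θ g = a ^ 2 * G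
  mul_eq : X * evAt T θ (C v) * evAt T θ (derivative g) = a * Q
  mul_eval_eq : ∀ e, X * evAt T θ (derivative g) * evAt T θ (y e) = a * r e
  inv : w * Q.coeff 0 = 1

variable {E : Type*} {g : (MvPolynomial σ ℤ)[X]} {v : MvPolynomial σ ℤ}
    {y : E → (MvPolynomial σ ℤ)[X]} {T : σ → B[X]} {θ a G Q : B[X]} {r : E → B[X]} {w : B}

theorem IsApprox.map (H : IsApprox g v y T θ a G Q r w) (h : B →+* B') :
    IsApprox g v y (fun i => (T i).map h) (θ.map h) (a.map h) (G.map h) (Q.map h)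
      (fun e => (r e).map h) (h w) := by
  have key : ∀ f, evAt (fun i => (T i).map h) (θ.map h) f = (evAt T θ f).map h := fun f => by
    have := map_evAt (mapRingHom h) T θ f
    simp only [coe_mapRingHom] at this
    exact this.symm
  refine ⟨H.monic.map h, ?_, ?_, ?_, ?_⟩
  · rw [key, H.eval_eq]; simp
  · rw [key, key, ← Polynomial.map_mul, ← H.mul_eq]; simp
  · intro e
    rw [key, key, ← Polynomial.map_mul, ← H.mul_eval_eq]; simp
  · rw [coeff_map, ← map_mul, H.inv, map_one]

theorem IsApprox.of_map {h : B →+* B'} (hh : Function.Injective h)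
    (H : IsApprox g v y (fun i => (T i).map h) (θ.map h) (a.map h) (G.map h) (Q.map h)
      (fun e => (r e).map h) (h w)) : IsApprox g v y T θ a G Q r w := by
  have key : ∀ f, evAt (fun i => (T i).map h) (θ.map h) f = (evAt T θ f).map h := fun f => by
    have := map_evAt (mapRingHom h) T θ f
    simp only [coe_mapRingHom] at this
    exact this.symm
  have hinj := map_injective h hh
  refine ⟨monic_of_injective hh H.monic, hinj ?_, hinj ?_, fun e => hinj ?_, hh ?_⟩
  · rw [← key, H.eval_eq]; simp
  · have := H.mul_eq
    rw [key, key] at this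
    simpa using this
  · have := H.mul_eval_eq e
    rw [key, key] at this
    simpa using this
  · rw [map_mul, ← coeff_map, H.inv, map_one]

theorem IsApprox.exists_root [IsDomain B] (H : IsApprox g v y T θ a G Q r w) :
    ∃ θ' : PowerSeries B, 
      let t : σ → PowerSeries B := fun i => (T i : PowerSeries B)
      evAt t θ' g = 0 ∧ evAt t θ' (C v) ≠ 0 ∧ ∀ e, evAt t θ' (C v) ∣ evAt t θ' (y e) := by
  let c : B[X] →+* PowerSeries B := coeToPowerSeries.ringHom
  let t : σ → PowerSeries B := fun i => (T i : PowerSeries B)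
  have hc : ∀ f, c (evAt T θ f) = evAt t (c θ) f := fun f => map_evAt c T θ f
  set γ := evAt t (c θ) (derivative g) with hγ
  set V := evAt t (c θ) (C v) with hV
  have hCv : ∀ z, evAt t z (C v) = V := fun z => by simp [hV, evAt]
  have e1 : evAt t (c θ) g = c a ^ 2 * c G := by rw [← hc, H.eval_eq]; simp
  have e2 : PowerSeries.X * V * γ = c a * c Q := by
    rw [hV, hγ, ← hc, ← hc, ← map_mul, ← H.mul_eq]; simp [c]
  have e3 : ∀ e, PowerSeries.X * γ * evAt t (c θ) (y e) = c a * c (r e) := fun e => by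
    rw [hγ, ← hc, ← hc, ← map_mul, ← H.mul_eval_eq]; simp [c]
  have hQ : IsUnit (c Q) := by
    rw [PowerSeries.isUnit_iff_constantCoeff]
    have : PowerSeries.constantCoeff (c Q) = Q.coeff 0 := by simp [c]
    rw [this]
    exact IsUnit.of_mul_eq_one_right _ H.inv
  obtain ⟨q, hq⟩ := hQ.exists_left_inv
  have ha : c a ≠ 0 := by
    intro h0
    exact H.monic.ne_zero (coe_injective (R := B) (by simpa [c] using h0))
  have hne : PowerSeries.X * V * γ ≠ 0 := by rw [e2]; exact mul_ne_zero ha hQ.ne_zero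
  have hγ0 : γ ≠ 0 := right_ne_zero_of_mul hne
  have hV0 : V ≠ 0 := right_ne_zero_of_mul (left_ne_zero_of_mul hne)
  set κ := q * PowerSeries.X * V with hκ
  have haκ : c a = γ * κ := by
    rw [hκ]; linear_combination (-(c a)) * hq - q * e2
  obtain ⟨k, hk⟩ := exists_evAt_taylor t (c θ) (γ * κ) g
  have hκX : κ ∈ Ideal.span {(PowerSeries.X : PowerSeries B)} := by
    rw [hκ, Ideal.mem_span_singleton]
    exact ⟨q * V, by ring⟩
  obtain ⟨s, hs⟩ := exists_fixedPoint_of_isAdicComplete (Ideal.span {(PowerSeries.X : PowerSeries B)})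
    (fun s => κ * (-(c G) - k.eval s * s ^ 2)) (by
      intro x y n hxy
      have : ∀ z, k.eval z * z ^ 2 = (k * X ^ 2).eval z := fun z => by simp
      rw [pow_succ', ← mul_sub]
      refine Ideal.mul_mem_mul hκX ?_
      rw [this, this, show -c G - eval x (k * X ^ 2) - (-c G - eval y (k * X ^ 2)) =
        -(eval x (k * X ^ 2) - eval y (k * X ^ 2)) by ring]
      exact neg_mem (Ideal.mem_of_dvd _ (sub_dvd_eval_sub x y _) hxy))
  refine ⟨c θ + γ * κ * s, ?_, ?_, fun e => ?_⟩
  · change evAt t (c θ + γ * κ * s) g = 0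
    rw [hk, ← hγ, e1, haκ]
    linear_combination (-(γ ^ 2 * κ)) * hs
  · change evAt t (c θ + γ * κ * s) (C v) ≠ 0
    rwa [hCv]
  · change evAt t (c θ + γ * κ * s) (C v) ∣ evAt t (c θ + γ * κ * s) (y e)
    rw [hCv]
    have h1 : V ∣ evAt t (c θ + γ * κ * s) (y e) - evAt t (c θ) (y e) := by
      refine dvd_evAt_sub (fun i => by simp) ?_ _
      rw [add_sub_cancel_left, hκ]
      exact ⟨γ * (q * PowerSeries.X) * s, by ring⟩
    have h2 : V ∣ evAt t (c θ) (y e) := by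
      have h3 := e3 e
      refine ⟨q * c (r e), mul_left_cancel₀ (mul_ne_zero PowerSeries.X_ne_zero hγ0) ?_⟩
      rw [h3, haκ, hκ]; ring
    exact (dvd_sub_comm.1 h1 |> fun h => by simpa using dvd_sub h2 h)

theorem Polynomial.IsDistinguishedAt.exists_coe_sub_dvd {R : Type*} [CommRing R] {I : Ideal R}
    [IsAdicComplete I R] {a : R[X]} (ha : a.IsDistinguishedAt I) (f : PowerSeries R) :
    ∃ f' : R[X], (a : PowerSeries R) ∣ f - f' := by
  obtain ⟨z, hz⟩ := (Polynomial.IsDistinguishedAt.algEquivQuotient ha).surjective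
    (Ideal.Quotient.mk _ f)
  obtain ⟨f', rfl⟩ := Ideal.Quotient.mk_surjective z
  refine ⟨f', ?_⟩
  rw [← Ideal.mem_span_singleton, ← Ideal.Quotient.eq, ← hz]
  rfl

theorem Polynomial.IsDistinguishedAt.dvd_of_coe_dvd {R : Type*} [CommRing R] {I : Ideal R}
    [IsAdicComplete I R] {a : R[X]} (ha : a.IsDistinguishedAt I) {f : R[X]}
    (h : (a : PowerSeries R) ∣ f) : a ∣ f := by
  rw [← Ideal.mem_span_singleton, ← Ideal.Quotient.eq_zero_iff_mem]
  apply (Polynomial.IsDistinguishedAt.algEquivQuotient ha).injective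
  rw [map_zero]
  exact Ideal.Quotient.eq_zero_iff_mem.2 (Ideal.mem_span_singleton.2 h)

/-- Weierstrass division modulo the square of the distinguished polynomial of `X * v * g'` gives
an approximate polynomial solution. -/
theorem exists_isApprox {R : Type*} [CommRing R] [IsDomain R] [IsLocalRing R]
    [IsAdicComplete (IsLocalRing.maximalIdeal R) R] (t : σ → PowerSeries R) (z : PowerSeries R)
    (hg : evAt t z g = 0) (y' : E → PowerSeries R)
    (hy : ∀ e, evAt t z (C v) * y' e = evAt t z (y e))
    (hW : (PowerSeries.X * evAt t z (C v) * evAt t z (derivative g)).map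
      (IsLocalRing.residue R) ≠ 0)
    (σ₀ : Set σ) (p : σ → R[X]) (hp : ∀ i ∈ σ₀, t i = p i) :
    ∃ (T : σ → R[X]) (θ a G Q : R[X]) (r : E → R[X]) (w : R),
      (∀ i ∈ σ₀, T i = p i) ∧ IsApprox g v y T θ a G Q r w := by
  obtain ⟨a, h, H⟩ := PowerSeries.exists_isWeierstrassFactorization hW
  have ha := H.isDistinguishedAt
  have ha2 : (a ^ 2).IsDistinguishedAt (IsLocalRing.maximalIdeal R) := by
    rw [pow_two]; exact ha.mul ha
  let c : R[X] →+* PowerSeries R := coeToPowerSeries.ringHom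
  have hc : ∀ f : R[X], (f : PowerSeries R) = c f := fun f => by simp [c]
  have hcinj : Function.Injective c := fun f f' hf => coe_injective R (by simpa [c] using hf)
  have hT : ∀ i, ∃ f : R[X], (i ∈ σ₀ → f = p i) ∧ c a ^ 2 ∣ t i - c f := by
    intro i
    by_cases hi : i ∈ σ₀
    · exact ⟨p i, fun _ => rfl, by rw [hp i hi, hc, sub_self]; exact dvd_zero _⟩
    · obtain ⟨f, hf⟩ := ha2.exists_coe_sub_dvd (t i)
      exact ⟨f, fun h => absurd h hi, by rw [hc, hc, map_pow] at hf; exact hf⟩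
  choose T hT0 hT using hT
  obtain ⟨θ, hθ⟩ := ha2.exists_coe_sub_dvd z
  rw [hc, hc, map_pow] at hθ
  have hcong : ∀ f, c a ^ 2 ∣ evAt t z f - c (evAt T θ f) := fun f => by
    rw [map_evAt]
    exact dvd_evAt_sub hT hθ f
  have hcong1 : ∀ f, c a ∣ evAt t z f - c (evAt T θ f) := fun f =>
    (Dvd.intro_left (c a) (pow_two (c a)).symm).trans (hcong f)
  have hWa : PowerSeries.X * evAt t z (C v) * evAt t z (derivative g) = c a * h := by
    rw [← hc]; exact H.eq_mul
  have hcX : c X = PowerSeries.X := by simp [c]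
  have ha0 : PowerSeries.constantCoeff (c a) = 0 := by
    have h1 := congrArg PowerSeries.constantCoeff hWa
    rw [mul_assoc, map_mul, PowerSeries.constantCoeff_X, zero_mul, map_mul] at h1
    exact (mul_eq_zero.1 h1.symm).resolve_right
      (PowerSeries.isUnit_iff_constantCoeff.1 H.isUnit).ne_zero
  have hane : c a ≠ 0 := by
    rw [← map_zero c]; exact hcinj.ne ha.monic.ne_zero
  obtain ⟨G, hG⟩ : a ^ 2 ∣ evAt T θ g := by
    apply ha2.dvd_of_coe_dvd
    have := hcong g
    rw [hg, zero_sub, dvd_neg] at this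
    rwa [hc, hc, map_pow]
  obtain ⟨s, hs⟩ : c a ^ 2 ∣ PowerSeries.X * evAt t z (C v) * evAt t z (derivative g) -
      c (X * evAt T θ (C v) * evAt T θ (derivative g)) := by
    have h1 := hcong (C v)
    have h2 := hcong (derivative g)
    rw [map_mul, map_mul, hcX]
    obtain ⟨s1, h1⟩ := h1
    obtain ⟨s2, h2⟩ := h2
    exact ⟨PowerSeries.X * (s1 * evAt t z (derivative g) + c (evAt T θ (C v)) * s2), by
      linear_combination (PowerSeries.X * evAt t z (derivative g)) * h1 +
        (PowerSeries.X * c (evAt T θ (C v))) * h2⟩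
  have hQ' : c (X * evAt T θ (C v) * evAt T θ (derivative g)) = c a * (h - c a * s) := by
    linear_combination hWa - hs
  obtain ⟨Q, hQ⟩ : a ∣ X * evAt T θ (C v) * evAt T θ (derivative g) := by
    apply ha.dvd_of_coe_dvd
    rw [hc, hc, hQ']
    exact Dvd.intro _ rfl
  have hQ2 : c Q = h - c a * s := by
    rw [hQ, map_mul] at hQ'
    exact mul_left_cancel₀ hane hQ'
  have hr : ∀ e, a ∣ X * evAt T θ (derivative g) * evAt T θ (y e) := by
    intro e
    apply ha.dvd_of_coe_dvd
    rw [hc, hc, map_mul, map_mul, hcX]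
    obtain ⟨s1, h1⟩ := hcong1 (derivative g)
    obtain ⟨s2, h2⟩ := hcong1 (y e)
    refine ⟨h * y' e - PowerSeries.X * (s1 * evAt t z (y e) +
      c (evAt T θ (derivative g)) * s2), ?_⟩
    linear_combination (-(PowerSeries.X * evAt t z (y e))) * h1 -
        (PowerSeries.X * c (evAt T θ (derivative g))) * h2 + (y' e) * hWa -
        (PowerSeries.X * evAt t z (derivative g)) * hy e
  choose r hr using hr
  have hu : IsUnit (Q.coeff 0) := by
    have : PowerSeries.constantCoeff (c Q) = Q.coeff 0 := by simp [c]
    rw [← this, hQ2, map_sub, map_mul, ha0, zero_mul, sub_zero]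
    exact PowerSeries.isUnit_iff_constantCoeff.1 H.isUnit
  obtain ⟨w, hw⟩ := hu.exists_left_inv
  exact ⟨T, θ, a, G, Q, r, w, hT0, ha.monic, hG, hQ, hr, hw⟩

/-- An approximate solution is defined over a finitely generated subring. -/
theorem IsApprox.exists_closure [Finite σ] [Finite E] (H : IsApprox g v y T θ a G Q r w)
    (F : Set B) (hF : F.Finite) :
    ∃ (F' : Set B) (_ : F'.Finite) (_ : F ⊆ F') (T' : σ → (Subring.closure F')[X])
      (θ' a' G' Q' : (Subring.closure F')[X]) (r' : E → (Subring.closure F')[X])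
      (w' : Subring.closure F'),
      (∀ i, (T' i).map (Subring.closure F').subtype = T i) ∧
        IsApprox g v y T' θ' a' G' Q' r' w' := by
  classical
  let co : B[X] → Set B := fun f => (f.coeffs : Set B)
  have hco : ∀ f, (co f).Finite := fun f => f.coeffs.finite_toSet
  let F' : Set B := F ∪ ((⋃ i, co (T i)) ∪ (⋃ e, co (r e)) ∪ (co θ ∪ co a ∪ co G ∪ co Q ∪ {w}))
  have hlift : ∀ f : B[X], co f ⊆ F' → ∃ f' : (Subring.closure F')[X],
      f'.map (Subring.closure F').subtype = f := by
    intro f hf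
    refine (lifts_iff_coeff_lifts _).2 fun n => ?_
    by_cases h0 : f.coeff n = 0
    · exact ⟨0, by rw [h0, map_zero]⟩
    · exact ⟨⟨f.coeff n, Subring.subset_closure (hf (coeff_mem_coeffs h0))⟩, rfl⟩
  choose T' hT' using fun i => hlift (T i) (by
    intro b hb; exact Or.inr (Or.inl (Or.inl (Set.mem_iUnion.2 ⟨i, hb⟩))))
  choose r' hr' using fun i => hlift (r i) (by
    intro b hb; exact Or.inr (Or.inl (Or.inr (Set.mem_iUnion.2 ⟨i, hb⟩))))
  obtain ⟨θ', hθ'⟩ := hlift θ (by intro b hb; simp [F', hb])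
  obtain ⟨a', ha'⟩ := hlift a (by intro b hb; simp [F', hb])
  obtain ⟨G', hG'⟩ := hlift G (by intro b hb; simp [F', hb])
  obtain ⟨Q', hQ'⟩ := hlift Q (by intro b hb; simp [F', hb])
  have hw : w ∈ F' := by simp [F']
  refine ⟨F', ?_, Set.subset_union_left, T', θ', a', G', Q', r',
    ⟨w, Subring.subset_closure hw⟩, hT', ?_⟩
  · exact hF.union (((Set.finite_iUnion fun i => hco _).union
      (Set.finite_iUnion fun i => hco _)).union
      (((((hco _).union (hco _)).union (hco _)).union (hco _)).union (Set.finite_singleton _)))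
  · apply IsApprox.of_map (h := (Subring.closure F').subtype) Subtype.val_injective
    simp only [hT', hr', hθ', ha', hG', hQ']
    exact H

end Approximation

namespace MvPowerSeries

theorem constantCoeff_coeff_zero_finSuccEquiv {R : Type*} [CommRing R] {n : ℕ}
    (f : MvPowerSeries (Fin (n + 1)) R) (d : ℕ) :
    constantCoeff (PowerSeries.coeff d (finSuccEquiv R n f)) = coeff (Finsupp.single 0 d) f := by
  rw [← coeff_zero_eq_constantCoeff_apply, coeff_coeff_finSuccEquiv]
  congr 1
  rw [Finsupp.cons_eq_single_zero_iff.2 ⟨rfl, rfl⟩]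

theorem mem_span_range_X {R : Type*} [CommRing R] {n : ℕ} (f : MvPowerSeries (Fin n) R)
    (hf : constantCoeff f = 0) : f ∈ Ideal.span (Set.range (X : Fin n → MvPowerSeries (Fin n) R)) := by
  induction n with
  | zero =>
    have : f = 0 := by
      ext d
      rw [Subsingleton.elim d 0, coeff_zero_eq_constantCoeff_apply, hf, coeff_zero]
    rw [this]; exact zero_mem _
  | succ n ih =>
    set I : Ideal (MvPowerSeries (Fin (n + 1)) R) :=
      Ideal.span (Set.range (X : Fin (n + 1) → MvPowerSeries (Fin (n + 1)) R)) with hI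
    let s : PowerSeries (MvPowerSeries (Fin n) R) ≃ₐ[R] MvPowerSeries (Fin (n + 1)) R :=
      (finSuccEquiv R n).symm
    have h0 : s PowerSeries.X = X 0 := by
      rw [AlgEquiv.symm_apply_eq, finSuccEquiv_X_zero]
    have hs : ∀ j, s (PowerSeries.C (X j)) = X j.succ := fun j => by
      rw [AlgEquiv.symm_apply_eq, finSuccEquiv_X_succ]
    let g := finSuccEquiv R n f
    have hg : f = s g := by rw [AlgEquiv.eq_symm_apply]
    have hc : constantCoeff (PowerSeries.coeff 0 g) = 0 := by
      rw [constantCoeff_coeff_zero_finSuccEquiv]; simpa using hf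
    have h1 : PowerSeries.coeff 0 g ∈
        (I.comap s.toRingEquiv.toRingHom).comap (PowerSeries.C (R := MvPowerSeries (Fin n) R)) := by
      refine (Ideal.span_le.2 ?_) (ih _ hc)
      rintro _ ⟨j, rfl⟩
      change s _ ∈ I
      rw [hs]; exact Ideal.subset_span ⟨_, rfl⟩
    rw [hg, ← sub_add_cancel g (PowerSeries.C (PowerSeries.coeff 0 g)), map_add]
    refine add_mem ?_ h1
    have : (PowerSeries.X : PowerSeries (MvPowerSeries (Fin n) R)) ∣
        g - PowerSeries.C (PowerSeries.coeff 0 g) := by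
      rw [PowerSeries.X_dvd_iff]; simp
    obtain ⟨h, hh⟩ := this
    rw [hh, map_mul, h0]
    exact Ideal.mul_mem_right _ _ (Ideal.subset_span ⟨_, rfl⟩)

theorem maximalIdeal_eq_span {k : Type*} [Field k] {n : ℕ} :
    IsLocalRing.maximalIdeal (MvPowerSeries (Fin n) k) = Ideal.span (Set.range X) := by
  apply le_antisymm
  · intro f hf
    apply mem_span_range_X
    by_contra h
    exact hf (isUnit_iff_constantCoeff.2 (isUnit_iff_ne_zero.2 h))
  · rw [Ideal.span_le]
    rintro _ ⟨j, rfl⟩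
    intro h
    have := isUnit_iff_constantCoeff.1 h
    simp at this

/-- A change of coordinates after which a nonzero power series is regular in the first
variable. -/
theorem exists_regular_coordinates {k : Type*} [Field k] [Infinite k] {n : ℕ}
    (W : MvPowerSeries (Fin (n + 1)) k) (hW : W ≠ 0) :
    ∃ (a : Fin n → k)
      (Φ : MvPowerSeries (Fin (n + 1)) k ≃+* PowerSeries (MvPowerSeries (Fin n) k)),
      Φ (X 0) = PowerSeries.X ∧
      (∀ j, Φ (X j.succ) = PowerSeries.C (X j) + PowerSeries.C (C (a j)) * PowerSeries.X) ∧
      (Φ W).map (IsLocalRing.residue (MvPowerSeries (Fin n) k)) ≠ 0 := by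
  classical
  obtain ⟨e₀, he₀⟩ : ∃ e, coeff e W ≠ 0 := by
    by_contra! h; exact hW (ext fun e => by simpa using h e)
  set d := e₀.degree with hd
  let s : Finset (Fin (n + 1) →₀ ℕ) := Finset.finsuppAntidiag Finset.univ d
  have hs : ∀ e, e ∈ s ↔ e.degree = d := fun e => by
    simp [s, Finset.mem_finsuppAntidiag, Finsupp.degree_eq_sum]
  let P : MvPolynomial (Fin (n + 1)) k := ∑ e ∈ s, MvPolynomial.monomial e (coeff e W)
  have hP : P ≠ 0 := by
    intro h
    have := congrArg (MvPolynomial.coeff e₀) h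
    simp only [P, MvPolynomial.coeff_sum, MvPolynomial.coeff_monomial] at this
    rw [Finset.sum_ite_eq' s e₀, if_pos ((hs _).2 rfl)] at this
    exact he₀ (by simpa using this)
  obtain ⟨c, hc⟩ : ∃ c, MvPolynomial.eval c (MvPolynomial.X 0 * P) ≠ 0 := by
    by_contra! h
    exact mul_ne_zero (MvPolynomial.X_ne_zero 0) hP (MvPolynomial.funext (by simpa using h))
  rw [map_mul, MvPolynomial.eval_X] at hc
  have hc0 := left_ne_zero_of_mul hc
  have hcP := right_ne_zero_of_mul hc
  let b : Fin (n + 1) → k := fun i => c i / c 0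
  have hb0 : b 0 = 1 := div_self hc0
  have hbP : ∑ e ∈ s, coeff e W * ∏ i, b i ^ e i ≠ 0 := by
    intro h
    apply hcP
    have : c 0 ^ d * ∑ e ∈ s, coeff e W * ∏ i, b i ^ e i = 0 := by rw [h, mul_zero]
    rw [← this, Finset.mul_sum, map_sum]
    refine Finset.sum_congr rfl fun e he => ?_
    rw [MvPolynomial.eval_monomial, Finsupp.prod_fintype _ _ (by simp), mul_left_comm]
    congr 1
    rw [← (hs e).1 he, Finsupp.degree_eq_sum, ← Finset.prod_pow_eq_pow_sum,
      ← Finset.prod_mul_distrib]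
    refine Finset.prod_congr rfl fun i _ => ?_
    rw [← mul_pow, mul_div_cancel₀ _ hc0]
  let α : (Fin n → k) → Fin (n + 1) → MvPowerSeries (Fin (n + 1)) k := fun a =>
    Fin.cases (X 0) (fun j => X j.succ + C (a j) * X 0)
  have hα0 : ∀ a, α a 0 = X 0 := fun a => rfl
  have hαs : ∀ a j, α a (Fin.succ j) = X j.succ + C (a j) * X 0 := fun a j => rfl
  have hα : ∀ a, HasSubst (α a) := fun a =>
    hasSubst_of_constantCoeff_zero (fun i => by
      refine Fin.cases ?_ (fun j => ?_) i
      · simp [hα0]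
      · simp [hαs])
  have hinv : ∀ a f, subst (α (-a)) (subst (α a) f) = f := by
    intro a f
    rw [subst_comp_subst_apply (hα a) (hα (-a))]
    have : (fun i => subst (α (-a)) (α a i)) = (X : Fin (n + 1) → MvPowerSeries (Fin (n + 1)) k) := by
      funext i
      refine Fin.cases ?_ (fun j => ?_) i
      · rw [hα0, subst_X (hα _), hα0]
      · rw [hαs, subst_add (hα _), subst_mul (hα _), subst_X (hα _), subst_X (hα _), hα0, hαs]
        rw [subst_C]
        simp
    rw [this, subst_self]; rfl
  let a : Fin n → k := fun j => b j.succ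
  let φ : MvPowerSeries (Fin (n + 1)) k ≃+* MvPowerSeries (Fin (n + 1)) k :=
    RingEquiv.ofRingHom (substAlgHom (R := k) (hα a)).toRingHom (substAlgHom (R := k) (hα (-a))).toRingHom
      (by
        ext1 f
        change substAlgHom (hα a) (substAlgHom (hα (-a)) f) = f
        rw [substAlgHom_apply, substAlgHom_apply]
        simpa using hinv (-a) f)
      (by
        ext1 f
        change substAlgHom (hα (-a)) (substAlgHom (hα a) f) = f
        rw [substAlgHom_apply, substAlgHom_apply, hinv])
  have hφ : ∀ f, φ f = subst (α a) f := fun f => substAlgHom_apply (hα a) f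
  refine ⟨a, φ.trans (finSuccEquiv k n).toRingEquiv, ?_, ?_, ?_⟩
  · change finSuccEquiv k n (φ (X 0)) = _
    rw [hφ, subst_X (hα _), hα0, finSuccEquiv_X_zero]
  · intro j
    change finSuccEquiv k n (φ _) = _
    rw [hφ, subst_X (hα _), hαs, map_add, map_mul, finSuccEquiv_X_zero, finSuccEquiv_X_succ,
      finSuccEquiv_C]
  · intro h
    have h2 : constantCoeff (PowerSeries.coeff d (finSuccEquiv k n (φ W))) = 0 := by
      have := congrArg (PowerSeries.coeff d) h
      rw [PowerSeries.coeff_map, map_zero, IsLocalRing.residue_eq_zero_iff] at this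
      by_contra h3
      exact this (isUnit_iff_constantCoeff.2 (isUnit_iff_ne_zero.2 h3))
    rw [constantCoeff_coeff_zero_finSuccEquiv, hφ, coeff_subst (hα a)] at h2
    let q : MvPowerSeries (Fin (n + 1)) k →+* PowerSeries k :=
      (PowerSeries.map constantCoeff).comp (finSuccEquiv k n).toRingEquiv.toRingHom
    have hq : ∀ f m, coeff (Finsupp.single 0 m) f = PowerSeries.coeff m (q f) := fun f m => by
      rw [← constantCoeff_coeff_zero_finSuccEquiv]
      exact (PowerSeries.coeff_map _ _ _).symm
    have hq' : ∀ f, q f = PowerSeries.map (constantCoeff (σ := Fin n) (R := k))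
        (finSuccEquiv k n f) := fun f => rfl
    have hqα : ∀ i, q (α a i) = PowerSeries.C (b i) * PowerSeries.X := by
      intro i
      have hq0 : q (X 0) = PowerSeries.X := by
        rw [hq', finSuccEquiv_X_zero, PowerSeries.map_X]
      refine Fin.cases ?_ (fun j => ?_) i
      · rw [hα0, hb0, hq0]; simp
      · rw [hαs, map_add, map_mul, hq0]
        rw [hq', hq', finSuccEquiv_X_succ, finSuccEquiv_C, PowerSeries.map_C, PowerSeries.map_C]
        simp [a]
    have hmon : ∀ e : Fin (n + 1) →₀ ℕ, coeff (Finsupp.single 0 d)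
        (e.prod fun i m => α a i ^ m) = if e.degree = d then ∏ i, b i ^ e i else 0 := by
      intro e
      rw [hq, Finsupp.prod_fintype _ _ (by simp), map_prod]
      simp only [map_pow, hqα, mul_pow]
      rw [Finset.prod_mul_distrib, Finset.prod_pow_eq_pow_sum, ← Finsupp.degree_eq_sum]
      simp only [← map_pow]
      rw [← map_prod, PowerSeries.coeff_C_mul, PowerSeries.coeff_X_pow]
      simp [eq_comm]
    apply hbP
    rw [← h2, finsum_eq_sum_of_support_subset (s := s)]
    · refine Finset.sum_congr rfl fun e he => ?_
      rw [hmon, if_pos ((hs e).1 he), smul_eq_mul]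
    · intro e he
      by_contra h3
      apply he
      simp only
      rw [hmon, if_neg (fun h4 => h3 ((hs e).2 h4)), smul_zero]

end MvPowerSeries

theorem isJacobsonRing_int : IsJacobsonRing ℤ := by
  rw [isJacobsonRing_iff_prime_eq]
  intro P hP
  by_cases h : P = ⊥
  · subst h
    rw [eq_bot_iff]
    intro x hx
    have := Ideal.mem_jacobson_bot.1 hx x
    rw [Int.isUnit_iff] at this
    rw [Ideal.mem_bot]
    rcases this with h | h <;> nlinarith
  · have := hP.isMaximal h
    exact Ideal.jacobson_eq_self_of_isMaximal

/-- A finitely generated ring has a quotient field of positive characteristic. -/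
theorem exists_ringHom_field_charP {S : Type u} [CommRing S] [Nontrivial S] (E : Set S)
    (hE : E.Finite) : ∃ (p : ℕ) (_ : Fact p.Prime) (K : Type u) (_ : Field K) (_ : CharP K p),
      Nonempty (Subring.closure E →+* K) := by
  have : Algebra.FiniteType ℤ (Subring.closure E) := by
    have h := Subalgebra.fg_adjoin_finset (R := ℤ) hE.toFinset
    rw [Set.Finite.coe_toFinset] at h
    have h2 := (Subalgebra.fg_iff_finiteType _).1 h
    have e : (Algebra.adjoin ℤ E).toSubring = Subring.closure E := by
      apply le_antisymm
      · intro x hx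
        refine Algebra.adjoin_induction (p := fun x _ => x ∈ Subring.closure E) ?_ ?_ ?_ ?_ hx
        · exact fun x hx => Subring.subset_closure hx
        · intro r; simp
        · exact fun x y _ _ => add_mem
        · exact fun x y _ _ => mul_mem
      · exact Subring.closure_le.2 Algebra.subset_adjoin
    let f : Algebra.adjoin ℤ E ≃+* Subring.closure E :=
      RingEquiv.subringCongr e
    exact h2.equiv (f.toIntAlgEquiv)
  obtain ⟨m, hm⟩ := Ideal.exists_maximal (Subring.closure E)
  let _ := Ideal.Quotient.field m
  have hft : Algebra.FiniteType ℤ (Subring.closure E ⧸ m) :=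
    Algebra.FiniteType.trans (S := Subring.closure E) this inferInstance
  have hintegral : (algebraMap ℤ (Subring.closure E ⧸ m)).IsIntegral := by
    obtain ⟨n, g, hg⟩ := Algebra.FiniteType.iff_quotient_mvPolynomial''.1 hft
    have := isJacobsonRing_int
    have := MvPolynomial.comp_C_integral_of_surjective_of_isJacobsonRing g.toRingHom hg
    rwa [RingHom.ext_int (algebraMap ℤ (Subring.closure E ⧸ m)) (g.toRingHom.comp MvPolynomial.C)]
  obtain ⟨p, hp⟩ := CharP.exists (Subring.closure E ⧸ m)
  rcases CharP.char_is_prime_or_zero (Subring.closure E ⧸ m) p with h | h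
  · exact ⟨p, ⟨h⟩, _, inferInstance, hp, ⟨Ideal.Quotient.mk m⟩⟩
  · subst h
    have : CharZero (Subring.closure E ⧸ m) := CharP.charP_to_charZero _
    have hintegral' : Algebra.IsIntegral ℤ (Subring.closure E ⧸ m) := ⟨hintegral⟩
    exact absurd (isField_of_isIntegral_of_isField (R := ℤ) (S := Subring.closure E ⧸ m)
      (RingHom.injective_int _) (Field.toIsField _)) Int.not_isField

theorem ringKrullDim_powerSeries {R : Type*} [CommRing R] [IsDomain R] [IsNoetherianRing R]
    [IsLocalRing R] : ringKrullDim (PowerSeries R) = ringKrullDim R + 1 := by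
  rw [← ringKrullDim_quotient_span_singleton_succ_eq_ringKrullDim_of_mem_jacobson
    (R := PowerSeries R) (x := PowerSeries.X) (fun a b h => ?_) ?_]
  · congr 1
    have h1 : RingHom.ker (PowerSeries.constantCoeff (R := R)) = Ideal.span {PowerSeries.X} := by
      ext f
      rw [RingHom.mem_ker, Ideal.mem_span_singleton, PowerSeries.X_dvd_iff]
    rw [← h1]
    exact ringKrullDim_eq_of_ringEquiv
      (RingHom.quotientKerEquivOfSurjective PowerSeries.constantCoeff_surj)
  · rw [IsLocalRing.ringJacobson_eq_maximalIdeal, IsLocalRing.mem_maximalIdeal, mem_nonunits_iff,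
      PowerSeries.isUnit_iff_constantCoeff]
    simp
  · exact mul_left_cancel₀ PowerSeries.X_ne_zero h

theorem algebraicIndepOn_int_range_of_injective {k S : Type*} [Field k] [CharZero k] [CommRing S]
    {n : ℕ} (φ : MvPolynomial (Fin n) k →+* S) (hφ : Function.Injective φ) :
    AlgebraicIndepOn ℤ id (Set.range fun i => φ (MvPolynomial.X i)) := by
  apply AlgebraicIndependent.to_subtype_range
  have h : ∀ f : MvPolynomial (Fin n) ℤ, MvPolynomial.aeval (fun i => φ (MvPolynomial.X i)) f
      = φ (MvPolynomial.map (Int.castRingHom k) f) := by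
    intro f
    induction f using MvPolynomial.induction_on with
    | C a => simp
    | add p q hp hq => simp [hp, hq]
    | mul_X p i hp => simp [hp]
  intro f g hfg
  rw [h, h] at hfg
  exact MvPolynomial.map_injective _ Int.cast_injective (hφ hfg)

open Polynomial in
theorem exists_hypersurface_presentation_evAt {S : Type u} [CommRing S] [IsDomain S] [CharZero S]
    (E : Set S) (hE : E.Finite) (E₀ : Set S) (hE₀ : E₀ ⊆ E) (hind : AlgebraicIndepOn ℤ id E₀) :
    ∃ (T : Set S) (_ : E₀ ⊆ T) (_ : T ⊆ E) (θ : S) (g : (MvPolynomial T ℤ)[X])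
      (v : MvPolynomial T ℤ) (y : E → (MvPolynomial T ℤ)[X]),
      evAt ((↑) : T → S) θ (C v) ≠ 0 ∧ evAt ((↑) : T → S) θ g = 0 ∧
      evAt ((↑) : T → S) θ (derivative g) ≠ 0 ∧
      (∀ f, evAt ((↑) : T → S) θ f = 0 → ∃ M, g ∣ C v ^ M * f) ∧
      ∀ e : E, evAt ((↑) : T → S) θ (C v) * e = evAt ((↑) : T → S) θ (y e) :=
  exists_hypersurface_presentation E hE E₀ hE₀ hind

open Polynomial in
/-- Finitely many power series over a field of characteristic zero can be specialised to a regular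
local ring of positive characteristic and of the same dimension. -/
theorem MvPowerSeries.exists_ringHom_charP {k : Type u} [Field k] [CharZero k] (d : ℕ)
    (E : Set (MvPowerSeries (Fin d) k)) (hE : E.Finite) (hX : Set.range X ⊆ E) :
    ∃ (p : ℕ) (_ : Fact p.Prime) (R : Type u) (_ : CommRing R) (_ : IsDomain R)
      (_ : IsNoetherianRing R) (_ : IsLocalRing R) (_ : CharP R p)
      (χ : Subring.closure E →+* R), ringKrullDim R = d ∧
        IsLocalRing.maximalIdeal R =
          Ideal.span (Set.range fun i => χ ⟨X i, Subring.subset_closure (hX ⟨i, rfl⟩)⟩) := by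
  induction d with
  | zero =>
    obtain ⟨p, hp, K, _, _, ⟨χ⟩⟩ := exists_ringHom_field_charP E hE
    refine ⟨p, hp, K, inferInstance, inferInstance, inferInstance, inferInstance, inferInstance,
      χ, ?_, ?_⟩
    · simp
    · rw [Set.range_eq_empty, Ideal.span_empty, IsLocalRing.maximalIdeal_eq_bot]
  | succ n ih =>
    have : IsDomain (MvPowerSeries (Fin (n + 1)) k) := NoZeroDivisors.to_isDomain _
    have : IsDomain (MvPowerSeries (Fin n) k) := NoZeroDivisors.to_isDomain _
    have : CharZero (MvPowerSeries (Fin (n + 1)) k) :=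
      charZero_of_injective_algebraMap (R := k) (algebraMap k _).injective
    have hind := algebraicIndepOn_int_range_of_injective
      (MvPolynomial.coeToMvPowerSeries.ringHom (σ := Fin (n + 1)) (R := k))
      (MvPolynomial.coe_injective _ _)
    simp only [MvPolynomial.coeToMvPowerSeries.ringHom_apply, MvPolynomial.coe_X] at hind
    obtain ⟨T, hT, hTE, θ, g, v, y, hv, hg, hg', hker, hy⟩ :=
      exists_hypersurface_presentation_evAt E hE (Set.range X) hX hind
    have : Finite E := hE
    have : Finite T := hE.subset hTE
    have hX0 : (X 0 : MvPowerSeries (Fin (n + 1)) k) ≠ 0 := fun h => by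
      simpa using congrArg (coeff (Finsupp.single 0 1)) h
    obtain ⟨a, Φ, hΦ0, hΦs, hΦW⟩ := exists_regular_coordinates
      (X 0 * evAt (↑) θ (Polynomial.C v) * evAt (↑) θ (derivative g))
      (mul_ne_zero (mul_ne_zero hX0 hv) hg')
    have hΦev : ∀ f, Φ (evAt (↑) θ f) = evAt (fun i : T => Φ i) (Φ θ) f := fun f =>
      map_evAt Φ.toRingHom _ _ _
    rw [map_mul Φ, map_mul Φ, hΦ0, hΦev, hΦev] at hΦW
    have : IsAdicComplete (IsLocalRing.maximalIdeal (MvPowerSeries (Fin n) k))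
        (MvPowerSeries (Fin n) k) := by
      rw [maximalIdeal_eq_span]; infer_instance
    let x : Fin (n + 1) → T := fun i => ⟨X i, hT ⟨i, rfl⟩⟩
    have hx : Function.Injective x := fun i j h => X_inj.1 (congrArg Subtype.val h)
    let p₀ : Fin (n + 1) → (MvPowerSeries (Fin n) k)[X] :=
      Fin.cases Polynomial.X fun j => Polynomial.C (X j) + Polynomial.C (C (a j)) * Polynomial.X
    obtain ⟨T₁, θ₁, a₁, G₁, Q₁, r₁, w₁, hT₁, H₁⟩ := exists_isApprox (g := g) (v := v) (y := y)
      (fun i : T => Φ i) (Φ θ) (by rw [← hΦev, hg, map_zero]) (fun e => Φ e)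
      (fun e => by rw [← hΦev, ← hΦev, ← map_mul, hy]) hΦW (Set.range x)
      (Function.extend x p₀ 0) (by
        rintro _ ⟨i, rfl⟩
        rw [hx.extend_apply]
        refine Fin.cases ?_ (fun j => ?_) i
        · simp [x, p₀, hΦ0]
        · simp [x, p₀, hΦs])
    obtain ⟨F, hF, hXF, T₂, θ₂, a₂, G₂, Q₂, r₂, w₂, hT₂, H₂⟩ := H₁.exists_closure
      (Set.range X ∪ Set.range fun j => C (a j)) ((Set.finite_range _).union (Set.finite_range _))
    obtain ⟨p, hp, R, _, _, _, _, _, χ, hdim, hmax⟩ := ih F hF (fun z hz => hXF (Or.inl hz))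
    obtain ⟨θ', h1, h2, h3⟩ := (H₂.map χ).exists_root
    set t : T → PowerSeries R := fun i => ((T₂ i).map χ : R[X]) with ht
    obtain ⟨χ', hχ'⟩ := exists_ringHom_closure (evAt ((↑) : T → _) θ) (evAt t θ')
      (fun f hf => by
        obtain ⟨M, q, hq⟩ := hker f hf
        have := congrArg (evAt t θ') hq
        rw [map_mul, map_mul, h1, zero_mul, map_pow] at this
        exact (mul_eq_zero.1 this).resolve_left (pow_ne_zero _ h2))
      (Polynomial.C v) h2 E (fun e he => ⟨y ⟨e, he⟩, hy ⟨e, he⟩, h3 ⟨e, he⟩⟩)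
    have hχx : ∀ i, χ' ⟨X i, Subring.subset_closure (hX ⟨i, rfl⟩)⟩ = t (x i) := fun i => by
      rw [hχ' _ (Polynomial.C (MvPolynomial.X (x i))) (by rw [evAt_C_X]), evAt_C_X]
    have hT₁x : ∀ i, T₁ (x i) = p₀ i := fun i => by rw [hT₁ _ ⟨i, rfl⟩, hx.extend_apply]
    have hinj := Polynomial.map_injective (Subring.closure F).subtype Subtype.val_injective
    have ht0 : t (x 0) = PowerSeries.X := by
      have : T₂ (x 0) = Polynomial.X := hinj (by rw [hT₂, hT₁x]; simp [p₀])
      simp [ht, this]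
    let ξ : Fin n → R := fun j => χ ⟨X j, Subring.subset_closure (hXF (Or.inl ⟨j, rfl⟩))⟩
    let α : Fin n → R := fun j => χ ⟨C (a j), Subring.subset_closure (hXF (Or.inr ⟨j, rfl⟩))⟩
    have hts : ∀ j, t (x (Fin.succ j)) =
        PowerSeries.C (ξ j) + PowerSeries.C (α j) * PowerSeries.X := fun j => by
      have : T₂ (x (Fin.succ j)) =
          Polynomial.C ⟨X j, Subring.subset_closure (hXF (Or.inl ⟨j, rfl⟩))⟩ +
          Polynomial.C ⟨C (a j), Subring.subset_closure (hXF (Or.inr ⟨j, rfl⟩))⟩ *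
            Polynomial.X := hinj (by rw [hT₂, hT₁x]; simp [p₀])
      simp [ht, this, ξ, α]
    refine ⟨p, hp, PowerSeries R, inferInstance, inferInstance, inferInstance, inferInstance,
      charP_of_injective_ringHom (f := PowerSeries.C (R := R)) PowerSeries.C_injective p,
      χ', ?_, ?_⟩
    · rw [ringKrullDim_powerSeries, hdim]; push_cast; rfl
    · simp only [hχx]
      set I := Ideal.span (Set.range fun i => t (x i)) with hI
      have hI0 : PowerSeries.X ∈ I := Ideal.subset_span ⟨0, ht0⟩
      have hIs : ∀ j, PowerSeries.C (ξ j) ∈ I := fun j => by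
        have : t (x (Fin.succ j)) ∈ I := Ideal.subset_span ⟨_, rfl⟩
        rw [hts] at this
        exact (Ideal.add_mem_iff_left _ (Ideal.mul_mem_left _ _ hI0)).1 this
      apply le_antisymm
      · intro f hf
        have hf0 : PowerSeries.constantCoeff f ∈ IsLocalRing.maximalIdeal R := by
          intro h; exact hf (PowerSeries.isUnit_iff_constantCoeff.2 h)
        rw [hmax] at hf0
        have : Ideal.span (Set.range ξ) ≤ I.comap PowerSeries.C := by
          rw [Ideal.span_le]; rintro _ ⟨j, rfl⟩; exact hIs j
        have h4 : PowerSeries.C (PowerSeries.constantCoeff f) ∈ I := this hf0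
        obtain ⟨q, hq⟩ : PowerSeries.X ∣ f - PowerSeries.C (PowerSeries.constantCoeff f) := by
          rw [PowerSeries.X_dvd_iff]; simp
        rw [← sub_add_cancel f (PowerSeries.C (PowerSeries.constantCoeff f)), hq]
        exact add_mem (Ideal.mul_mem_right _ _ hI0) h4
      · rw [hI, Ideal.span_le]
        rintro _ ⟨i, rfl⟩
        intro hu
        rw [PowerSeries.isUnit_iff_constantCoeff] at hu
        revert hu
        refine Fin.cases ?_ (fun j => ?_) i
        · simp [ht0]
        · simp only [hts]
          intro hu
          have : ξ j ∈ IsLocalRing.maximalIdeal R := by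
            rw [hmax]; exact Ideal.subset_span ⟨j, rfl⟩
          exact this (by simpa using hu)

section Integral

variable {R S : Type*} [CommRing R] [CommRing S] [Algebra R S] [Algebra.IsIntegral R S]

theorem ringKrullDim_le_of_isIntegral : ringKrullDim S ≤ ringKrullDim R :=
  Order.krullDim_le_of_strictMono (PrimeSpectrum.comap (algebraMap R S)) fun P Q h =>
    Ideal.IsIntegral.comap_lt_comap (R := R) (A := S) (I := P.asIdeal) (J := Q.asIdeal) h

theorem ringKrullDim_le_of_isIntegral_of_injective (h : Function.Injective (algebraMap R S)) :
    ringKrullDim R ≤ ringKrullDim S := by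
  have : FaithfulSMul R S := (faithfulSMul_iff_algebraMap_injective R S).2 h
  refine iSup_le fun l => ?_
  obtain ⟨Q, hQ, hQ'⟩ := Ideal.nonempty_primesOver (S := S) l.head.asIdeal
  obtain ⟨L, hL, -⟩ := Ideal.exists_ltSeries_of_hasGoingUp l Q
  rw [← hL]
  exact le_iSup (fun L : LTSeries (PrimeSpectrum S) => (L.length : WithBot ℕ∞)) L

theorem exists_ringHom_extension_of_isIntegral (h : Function.Injective (algebraMap R S))
    {Ω : Type*} [Field Ω] [IsAlgClosed Ω] (χ : R →+* Ω) :
    ∃ χ' : S →+* Ω, χ'.comp (algebraMap R S) = χ := by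
  have : FaithfulSMul R S := (faithfulSMul_iff_algebraMap_injective R S).2 h
  have hP : (RingHom.ker χ).IsPrime := RingHom.ker_isPrime χ
  obtain ⟨Q, hQ, hQ'⟩ := Ideal.nonempty_primesOver (S := S) (RingHom.ker χ)
  let _ : Algebra (R ⧸ RingHom.ker χ) Ω := (RingHom.kerLift χ).toAlgebra
  have : FaithfulSMul (R ⧸ RingHom.ker χ) Ω :=
    (faithfulSMul_iff_algebraMap_injective _ _).2 (RingHom.kerLift_injective χ)
  have : FaithfulSMul (R ⧸ RingHom.ker χ) (S ⧸ Q) := inferInstance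
  have : Algebra.IsIntegral (R ⧸ RingHom.ker χ) (S ⧸ Q) := inferInstance
  have : IsDomain (R ⧸ RingHom.ker χ) := Ideal.Quotient.isDomain _
  have : IsDomain (S ⧸ Q) := Ideal.Quotient.isDomain _
  have : Module.IsTorsionFree (R ⧸ RingHom.ker χ) (S ⧸ Q) :=
    Module.isTorsionFree_iff_faithfulSMul.2 inferInstance
  have : Module.IsTorsionFree (R ⧸ RingHom.ker χ) Ω :=
    Module.isTorsionFree_iff_faithfulSMul.2 inferInstance
  have : Algebra.IsAlgebraic (R ⧸ RingHom.ker χ) (S ⧸ Q) := Algebra.IsIntegral.isAlgebraic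
  let f : S ⧸ Q →ₐ[R ⧸ RingHom.ker χ] Ω := IsAlgClosed.lift
  refine ⟨f.toRingHom.comp (Ideal.Quotient.mk Q), RingHom.ext fun x => ?_⟩
  exact f.commutes (Ideal.Quotient.mk _ x)

end Integral

section FiniteExtension

variable {R S : Type u} [CommRing R] [CommRing S] [Algebra R S]
  {ι : Type w} [Fintype ι] [DecidableEq ι] {deg : ι → ℕ} {D : Matrix ι ι S}

theorem charP_of_natCast_eq_zero {T : Type*} [CommRing T] [Nontrivial T] (p : ℕ) [hp : Fact p.Prime]
    (h : (p : T) = 0) : CharP T p :=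
  (CharP.charP_iff_prime_eq_zero hp.out).2 h

/-- The intersection theorem in characteristic `p` for a finite extension of a local ring whose
maximal ideal is generated by null-homotopic elements. -/
theorem ringKrullDim_le_of_finite_extension [IsNoetherianRing R] [IsLocalRing R]
    (p : ℕ) [Fact p.Prime] [CharP R p] [Module.Finite R S]
    (hinj : Function.Injective (algebraMap R S)) {κ : Type*} (x : κ → R)
    (hx : IsLocalRing.maximalIdeal R = Ideal.span (Set.range x))
    (hD : IsLowering deg D) (hDD : D * D = 0) {r : ℕ} (hr : ∀ b, deg b ≤ r)
    (hJ : ∀ i, NullHtpy deg D (algebraMap R S (x i))) {a : ι} (ha : deg a = 0)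
    (haD : ∀ b, ∃ s : ℕ, D a b ^ s ∈ Ideal.span (Set.range fun i => algebraMap R S (x i))) :
    ringKrullDim R ≤ r := by
  have : IsNoetherianRing S := IsNoetherianRing.of_finite R S
  have : Nontrivial S := hinj.nontrivial
  have hspan : (Ideal.span (Set.range fun i => algebraMap R S (x i))) =
      (IsLocalRing.maximalIdeal R).map (algebraMap R S) := by
    rw [hx, Ideal.map_span, ← Set.range_comp]; rfl
  refine (ringKrullDim_le_of_isIntegral_of_injective hinj).trans ?_
  rw [← Ideal.sup_isMaximal_height_eq_ringKrullDim]
  have hmax : ∀ n : Ideal S, n.IsMaximal → n.height ≤ (r : ℕ∞) := by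
    intro n hn
    have hcomap : n.comap (algebraMap R S) = IsLocalRing.maximalIdeal R :=
      IsLocalRing.eq_maximalIdeal (Ideal.isMaximal_comap_of_isIntegral_of_isMaximal n)
    let L := Localization.AtPrime n
    have : IsNoetherianRing L := IsLocalization.isNoetherianRing n.primeCompl L inferInstance
    have : CharP L p := by
      apply charP_of_natCast_eq_zero p
      have h0 : (p : R) = 0 := CharP.cast_eq_zero R p
      rw [← map_natCast (algebraMap S L), ← map_natCast (algebraMap R S), h0, map_zero, map_zero]
    have key : ringKrullDim L ≤ r := by
      refine ringKrullDim_le_of_charP (A := L) p (hD.map (algebraMap S L))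
        (map_mul_self_eq_zero hDD _) hr (fun P hP hPm => ?_) ha (fun b => ?_)
      · by_contra! hcon
        apply hPm
        have hle : IsLocalRing.maximalIdeal R ≤ (P.comap (algebraMap S L)).comap (algebraMap R S) := by
          rw [hx, Ideal.span_le]
          rintro _ ⟨i, rfl⟩
          by_contra h
          exact hcon _ h ((hJ i).map _)
        have hpr : (P.comap (algebraMap S L)).IsPrime := Ideal.comap_isPrime _ _
        have hpr' : ((P.comap (algebraMap S L)).comap (algebraMap R S)).IsPrime :=
          Ideal.comap_isPrime _ _
        have heq := (IsLocalRing.maximalIdeal.isMaximal R).eq_of_le hpr'.ne_top hle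
        have hm : (P.comap (algebraMap S L)).IsMaximal :=
          Ideal.isMaximal_of_isIntegral_of_isMaximal_comap _
            (heq ▸ IsLocalRing.maximalIdeal.isMaximal R)
        have hPle : P.comap (algebraMap S L) ≤ n := by
          have := Ideal.comap_mono (f := algebraMap S L) (IsLocalRing.le_maximalIdeal hP.ne_top)
          exact this.trans_eq (Localization.AtPrime.under_maximalIdeal (I := n))
        have hPn := hm.eq_of_le hn.ne_top hPle
        refine le_antisymm (IsLocalRing.le_maximalIdeal hP.ne_top) ?_
        rw [← Localization.AtPrime.map_eq_maximalIdeal]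
        exact Ideal.map_le_iff_le_comap.2 hPn.ge
      · obtain ⟨s, hs⟩ := haD b
        have hmem : D a b ∈ n := by
          refine hn.isPrime.mem_of_pow_mem s (?_ : _ ∈ n)
          rw [hspan] at hs
          exact (Ideal.map_le_iff_le_comap.2 hcomap.ge) hs
        have : algebraMap S L (D a b) ∈ n.map (algebraMap S L) := Ideal.mem_map_of_mem _ hmem
        rwa [Localization.AtPrime.map_eq_maximalIdeal] at this
    rw [IsLocalization.AtPrime.ringKrullDim_eq_height n L] at key
    exact_mod_cast key
  have : (⨆ (n : Ideal S) (_ : n.IsMaximal), n.height) ≤ (r : ℕ∞) := iSup₂_le hmax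
  exact_mod_cast this

end FiniteExtension

section Descent

theorem isIntegral_subring_of_coeffs_subset {S B : Type*} [CommRing S] [CommRing B] [Algebra S B]
    (C : Subring S) (z : B) (P : Polynomial S) (hP : P.Monic) (hz : Polynomial.eval₂ (algebraMap S B) z P = 0)
    (hc : (P.coeffs : Set S) ⊆ C) : IsIntegral C z := by
  refine ⟨P.toSubring C hc, (Polynomial.monic_toSubring _ _ _).2 hP, ?_⟩
  have h : (P.toSubring C hc).map C.subtype = P := Polynomial.map_toSubring _ _ _
  have h2 : Polynomial.eval₂ (algebraMap S B) z ((P.toSubring C hc).map C.subtype) = 0 := by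
    rw [h, hz]
  rwa [Polynomial.eval₂_map] at h2

variable {ι : Type w} [Fintype ι] [DecidableEq ι] {deg : ι → ℕ}

/-- The intersection theorem over an integral extension of a power series ring over a field of
characteristic zero. -/
theorem le_of_isIntegral_mvPowerSeries {k : Type u} [Field k] [CharZero k] {d : ℕ}
    {B : Type u} [CommRing B] [Algebra (MvPowerSeries (Fin d) k) B]
    (hinj : Function.Injective (algebraMap (MvPowerSeries (Fin d) k) B))
    [Algebra.IsIntegral (MvPowerSeries (Fin d) k) B] {D : Matrix ι ι B}
    (hD : IsLowering deg D) (hDD : D * D = 0) {r : ℕ} (hr : ∀ b, deg b ≤ r)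
    (hJ : ∀ i, NullHtpy deg D (algebraMap (MvPowerSeries (Fin d) k) B (MvPowerSeries.X i)))
    {a : ι} (ha : deg a = 0)
    (haD : ∀ b, ∃ s : ℕ, D a b ^ s ∈ Ideal.span (Set.range fun i =>
      algebraMap (MvPowerSeries (Fin d) k) B (MvPowerSeries.X i))) : d ≤ r := by
  classical
  let S := MvPowerSeries (Fin d) k
  choose H hH hHz using hJ
  choose s hs using haD
  have hs' : ∀ b, ∃ c : Fin d → B, ∑ i, c i * algebraMap S B (MvPowerSeries.X i) = D a b ^ s b :=
    fun b => Ideal.mem_span_range_iff_exists_fun.1 (hs b)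
  choose c hc using hs'
  let Z : Set B := (Set.range fun t : ι × ι => D t.1 t.2) ∪
    (Set.range fun t : Fin d × ι × ι => H t.1 t.2.1 t.2.2) ∪ (Set.range fun t : ι × Fin d => c t.1 t.2)
  have hZ : Z.Finite := ((Set.finite_range _).union (Set.finite_range _)).union (Set.finite_range _)
  have hintegral : ∀ z : B, IsIntegral S z := Algebra.IsIntegral.isIntegral
  choose P hPm hPz using hintegral
  let E : Set S := (⋃ z ∈ Z, ((P z).coeffs : Set S)) ∪ Set.range MvPowerSeries.X
  have hE : E.Finite := (hZ.biUnion fun z _ => Finset.finite_toSet _).union (Set.finite_range _)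
  have hX : Set.range MvPowerSeries.X ⊆ E := Set.subset_union_right
  obtain ⟨p, hp, R, _, _, _, _, _, χ, hdim, hmax⟩ := MvPowerSeries.exists_ringHom_charP d E hE hX
  let C := Subring.closure E
  have hZint : ∀ z ∈ Z, IsIntegral C z := fun z hz =>
    isIntegral_subring_of_coeffs_subset C z (P z) (hPm z) (hPz z) fun t ht =>
      Subring.subset_closure (Or.inl (Set.mem_biUnion hz ht))
  let Λ := Algebra.adjoin C Z
  have hΛ : Algebra.IsIntegral C Λ := Algebra.IsIntegral.adjoin fun {x} hx => hZint x hx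
  have hCΛ : Function.Injective (algebraMap C Λ) := by
    have : Function.Injective (algebraMap C B) := hinj.comp Subtype.val_injective
    exact Function.Injective.of_comp (f := algebraMap Λ B) this
  let Ω := AlgebraicClosure (FractionRing R)
  obtain ⟨χ', hχ'⟩ := exists_ringHom_extension_of_isIntegral hCΛ ((algebraMap R Ω).comp χ)
  let Z' : Set Ω := Set.image χ' (Subtype.val ⁻¹' Z)
  have hZ'fin : Z'.Finite := (hZ.preimage Subtype.val_injective.injOn).image _
  have hχ'C : ∀ x : C, χ' (algebraMap C Λ x) = algebraMap R Ω (χ x) := fun x =>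
    DFunLike.congr_fun hχ' x
  have hZ'int : ∀ z ∈ Z', IsIntegral R z := by
    rintro _ ⟨z, hz, rfl⟩
    obtain ⟨Q, hQm, hQz⟩ := hΛ.isIntegral z
    refine ⟨Q.map χ, hQm.map χ, ?_⟩
    rw [Polynomial.eval₂_map, ← hχ', ← Polynomial.hom_eval₂, hQz, map_zero]
  let T := Algebra.adjoin R Z'
  have hTfin : Module.Finite R T :=
    Module.Finite.iff_fg.2 (fg_adjoin_of_finite hZ'fin hZ'int)
  have hmem : ∀ z : Λ, χ' z ∈ T := by
    rintro ⟨z, hz⟩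
    induction hz using Algebra.adjoin_induction with
    | mem x hx => exact Algebra.subset_adjoin ⟨_, hx, rfl⟩
    | algebraMap x => exact (hχ'C x) ▸ T.algebraMap_mem _
    | add x y hx hy h1 h2 => exact (map_add χ' ⟨x, hx⟩ ⟨y, hy⟩) ▸ T.add_mem h1 h2
    | mul x y hx hy h1 h2 => exact (map_mul χ' ⟨x, hx⟩ ⟨y, hy⟩) ▸ T.mul_mem h1 h2
  let ψ : Λ →+* T := χ'.codRestrict T hmem
  have hRT : Function.Injective (algebraMap R T) := by
    have : Function.Injective (algebraMap R Ω) := by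
      rw [IsScalarTower.algebraMap_eq R (FractionRing R) Ω]
      exact (algebraMap (FractionRing R) Ω).injective.comp
        (IsFractionRing.injective R (FractionRing R))
    exact Function.Injective.of_comp (f := algebraMap T Ω) this
  have hψC : ∀ x : C, ψ (algebraMap C Λ x) = algebraMap R T (χ x) := fun x =>
    Subtype.ext (hχ'C x)
  let D₁ : Matrix ι ι Λ := Matrix.of fun i j => ⟨D i j, Algebra.subset_adjoin (Or.inl (Or.inl ⟨(i, j), rfl⟩))⟩
  let H₁ : Fin d → Matrix ι ι Λ := fun t => Matrix.of fun i j =>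
    ⟨H t i j, Algebra.subset_adjoin (Or.inl (Or.inr ⟨(t, i, j), rfl⟩))⟩
  let c₁ : ι → Fin d → Λ := fun b t => ⟨c b t, Algebra.subset_adjoin (Or.inr ⟨(b, t), rfl⟩)⟩
  have hval : Function.Injective Λ.val.toRingHom := Subtype.val_injective
  have hD₁ : D₁.map Λ.val.toRingHom = D := rfl
  have hH₁ : ∀ t, (H₁ t).map Λ.val.toRingHom = H t := fun _ => rfl
  let x₁ : Fin d → C := fun i => ⟨MvPowerSeries.X i, Subring.subset_closure (hX ⟨i, rfl⟩)⟩
  have hlow : IsLowering deg D₁ := fun i j h => hD i j fun h0 => h (Subtype.ext h0)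
  have hsq : D₁ * D₁ = 0 := by
    apply Matrix.map_injective hval
    dsimp only
    rw [Matrix.map_mul, hD₁, hDD, Matrix.map_zero _ (map_zero _)]
  have hnull : ∀ t, NullHtpy deg D₁ (algebraMap C Λ (x₁ t)) := by
    refine fun t => ⟨H₁ t, fun i j h => hH t i j fun h0 => h (Subtype.ext h0), ?_⟩
    apply Matrix.map_injective hval
    dsimp only
    rw [Matrix.map_add _ (map_add _), Matrix.map_mul, Matrix.map_mul, hD₁, hH₁, hHz]
    ext i j
    simp only [Matrix.smul_apply, Matrix.map_apply, Matrix.one_apply, smul_eq_mul, map_mul]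
    congr 1
    split_ifs <;> simp
  have hfin := ringKrullDim_le_of_finite_extension (R := R) (S := T) p hRT (fun i => χ (x₁ i)) hmax
    (hlow.map ψ) (map_mul_self_eq_zero hsq ψ) hr
    (fun t => hψC (x₁ t) ▸ (hnull t).map ψ) ha (fun b => ⟨s b, by
      have h1 : ∑ i, c₁ b i * algebraMap C Λ (x₁ i) = D₁ a b ^ s b := by
        apply hval
        rw [map_sum, map_pow]
        simp only [map_mul]
        exact hc b
      refine Ideal.mem_span_range_iff_exists_fun.2 ⟨fun i => ψ (c₁ b i), ?_⟩
      rw [Matrix.map_apply, ← map_pow, ← h1, map_sum]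
      simp only [map_mul, hψC]⟩)
  rw [hdim] at hfin
  exact_mod_cast hfin

end Descent

section CoefficientField

theorem Algebra.FormallySmooth.of_charZero (K L : Type*) [Field K] [Field L] [Algebra K L]
    [CharZero K] : Algebra.FormallySmooth K L := by
  obtain ⟨s, v, hs⟩ := exists_isTranscendenceBasis' K L
  have := hs.isAlgebraic_field
  have : Algebra.IsSeparable (IntermediateField.adjoin K (Set.range v)) L := inferInstance
  exact .of_algebraicIndependent_of_isSeparable hs.1

theorem exists_coefficient_field (B : Type*) [CommRing B] [IsLocalRing B] [Algebra ℚ B]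
    [IsAdicComplete (IsLocalRing.maximalIdeal B) B] :
    ∃ g : IsLocalRing.ResidueField B →+* B, ∀ y, IsLocalRing.residue B (g y) = y := by
  have := Algebra.FormallySmooth.of_charZero ℚ (IsLocalRing.ResidueField B)
  obtain ⟨g, hg⟩ := Algebra.FormallySmooth.exists_mkₐ_comp_eq_of_isAdicComplete
    (R := ℚ) (S := B) (A := IsLocalRing.ResidueField B) (I := IsLocalRing.maximalIdeal B)
    (AlgHom.id ℚ (IsLocalRing.ResidueField B) : IsLocalRing.ResidueField B →ₐ[ℚ] IsLocalRing.ResidueField B)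
  exact ⟨g.toRingHom, fun y => DFunLike.congr_fun hg y⟩

end CoefficientField

namespace MvPowerSeries

variable {k : Type*} [Field k] {d : ℕ}

theorem coeff_eq_zero_of_mem_span_pow {n : ℕ} {f : MvPowerSeries (Fin d) k}
    (hf : f ∈ Ideal.span (Set.range (X : Fin d → MvPowerSeries (Fin d) k)) ^ n) {e : Fin d →₀ ℕ}
    (he : e.degree < n) : coeff e f = 0 := by
  induction n generalizing f e with
  | zero => omega
  | succ n ih =>
    rw [pow_succ] at hf
    refine Submodule.mul_induction_on hf (fun a ha b hb => ?_) (fun a b ha hb => by simp [ha, hb])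
    have hb0 : constantCoeff b = 0 := by
      have : Ideal.span (Set.range (X : Fin d → MvPowerSeries (Fin d) k)) ≤
          RingHom.ker (constantCoeff (σ := Fin d) (R := k)) := by
        rw [Ideal.span_le]
        rintro _ ⟨i, rfl⟩
        exact constantCoeff_X i
      exact this hb
    rw [coeff_mul]
    refine Finset.sum_eq_zero fun q hq => ?_
    rw [Finset.HasAntidiagonal.mem_antidiagonal] at hq
    by_cases h2 : q.2 = 0
    · rw [h2, coeff_zero_eq_constantCoeff_apply, hb0, mul_zero]
    · have h3 : 0 < q.2.degree := by
        rw [Nat.pos_iff_ne_zero, Ne, Finsupp.degree_eq_zero_iff]; exact h2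
      have h4 : q.1.degree + q.2.degree = e.degree := by rw [← hq, map_add]
      rw [ih ha (by omega), zero_mul]

theorem exists_eq_sum_X_mul (f : MvPowerSeries (Fin d) k) (hf : constantCoeff f = 0) :
    ∃ g : Fin d → MvPowerSeries (Fin d) k, f = ∑ i, X i * g i ∧
      ∀ i e, coeff e (g i) = 0 ∨ coeff e (g i) = coeff (e + Finsupp.single i 1) f := by
  classical
  let g : Fin d → MvPowerSeries (Fin d) k := fun i e =>
    if ∀ j < i, e j = 0 then coeff (e + Finsupp.single i 1) f else 0
  have hg : ∀ i e, coeff e (g i) = if ∀ j < i, e j = 0 then coeff (e + Finsupp.single i 1) f else 0 :=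
    fun _ _ => rfl
  refine ⟨g, ?_, fun i e => ?_⟩
  · ext e
    rw [map_sum]
    have hterm : ∀ i, coeff e (X i * g i) =
        if e i ≠ 0 ∧ ∀ j < i, e j = 0 then coeff e f else 0 := by
      intro i
      by_cases hi : e i = 0
      · rw [if_neg (by simp [hi]), mul_comm, X, coeff_mul_monomial, if_neg]
        intro hle
        have := hle i
        simp [hi] at this
      · have hle : Finsupp.single i 1 ≤ e := by
          rw [Finsupp.single_le_iff]; omega
        rw [mul_comm, X, coeff_mul_monomial, if_pos hle, mul_one, hg, tsub_add_cancel_of_le hle]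
        congr 1
        simp only [eq_iff_iff, hi, ne_eq, not_false_eq_true, true_and]
        refine forall₂_congr fun j hj => ?_
        rw [Finsupp.tsub_apply, Finsupp.single_eq_of_ne (by omega), Nat.sub_zero]
    simp only [hterm]
    by_cases he : e = 0
    · subst he
      rw [Finset.sum_eq_zero (by simp), coeff_zero_eq_constantCoeff_apply, hf]
    · have hex : ∃ i, e i ≠ 0 := by
        by_contra! h
        exact he (Finsupp.ext h)
      let i₀ := WellFounded.min wellFounded_lt {i | e i ≠ 0} hex
      have h0 : e i₀ ≠ 0 := WellFounded.min_mem wellFounded_lt {i | e i ≠ 0} hex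
      have hmin : ∀ j < i₀, e j = 0 := fun j hj => by
        by_contra h
        exact WellFounded.not_lt_min wellFounded_lt {i | e i ≠ 0} h hj
      rw [Finset.sum_eq_single i₀, if_pos ⟨h0, hmin⟩]
      · intro i _ hi
        rw [if_neg]
        rintro ⟨h1, h2⟩
        rcases lt_trichotomy i i₀ with h | h | h
        · exact h1 (hmin i h)
        · exact hi h
        · exact h0 (h2 i₀ h)
      · simp
  · rw [hg]
    split_ifs <;> simp

theorem mem_span_pow_of_coeff_eq_zero {n : ℕ} {f : MvPowerSeries (Fin d) k}
    (hf : ∀ e : Fin d →₀ ℕ, e.degree < n → coeff e f = 0) :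
    f ∈ Ideal.span (Set.range (X : Fin d → MvPowerSeries (Fin d) k)) ^ n := by
  induction n generalizing f with
  | zero => simp
  | succ n ih =>
    obtain ⟨g, hg, hg'⟩ := exists_eq_sum_X_mul f (hf 0 (by simp))
    rw [hg, pow_succ']
    refine Ideal.sum_mem _ fun i _ => Ideal.mul_mem_mul (Ideal.subset_span ⟨i, rfl⟩) (ih fun e he => ?_)
    rcases hg' i e with h | h
    · exact h
    · rw [h]
      apply hf
      rw [map_add, Finsupp.degree_single]
      omega

instance isPrecomplete_pi (κ : Type*) [Finite κ] :
    IsPrecomplete (Ideal.span (Set.range (X : Fin d → MvPowerSeries (Fin d) k)))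
      (κ → MvPowerSeries (Fin d) k) := by
  classical
  have := Fintype.ofFinite κ
  set I := Ideal.span (Set.range (X : Fin d → MvPowerSeries (Fin d) k)) with hI
  have hpi : ∀ (n : ℕ) (y : κ → MvPowerSeries (Fin d) k),
      y ∈ (I ^ n • ⊤ : Submodule (MvPowerSeries (Fin d) k) (κ → MvPowerSeries (Fin d) k)) ↔
        ∀ j, y j ∈ I ^ n := by
    intro n y
    constructor
    · intro hy j
      refine Submodule.smul_induction_on hy (fun r hr m _ => ?_) (fun a b ha hb => Ideal.add_mem _ ha hb)
      exact Ideal.mul_mem_right _ _ hr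
    · intro hy
      have : y = ∑ j, y j • (Pi.single j 1 : κ → MvPowerSeries (Fin d) k) := by
        ext1 i
        simp [Finset.sum_apply, Pi.single_apply]
      rw [this]
      exact Submodule.sum_mem _ fun j _ => Submodule.smul_mem_smul (hy j) trivial
  refine ⟨fun f hf => ?_⟩
  let y : κ → MvPowerSeries (Fin d) k := fun j e => coeff e (f (e.degree + 1) j)
  have hy : ∀ j e, coeff e (y j) = coeff e (f (e.degree + 1) j) := fun _ _ => rfl
  refine ⟨y, fun n => ?_⟩
  rw [SModEq.sub_mem, hpi]
  refine fun j => mem_span_pow_of_coeff_eq_zero fun e he => ?_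
  have h1 := hf (show e.degree + 1 ≤ n from he)
  rw [SModEq.sub_mem, hpi] at h1
  have h2 := coeff_eq_zero_of_mem_span_pow (h1 j) (Nat.lt_succ_self e.degree)
  rw [Pi.sub_apply, map_sub, sub_eq_zero] at h2 ⊢
  rw [hy]
  exact h2.symm

end MvPowerSeries

section CompleteLocal

variable {k : Type*} [Field k] {d : ℕ} {B : Type*} [CommRing B]

theorem exists_ringHom_mvPowerSeries (I : Ideal B) [IsAdicComplete I B] (g : k →+* B)
    (x : Fin d → B) (hx : ∀ i, x i ∈ I) :
    ∃ φ : MvPowerSeries (Fin d) k →+* B, (∀ c, φ (MvPowerSeries.C c) = g c) ∧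
      ∀ i, φ (MvPowerSeries.X i) = x i := by
  let ev : MvPolynomial (Fin d) k →+* B := MvPolynomial.eval₂Hom g x
  have hev : MvPolynomial.idealOfVars (Fin d) k ≤ I.comap ev := by
    rw [MvPolynomial.idealOfVars, Ideal.span_le]
    rintro _ ⟨i, rfl⟩
    simpa [ev] using hx i
  have hevn : ∀ n, MvPolynomial.idealOfVars (Fin d) k ^ n ≤ (I ^ n).comap ev := fun n =>
    (Ideal.pow_right_mono hev n).trans (Ideal.le_comap_pow ev n)
  let f : (n : ℕ) → MvPowerSeries (Fin d) k →+* B ⧸ I ^ n := fun n =>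
    (Ideal.quotientMap (I ^ n) ev (hevn n)).comp
      (MvPowerSeries.truncTotalAlgHom (Fin d) k n).toRingHom
  have hf : ∀ n p, f n p = Ideal.Quotient.mk (I ^ n) (ev (p.truncTotal n)) := fun n p => rfl
  have hcompat : ∀ {m n : ℕ} (hle : m ≤ n), (Ideal.Quotient.factorPow I hle).comp (f n) = f m := by
    intro m n hle
    refine RingHom.ext fun p => ?_
    rw [RingHom.comp_apply, hf, hf]
    change Ideal.Quotient.mk (I ^ m) _ = _
    rw [Ideal.Quotient.eq, ← map_sub]
    exact hevn m (MvPowerSeries.truncTotal_sub_truncTotal_mem_pow_idealOfVars hle le_rfl p)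
  let φ := IsAdicComplete.liftRingHom I f hcompat
  have hφ : ∀ p : MvPolynomial (Fin d) k, φ (p : MvPowerSeries (Fin d) k) = ev p := by
    intro p
    refine congrFun (IsHausdorff.funext' I (f := fun p : MvPolynomial (Fin d) k =>
      φ (p : MvPowerSeries (Fin d) k)) (g := ev) fun n p => ?_) p
    rw [IsAdicComplete.mk_liftRingHom]
    have := (MvPowerSeries.truncTotalAlgHom (Fin d) k n).commutes p
    exact congrArg (Ideal.quotientMap (I ^ n) ev (hevn n)) this
  refine ⟨φ, fun c => ?_, fun i => ?_⟩
  · rw [← MvPolynomial.coe_C, hφ]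
    simp [ev]
  · rw [← MvPolynomial.coe_X, hφ]
    simp [ev]

variable [IsLocalRing B]

open IsLocalRing in
theorem exists_fg_submodule_sub_mem_pow [Algebra (MvPowerSeries (Fin d) k) B]
    (hm : (maximalIdeal B).FG)
    (hres : ∀ b : B, ∃ c : k, b - algebraMap _ B (MvPowerSeries.C (σ := Fin d) c) ∈ maximalIdeal B)
    (j : ℕ) : ∃ F : Submodule (MvPowerSeries (Fin d) k) B, F.FG ∧
      ∀ b, ∃ f ∈ F, b - f ∈ maximalIdeal B ^ j := by
  induction j with
  | zero => exact ⟨⊥, Submodule.fg_bot, fun b => ⟨0, Submodule.zero_mem _, by simp⟩⟩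
  | succ j ih =>
    obtain ⟨F, hF, hFj⟩ := ih
    obtain ⟨U, hU⟩ := hm.pow (n := j)
    refine ⟨F ⊔ Submodule.span _ (U : Set B), hF.sup (Submodule.fg_span U.finite_toSet), ?_⟩
    have key : ∀ y ∈ Submodule.span B (U : Set B), ∀ c : B,
        ∃ f ∈ Submodule.span (MvPowerSeries (Fin d) k) (U : Set B),
          c * y - f ∈ maximalIdeal B ^ (j + 1) := by
      intro y hy
      induction hy using Submodule.span_induction with
      | mem y hy =>
        intro c
        obtain ⟨t, ht⟩ := hres c
        refine ⟨MvPowerSeries.C (σ := Fin d) t • y,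
          Submodule.smul_mem _ _ (Submodule.subset_span hy), ?_⟩
        rw [Algebra.smul_def, ← sub_mul, pow_succ']
        refine Ideal.mul_mem_mul ht ?_
        rw [← hU]
        exact Submodule.subset_span hy
      | zero => exact fun c => ⟨0, Submodule.zero_mem _, by simp⟩
      | add y z _ _ hy hz =>
        intro c
        obtain ⟨f, hf, hf'⟩ := hy c
        obtain ⟨f₂, hf₂, hf₂'⟩ := hz c
        refine ⟨f + f₂, Submodule.add_mem _ hf hf₂, ?_⟩
        have : c * (y + z) - (f + f₂) = (c * y - f) + (c * z - f₂) := by ring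
        rw [this]
        exact Ideal.add_mem _ hf' hf₂'
      | smul a y _ hy =>
        intro c
        rw [smul_eq_mul, ← mul_assoc]
        exact hy _
    intro b
    obtain ⟨f, hf, hf'⟩ := hFj b
    rw [← hU] at hf'
    obtain ⟨f₂, hf₂, hf₂'⟩ := key _ hf' 1
    refine ⟨f + f₂, Submodule.add_mem_sup hf hf₂, ?_⟩
    rwa [one_mul, sub_sub] at hf₂'

open IsLocalRing in
theorem finite_of_pow_le_span [Algebra (MvPowerSeries (Fin d) k) B]
    [IsHausdorff (maximalIdeal B) B] (hm : (maximalIdeal B).FG)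
    (hres : ∀ b : B, ∃ c : k, b - algebraMap _ B (MvPowerSeries.C (σ := Fin d) c) ∈ maximalIdeal B)
    (hX : ∀ i, algebraMap (MvPowerSeries (Fin d) k) B (MvPowerSeries.X i) ∈ maximalIdeal B) {N : ℕ}
    (hN : maximalIdeal B ^ N ≤ Ideal.span
      (Set.range fun i => algebraMap (MvPowerSeries (Fin d) k) B (MvPowerSeries.X i))) :
    Module.Finite (MvPowerSeries (Fin d) k) B := by
  obtain ⟨F, hF, hFN⟩ := exists_fg_submodule_sub_mem_pow (k := k) (d := d) hm hres N
  set I : Ideal (MvPowerSeries (Fin d) k) := Ideal.span (Set.range MvPowerSeries.X) with hI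
  have hmap : I.map (algebraMap _ B) = Ideal.span
      (Set.range fun i => algebraMap (MvPowerSeries (Fin d) k) B (MvPowerSeries.X i)) := by
    rw [hI, Ideal.map_span, ← Set.range_comp]; rfl
  have hle : I.map (algebraMap _ B) ≤ maximalIdeal B := by
    rw [hmap, Ideal.span_le]
    rintro _ ⟨i, rfl⟩
    exact hX i
  have : IsHausdorff I B := IsHausdorff.of_map hle
  obtain ⟨n, w, hw⟩ := Submodule.fg_iff_exists_fin_generating_family.1 hF
  let f : (Fin n → MvPowerSeries (Fin d) k) →ₗ[MvPowerSeries (Fin d) k] B :=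
    Fintype.linearCombination (MvPowerSeries (Fin d) k) w
  have hf : f.range = F := by rw [← hw, Fintype.range_linearCombination]
  refine Module.Finite.of_surjective f (surjective_of_mkQ_comp_surjective (I := I) ?_)
  intro y
  obtain ⟨b, rfl⟩ := Submodule.mkQ_surjective _ y
  obtain ⟨z, hz, hbz⟩ := hFN b
  rw [← hf] at hz
  obtain ⟨t, rfl⟩ := hz
  refine ⟨t, ?_⟩
  rw [LinearMap.comp_apply, ← sub_eq_zero, ← map_sub, ← LinearMap.mem_ker, Submodule.ker_mkQ,
    Ideal.smul_top_eq_map, Submodule.restrictScalars_mem, hmap, ← neg_sub]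
  exact Ideal.neg_mem_iff _ |>.2 (hN hbz)

end CompleteLocal

section Complete

open IsLocalRing

variable {ι : Type w} [Fintype ι] [DecidableEq ι] {deg : ι → ℕ}

theorem MvPowerSeries.ringKrullDim_le {k : Type*} [Field k] (d : ℕ) :
    ringKrullDim (MvPowerSeries (Fin d) k) ≤ d := by
  refine (ringKrullDim_le_spanFinrank_maximalIdeal _).trans ?_
  rw [MvPowerSeries.maximalIdeal_eq_span]
  have := Submodule.spanFinrank_span_le_ncard_of_finite (R := MvPowerSeries (Fin d) k)
    (Set.finite_range (MvPowerSeries.X (R := k) (σ := Fin d)))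
  have h2 := Set.ncard_image_le (f := MvPowerSeries.X (R := k) (σ := Fin d)) Set.finite_univ
  rw [Set.image_univ, Set.ncard_univ, Nat.card_fin] at h2
  exact_mod_cast this.trans h2

theorem le_of_isAdicComplete {B : Type u} [CommRing B] [IsLocalRing B] [Algebra ℚ B]
    [IsAdicComplete (maximalIdeal B) B] (hm : (maximalIdeal B).FG) {d N : ℕ} (x : Fin d → B)
    (hx : ∀ i, x i ∈ maximalIdeal B) (hN : maximalIdeal B ^ N ≤ Ideal.span (Set.range x))
    (hdim : d ≤ ringKrullDim B) {D : Matrix ι ι B}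
    (hD : IsLowering deg D) (hDD : D * D = 0) {r : ℕ} (hr : ∀ b, deg b ≤ r)
    (hJ : ∀ i, NullHtpy deg D (x i)) {a : ι} (ha : deg a = 0)
    (haD : ∀ b, D a b ∈ maximalIdeal B) : d ≤ r := by
  obtain ⟨g, hg⟩ := exists_coefficient_field B
  obtain ⟨φ, hφC, hφX⟩ := exists_ringHom_mvPowerSeries (maximalIdeal B) g x hx
  have : CharZero (ResidueField B) := algebraRat.charZero _
  let _ : Algebra (MvPowerSeries (Fin d) (ResidueField B)) B := φ.toAlgebra
  have hφ : algebraMap (MvPowerSeries (Fin d) (ResidueField B)) B = φ := rfl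
  have hφX' : (fun i => φ (MvPowerSeries.X i)) = x := funext hφX
  have hfin : Module.Finite (MvPowerSeries (Fin d) (ResidueField B)) B := by
    refine finite_of_pow_le_span hm (fun b => ⟨residue B b, ?_⟩) (fun i => ?_) (N := N) ?_
    · rw [hφ, hφC, ← residue_eq_zero_iff, map_sub, hg, sub_self]
    · rw [hφ, hφX]
      exact hx i
    · rw [hφ, hφX']
      exact hN
  have hinj : Function.Injective φ := by
    rw [injective_iff_map_eq_zero]
    intro s hs
    by_contra hs0
    have : IsDomain (MvPowerSeries (Fin d) (ResidueField B)) := NoZeroDivisors.to_isDomain _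
    have h1 := ringKrullDim_quotient_succ_le_of_nonZeroDivisor (mem_nonZeroDivisors_of_ne_zero hs0)
    let ψ : MvPowerSeries (Fin d) (ResidueField B) ⧸ Ideal.span {s} →+* B :=
      Ideal.Quotient.lift _ φ (fun t ht => by
        obtain ⟨c, rfl⟩ := Ideal.mem_span_singleton'.1 ht
        rw [map_mul, hs, mul_zero])
    have hψ : ψ.comp (Ideal.Quotient.mk _) = φ := Ideal.Quotient.lift_comp_mk _ _ _
    have hintegral : ψ.IsIntegral := by
      apply RingHom.IsIntegral.tower_top (Ideal.Quotient.mk _)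
      rw [hψ]
      exact fun b => Algebra.IsIntegral.isIntegral (R := MvPowerSeries (Fin d) (ResidueField B)) b
    let _ := ψ.toAlgebra
    have : Algebra.IsIntegral (MvPowerSeries (Fin d) (ResidueField B) ⧸ Ideal.span {s}) B :=
      ⟨hintegral⟩
    have h2 := ringKrullDim_le_of_isIntegral
      (R := MvPowerSeries (Fin d) (ResidueField B) ⧸ Ideal.span {s}) (S := B)
    have h3 := h1.trans (MvPowerSeries.ringKrullDim_le d)
    have h4 : ((d : ℕ) : WithBot ℕ∞) + 1 ≤ d := (add_le_add_left (hdim.trans h2) 1).trans h3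
    have h5 : d + 1 ≤ d := by exact_mod_cast h4
    omega
  have hXx : ∀ i, algebraMap (MvPowerSeries (Fin d) (ResidueField B)) B (MvPowerSeries.X i) = x i := hφX
  refine le_of_isIntegral_mvPowerSeries (k := ResidueField B) (B := B) hinj hD hDD hr
    (fun i => (hXx i).symm ▸ hJ i) ha (fun b => ⟨N, ?_⟩)
  simp only [hXx]
  exact hN (Ideal.pow_mem_pow (haD b) N)

end Complete

open IsLocalRing

section NullHtpyIdeal

variable {A : Type u} [CommRing A] {ι : Type w} [Fintype ι] [DecidableEq ι] {deg : ι → ℕ}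
  {D : Matrix ι ι A}

/-- The ideal of elements acting null-homotopically on a complex of free modules. -/
def nullHtpyIdeal (deg : ι → ℕ) (D : Matrix ι ι A) : Ideal A where
  carrier := {z | NullHtpy deg D z}
  zero_mem' := ⟨0, fun a b h => absurd (by simp) h, by simp⟩
  add_mem' := by
    rintro x y ⟨H, hH, hx⟩ ⟨H', hH', hy⟩
    refine ⟨H + H', fun a b h => ?_, ?_⟩
    · by_cases h1 : H.transpose a b = 0
      · refine hH' a b fun h2 => h ?_
        rw [Matrix.transpose_add, Matrix.add_apply, h1, h2, add_zero]
      · exact hH a b h1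
    · rw [mul_add, add_mul, add_smul, ← hx, ← hy]
      abel
  smul_mem' := by
    rintro c x ⟨H, hH, hx⟩
    refine ⟨c • H, fun a b h => hH a b fun h2 => h ?_, ?_⟩
    · rw [Matrix.transpose_smul, Matrix.smul_apply, h2, smul_zero]
    · rw [Matrix.mul_smul, Matrix.smul_mul, ← smul_add, hx, smul_assoc]

theorem mem_nullHtpyIdeal {z : A} : z ∈ nullHtpyIdeal deg D ↔ NullHtpy deg D z := Iff.rfl

end NullHtpyIdeal

section LocalRing

variable {A : Type u} [CommRing A] [IsNoetherianRing A] [IsLocalRing A]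

theorem maximalIdeal_le_radical_of_forall_prime {J : Ideal A}
    (hJ : ∀ P : Ideal A, P.IsPrime → P ≠ maximalIdeal A → ∃ x, x ∉ P ∧ x ∈ J) :
    maximalIdeal A ≤ J.radical := by
  rw [Ideal.radical_eq_sInf]
  refine le_sInf fun P hP => ?_
  by_contra h
  obtain ⟨x, hx, hxJ⟩ := hJ P hP.2 fun h' => h h'.ge
  exact hx (hP.1 hxJ)

theorem exists_system_of_parameters {d : ℕ} (hd : ringKrullDim A = d) :
    ∃ x : Fin d → A, (∀ i, x i ∈ maximalIdeal A) ∧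
      maximalIdeal A ≤ (Ideal.span (Set.range x)).radical := by
  obtain ⟨s, hs, hcard⟩ :=
    Ideal.exists_finset_card_eq_height_of_isNoetherianRing (maximalIdeal A)
  have hcard' : s.card = d := by
    have h := (maximalIdeal_height_eq_ringKrullDim (R := A)).trans hd
    rw [← hcard] at h
    exact_mod_cast h
  subst hcard'
  refine ⟨fun i => s.equivFin.symm i, fun i => hs.1.2 (Ideal.subset_span (s.equivFin.symm i).2), ?_⟩
  have hrange : (Set.range fun i => (s.equivFin.symm i : A)) = s := by
    ext y
    constructor
    · rintro ⟨i, rfl⟩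
      exact (s.equivFin.symm i).2
    · intro hy
      exact ⟨s.equivFin ⟨y, hy⟩, by simp⟩
  rw [hrange]
  refine maximalIdeal_le_radical_of_forall_prime fun P hP hPm => ?_
  by_contra! hcon
  have hle : Ideal.span (s : Set A) ≤ P := fun x hx => by
    by_contra h
    exact hcon x h hx
  exact hPm (le_antisymm (le_maximalIdeal hP.ne_top) (hs.2 ⟨hP, hle⟩ (le_maximalIdeal hP.ne_top)))

variable (A) in
theorem ringKrullDim_le_ringKrullDim_adicCompletion :
    ringKrullDim A ≤ ringKrullDim (AdicCompletion (maximalIdeal A) A) := by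
  let B := AdicCompletion (maximalIdeal A) A
  obtain ⟨l, hl, hlen⟩ := (maximalIdeal A).exists_ltSeries_length_eq_height
  have hover : (maximalIdeal B).LiesOver l.last.asIdeal := by
    rw [hl]
    refine ⟨(maximalIdeal.isMaximal A).eq_of_le (Ideal.comap_ne_top _ ?_) ?_⟩
    · exact (maximalIdeal.isMaximal B).ne_top
    · rw [Ideal.under_def, ← Ideal.map_le_iff_le_comap]
      exact AdicCompletion.maximalIdeal_eq_map.ge
  have : Algebra.HasGoingDown A B := Algebra.HasGoingDown.of_flat
  obtain ⟨L, hL, -⟩ := Ideal.exists_ltSeries_of_hasGoingDown l (maximalIdeal B)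
  rw [← maximalIdeal_height_eq_ringKrullDim, ← hlen, ← hL]
  exact le_iSup (fun L : LTSeries (PrimeSpectrum B) => (L.length : WithBot ℕ∞)) L

variable {ι : Type w} [Fintype ι] [DecidableEq ι] {deg : ι → ℕ} {D : Matrix ι ι A}

theorem ringKrullDim_le_of_algebraRat [Algebra ℚ A] (hD : IsLowering deg D) (hDD : D * D = 0)
    {r : ℕ} (hr : ∀ b, deg b ≤ r)
    (hJ : ∀ P : Ideal A, P.IsPrime → P ≠ maximalIdeal A → ∃ x, x ∉ P ∧ NullHtpy deg D x)
    {a : ι} (ha : deg a = 0) (haD : ∀ b, D a b ∈ maximalIdeal A) : ringKrullDim A ≤ r := by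
  obtain ⟨d, hd⟩ := exists_ringKrullDim_eq_natCast A
  have hfg : ∀ I : Ideal A, I.FG := fun I => I.fg_of_isNoetherianRing
  have hrad : maximalIdeal A ≤ (nullHtpyIdeal deg D).radical :=
    maximalIdeal_le_radical_of_forall_prime hJ
  obtain ⟨M, hM⟩ := Ideal.exists_pow_le_of_le_radical_of_fg hrad (hfg _)
  obtain ⟨x, hxm, hxrad⟩ := exists_system_of_parameters hd
  have hxrad' : maximalIdeal A ≤ (Ideal.span (Set.range fun i => x i ^ (M + 1))).radical := by
    refine hxrad.trans (Ideal.radical_le_radical_iff.2 (Ideal.span_le.2 ?_))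
    rintro _ ⟨i, rfl⟩
    exact ⟨M + 1, Ideal.subset_span ⟨i, rfl⟩⟩
  obtain ⟨N, hN⟩ := Ideal.exists_pow_le_of_le_radical_of_fg hxrad' (hfg _)
  let B := AdicCompletion (maximalIdeal A) A
  have hmB : maximalIdeal B = (maximalIdeal A).map (algebraMap A B) :=
    AdicCompletion.maximalIdeal_eq_map
  have hmem : ∀ y ∈ maximalIdeal A, algebraMap A B y ∈ maximalIdeal B := fun y hy => by
    rw [hmB]
    exact Ideal.mem_map_of_mem _ hy
  have hle : d ≤ r := by
    let _ : Algebra ℚ B := Algebra.compHom B (algebraMap ℚ A)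
    refine le_of_isAdicComplete (B := B) (hmB ▸ (hfg _).map _) (N := N)
      (fun i => algebraMap A B (x i ^ (M + 1))) (fun i => ?_) ?_
      (hd ▸ ringKrullDim_le_ringKrullDim_adicCompletion A) (hD.map (algebraMap A B))
      (map_mul_self_eq_zero hDD _) hr (fun i => ?_) ha (fun b => hmem _ (haD b))
    · exact hmem _ (Ideal.pow_mem_of_mem _ (hxm i) _ (Nat.succ_pos M))
    · rw [hmB, ← Ideal.map_pow]
      refine (Ideal.map_mono hN).trans_eq ?_
      rw [Ideal.map_span, ← Set.range_comp]
      rfl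
    · exact NullHtpy.map (mem_nullHtpyIdeal.1
        (hM (Ideal.pow_le_pow_right (Nat.le_succ M) (Ideal.pow_mem_pow (hxm i) (M + 1))))) _
  rw [hd]
  exact_mod_cast hle

end LocalRing

section Cone

variable {A : Type u} [CommRing A] {ι : Type w} [Fintype ι] [DecidableEq ι] {deg : ι → ℕ}
  {D : Matrix ι ι A}

/-- The differential of the mapping cone of multiplication by `y`. -/
def coneMatrix (D : Matrix ι ι A) (y : A) : Matrix (ι ⊕ ι) (ι ⊕ ι) A :=
  Matrix.fromBlocks D (y • 1) 0 (-D)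

/-- The degrees of the basis elements of the mapping cone. -/
def coneDeg (deg : ι → ℕ) : ι ⊕ ι → ℕ := Sum.elim deg fun b => deg b + 1

theorem IsLowering.coneMatrix (hD : IsLowering deg D) (y : A) :
    IsLowering (coneDeg deg) (coneMatrix D y) := by
  rintro (a | a) (b | b) h
  · exact hD a b h
  · have hab : a = b := by
      by_contra hab
      apply h
      simp [_root_.coneMatrix, Matrix.one_apply_ne hab]
    simp [coneDeg, hab]
  · exact absurd rfl h
  · have h' : D a b ≠ 0 := fun h' => h (by simp [_root_.coneMatrix, h'])
    simp [coneDeg, hD a b h']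

theorem coneMatrix_mul_self (hDD : D * D = 0) (y : A) :
    coneMatrix D y * coneMatrix D y = 0 := by
  simp [coneMatrix, Matrix.fromBlocks_multiply, hDD]

theorem NullHtpy.coneMatrix {z : A} (h : NullHtpy deg D z) (y : A) :
    NullHtpy (coneDeg deg) (coneMatrix D y) z := by
  obtain ⟨H, hH, hz⟩ := h
  refine ⟨Matrix.fromBlocks H 0 0 (-H), ?_, ?_⟩
  · rintro (a | a) (b | b) h
    · exact hH a b h
    · exact absurd rfl h
    · exact absurd rfl h
    · have h' : H.transpose a b ≠ 0 := fun h' => h (by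
        have h'' : H b a = 0 := h'
        simp [h''])
      simp [coneDeg, hH a b h']
  · rw [_root_.coneMatrix, Matrix.fromBlocks_multiply, Matrix.fromBlocks_multiply,
      Matrix.fromBlocks_add, ← Matrix.fromBlocks_one, Matrix.fromBlocks_smul]
    simp [hz]

theorem nullHtpy_coneMatrix_self (D : Matrix ι ι A) (y : A) :
    NullHtpy (coneDeg deg) (coneMatrix D y) y := by
  refine ⟨Matrix.fromBlocks 0 0 1 0, ?_, ?_⟩
  · rintro (a | a) (b | b) h
    · exact absurd rfl h
    · have hab : b = a := by
        by_contra hab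
        apply h
        simp [Matrix.one_apply_ne hab]
      simp [coneDeg, hab]
    · exact absurd rfl h
    · exact absurd rfl h
  · rw [coneMatrix, Matrix.fromBlocks_multiply, Matrix.fromBlocks_multiply,
      Matrix.fromBlocks_add, ← Matrix.fromBlocks_one, Matrix.fromBlocks_smul]
    simp

end Cone

section Domain

variable {A : Type u} [CommRing A] [IsNoetherianRing A] [IsLocalRing A]
variable {ι : Type w} [Fintype ι] [DecidableEq ι] {deg : ι → ℕ} {D : Matrix ι ι A}

theorem ringKrullDim_le_of_isDomain [IsDomain A] (hD : IsLowering deg D) (hDD : D * D = 0)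
    {r : ℕ} (hr : ∀ b, deg b ≤ r)
    (hJ : ∀ P : Ideal A, P.IsPrime → P ≠ maximalIdeal A → ∃ x, x ∉ P ∧ NullHtpy deg D x)
    {a : ι} (ha : deg a = 0) (haD : ∀ b, D a b ∈ maximalIdeal A) : ringKrullDim A ≤ r := by
  by_cases hunit : ∀ n : ℕ, 0 < n → IsUnit (n : A)
  · have : Nonempty (Algebra ℚ A) := by
      refine (EqualCharZero.nonempty_algebraRat_iff A).2 fun I hI => ⟨fun m n hmn => ?_⟩
      by_contra hne
      wlog hlt : m < n generalizing m n
      · exact this n m hmn.symm (Ne.symm hne) (by omega)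
      apply hI
      refine I.eq_top_of_isUnit_mem ?_ (hunit (n - m) (by omega))
      rw [← Ideal.Quotient.eq_zero_iff_mem, map_natCast, Nat.cast_sub hlt.le, hmn, sub_self]
    obtain ⟨h⟩ := this
    exact ringKrullDim_le_of_algebraRat hD hDD hr hJ ha haD
  · push Not at hunit
    obtain ⟨n, hn, hn'⟩ := hunit
    have hmem : (n : A) ∈ maximalIdeal A := hn'
    obtain ⟨p, hp, hpm⟩ : ∃ p : ℕ, p.Prime ∧ (p : A) ∈ maximalIdeal A := by
      have h1 : (n.primeFactorsList.map (Nat.cast : ℕ → A)).prod ∈ maximalIdeal A := by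
        rw [← Nat.cast_list_prod, Nat.prod_primeFactorsList hn.ne']
        exact hmem
      obtain ⟨x, hx, hxm⟩ := (Ideal.IsPrime.multiset_prod_mem_iff_exists_mem
        (maximalIdeal.isMaximal A).isPrime (n.primeFactorsList.map (Nat.cast : ℕ → A) : Multiset A)).1
        (by rwa [Multiset.prod_coe])
      obtain ⟨p, hp, rfl⟩ := List.mem_map.1 hx
      exact ⟨p, Nat.prime_of_mem_primeFactorsList hp, hxm⟩
    have : Fact p.Prime := ⟨hp⟩
    by_cases h0 : (p : A) = 0
    · have := charP_of_natCast_eq_zero p h0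
      exact ringKrullDim_le_of_charP p hD hDD hr hJ ha haD
    · exact ringKrullDim_le_of_mixedChar p (fun x hx => (mul_eq_zero.1 hx).resolve_left h0) hpm
        hD hDD hr hJ ha haD

theorem ringKrullDim_le_add_of_le_radical [IsDomain A] {e : ℕ} (y : Fin e → A)
    (hy : ∀ i, y i ∈ maximalIdeal A) (hD : IsLowering deg D) (hDD : D * D = 0)
    {r : ℕ} (hr : ∀ b, deg b ≤ r)
    (hJ : maximalIdeal A ≤ (nullHtpyIdeal deg D ⊔ Ideal.span (Set.range y)).radical)
    {a : ι} (ha : deg a = 0) (haD : ∀ b, D a b ∈ maximalIdeal A) :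
    ringKrullDim A ≤ (r + e : ℕ) := by
  induction e generalizing ι r with
  | zero =>
    refine ringKrullDim_le_of_isDomain hD hDD hr (fun P hP hPm => ?_) ha haD
    by_contra! hcon
    have hle : nullHtpyIdeal deg D ≤ P := fun x hx => by
      by_contra h
      exact hcon x h hx
    apply hPm
    refine le_antisymm (le_maximalIdeal hP.ne_top) (hJ.trans ?_)
    simpa [hP.radical_le_iff] using hle
  | succ e ih =>
    have key := ih (ι := ι ⊕ ι) (deg := coneDeg deg) (D := coneMatrix D (y 0))
      (fun i => y i.succ) (fun i => hy _) (hD.coneMatrix _) (coneMatrix_mul_self hDD _)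
      (r := r + 1) ?_ (hJ.trans (Ideal.radical_mono ?_)) (a := Sum.inl a) ha ?_
    · rwa [show r + (e + 1) = r + 1 + e by omega]
    · rintro (b | b)
      · exact (hr b).trans (Nat.le_succ r)
      · exact Nat.succ_le_succ (hr b)
    · refine sup_le (le_sup_of_le_left fun z hz => NullHtpy.coneMatrix hz _) ?_
      rw [Ideal.span_le]
      rintro _ ⟨i, rfl⟩
      induction i using Fin.cases with
      | zero => exact Ideal.mem_sup_left (nullHtpy_coneMatrix_self D (y 0))
      | succ i => exact Ideal.mem_sup_right (Ideal.subset_span ⟨i, rfl⟩)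
    · rintro (b | b)
      · exact haD b
      · change ((y 0) • (1 : Matrix ι ι A)) a b ∈ maximalIdeal A
        rw [Matrix.smul_apply, smul_eq_mul]
        exact Ideal.mul_mem_right _ _ (hy 0)

theorem nullHtpyIdeal_ne_top {a : ι} (ha : deg a = 0) (haD : ∀ b, D a b ∈ maximalIdeal A)
    (hD : IsLowering deg D) : nullHtpyIdeal deg D ≠ ⊤ := by
  intro htop
  obtain ⟨H, hH, h1⟩ : NullHtpy deg D (1 : A) := mem_nullHtpyIdeal.1 (htop ▸ trivial)
  have h := congrFun (congrFun h1 a) a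
  rw [one_smul, Matrix.one_apply_eq, Matrix.add_apply, Matrix.mul_apply, Matrix.mul_apply,
    Finset.sum_eq_zero (s := Finset.univ) (f := fun j => H a j * D j a), add_zero] at h
  · refine (maximalIdeal.isMaximal A).ne_top ((Ideal.eq_top_iff_one _).2 (h ▸ ?_))
    exact Ideal.sum_mem _ fun b _ => Ideal.mul_mem_right _ _ (haD b)
  · intro b _
    by_cases hb : D b a = 0
    · rw [hb, mul_zero]
    · have := hD b a hb
      omega

/-- The intersection theorem for complexes over a local domain. -/
theorem ringKrullDim_le_ringKrullDim_quotient_add [IsDomain A] (hD : IsLowering deg D)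
    (hDD : D * D = 0) {r : ℕ} (hr : ∀ b, deg b ≤ r)
    {a : ι} (ha : deg a = 0) (haD : ∀ b, D a b ∈ maximalIdeal A) :
    ringKrullDim A ≤ ringKrullDim (A ⧸ nullHtpyIdeal deg D) + r := by
  have hne := nullHtpyIdeal_ne_top ha haD hD
  set J := nullHtpyIdeal deg D
  have : Nontrivial (A ⧸ J) := Ideal.Quotient.nontrivial_iff.2 hne
  have hsurj : Function.Surjective (Ideal.Quotient.mk J) := Ideal.Quotient.mk_surjective
  have : IsLocalRing (A ⧸ J) := IsLocalRing.of_surjective' (Ideal.Quotient.mk J) hsurj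
  have hloc : IsLocalHom (Ideal.Quotient.mk J) := IsLocalHom.of_surjective _ hsurj
  obtain ⟨e, he⟩ := exists_ringKrullDim_eq_natCast (A ⧸ J)
  obtain ⟨x, hxm, hx⟩ := exists_system_of_parameters he
  choose y hy using fun i => hsurj (x i)
  have hym : ∀ i, y i ∈ maximalIdeal A := fun i hu => hxm i (hy i ▸ hu.map _)
  rw [he]
  have key := ringKrullDim_le_add_of_le_radical y hym hD hDD hr (fun z hz => ?_) ha haD
  · rw [add_comm]
    exact_mod_cast key
  · have hz' : Ideal.Quotient.mk J z ∈ maximalIdeal (A ⧸ J) := fun hu =>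
      hz (isUnit_of_map_unit (Ideal.Quotient.mk J) z hu)
    obtain ⟨n, hn⟩ := hx hz'
    refine ⟨n, ?_⟩
    have hrange : Set.range x = Ideal.Quotient.mk J '' Set.range y := by
      rw [← Set.range_comp]
      exact congrArg Set.range (funext fun i => (hy i).symm)
    rw [hrange, ← Ideal.map_span, ← map_pow, ← Ideal.mem_comap,
      Ideal.comap_map_of_surjective _ hsurj, ← RingHom.ker_eq_comap_bot, Ideal.mk_ker, sup_comm]
      at hn
    exact hn

end Domain

section Homotopy

variable {A : Type u} [CommRing A] {ι : Type w} [Fintype ι] [DecidableEq ι] {deg : ι → ℕ}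
  {D : Matrix ι ι A} {M : Type v} [AddCommGroup M] [Module A M]

/-- The complex of free modules given by `D` is a resolution of `M` with augmentation `ε`. -/
structure IsMatrixResolution (deg : ι → ℕ) (D : Matrix ι ι A) (ε : (ι → A) →ₗ[A] M) : Prop where
  lowering : IsLowering deg D
  mul_self : D * D = 0
  aug_single : ∀ b, deg b ≠ 0 → ε (Pi.single b 1) = 0
  aug_mulVec : ∀ v, ε (D.mulVec v) = 0
  aug_surjective : ∀ m, ∃ u, D.mulVec u = 0 ∧ ε u = m
  exact : ∀ v, D.mulVec v = 0 → ε v = 0 → ∃ w, D.mulVec w = v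

theorem LinearMap.apply_eq_sum_smul_single (ε : (ι → A) →ₗ[A] M) (v : ι → A) :
    ε v = ∑ b, v b • ε (Pi.single b 1) := by
  conv_lhs => rw [pi_eq_sum_univ' v]
  rw [map_sum]
  exact Finset.sum_congr rfl fun b _ => by rw [← map_smul]

theorem IsMatrixResolution.nullHtpy {ε : (ι → A) →ₗ[A] M} (h : IsMatrixResolution deg D ε)
    {z : A} (hz : ∀ m : M, z • m = 0) : NullHtpy deg D z := by
  have key : ∀ n : ℕ, ∃ H : Matrix ι ι A, IsLowering deg H.transpose ∧
      ∀ a b, deg b < n → (D * H + H * D) a b = (z • (1 : Matrix ι ι A)) a b := by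
    intro n
    induction n with
    | zero => exact ⟨0, fun a b h => absurd rfl h, fun a b h => absurd h (Nat.not_lt_zero _)⟩
    | succ n ih =>
      obtain ⟨H, hH, hHn⟩ := ih
      let V : Matrix ι ι A := z • 1 - H * D
      have hVdeg : ∀ a b, deg a ≠ deg b → V a b = 0 := by
        intro a b hab
        have h1 : (H * D) a b = 0 := by
          rw [Matrix.mul_apply]
          refine Finset.sum_eq_zero fun c _ => ?_
          by_contra hc
          have h2 : deg a = deg c + 1 := hH c a (left_ne_zero_of_mul hc)
          have h3 : deg b = deg c + 1 := h.lowering c b (right_ne_zero_of_mul hc)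
          omega
        have hne : a ≠ b := fun h' => hab (h' ▸ rfl)
        simp [V, h1, Matrix.one_apply_ne hne]
      have hcol : ∀ b, ∃ w : ι → A, deg b = n → D.mulVec w = fun a => V a b := by
        intro b
        by_cases hb : deg b = n
        · have hcycle : D.mulVec (fun a => V a b) = 0 := by
            have hDV : ∀ a, (D * V) a b = 0 := by
              intro a
              have h1 : D * V = ((z • (1 : Matrix ι ι A)) - (D * H + H * D)) * D := by
                simp only [V, mul_sub, sub_mul, add_mul, Matrix.mul_assoc, h.mul_self,
                  Matrix.mul_smul, Matrix.smul_mul, mul_one, one_mul, mul_zero, add_zero]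
              rw [h1, Matrix.mul_apply]
              refine Finset.sum_eq_zero fun c _ => ?_
              by_cases hc : D c b = 0
              · rw [hc, mul_zero]
              · have := h.lowering c b hc
                rw [Matrix.sub_apply, hHn a c (by omega), sub_self, zero_mul]
            funext a
            exact hDV a
          have haug : ε (fun a => V a b) = 0 := by
            rw [LinearMap.apply_eq_sum_smul_single]
            refine Finset.sum_eq_zero fun c _ => ?_
            by_cases hc : deg c = 0
            · by_cases hcb : deg c = deg b
              · have h1 : (H * D) c b = 0 := by
                  rw [Matrix.mul_apply]
                  refine Finset.sum_eq_zero fun e _ => ?_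
                  by_contra he
                  have := h.lowering e b (right_ne_zero_of_mul he)
                  omega
                have hV : V c b = z * (1 : Matrix ι ι A) c b := by simp [V, h1]
                rw [hV, mul_smul, hz]
              · rw [hVdeg c b hcb, zero_smul]
            · rw [h.aug_single c hc, smul_zero]
          obtain ⟨w, hw⟩ := h.exact _ hcycle haug
          exact ⟨w, fun _ => hw⟩
        · exact ⟨0, fun h' => absurd h' hb⟩
      choose W hW using hcol
      let H' : Matrix ι ι A := fun c b =>
        if deg b = n then (if deg c = n + 1 then W b c else 0) else H c b
      have hHD : ∀ a b, deg b ≤ n → (H' * D) a b = (H * D) a b := by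
        intro a b hb
        rw [Matrix.mul_apply, Matrix.mul_apply]
        refine Finset.sum_congr rfl fun c _ => ?_
        by_cases hc : D c b = 0
        · rw [hc, mul_zero, mul_zero]
        · have := h.lowering c b hc
          have h1 : H' a c = H a c := if_neg (by omega)
          rw [h1]
      refine ⟨H', fun a b hab => ?_, fun a b hb => ?_⟩
      · by_cases ha : deg a = n
        · by_contra hcon
          apply hab
          change H' b a = 0
          simp only [H', if_pos ha]
          exact if_neg (by omega)
        · refine hH a b fun h0 => hab ?_
          change H' b a = 0
          simp only [H', if_neg ha]
          exact h0
      · rw [Matrix.add_apply, hHD a b (by omega)]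
        by_cases hbn : deg b = n
        · have h1 : (D * H') a b = V a b := by
            rw [Matrix.mul_apply]
            by_cases hab : deg a = deg b
            · rw [← congrFun (hW b hbn) a]
              refine Finset.sum_congr rfl fun c _ => ?_
              by_cases hc : D a c = 0
              · change D a c * _ = D a c * _
                rw [hc, zero_mul, zero_mul]
              · have := h.lowering a c hc
                simp only [H', if_pos hbn]
                rw [if_pos (by omega)]
            · rw [hVdeg a b hab]
              refine Finset.sum_eq_zero fun c _ => ?_
              by_cases hc : D a c = 0
              · rw [hc, zero_mul]
              · have := h.lowering a c hc
                simp only [H', if_pos hbn]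
                rw [if_neg (by omega), mul_zero]
          rw [h1]
          simp [V]
        · rw [← hHn a b (by omega), Matrix.add_apply, Matrix.mul_apply, Matrix.mul_apply]
          congr 1
          refine Finset.sum_congr rfl fun c _ => ?_
          have h1 : H' c b = H c b := if_neg hbn
          rw [h1]
  obtain ⟨H, hH, hHz⟩ := key (Finset.univ.sup deg + 1)
  refine ⟨H, hH, ?_⟩
  ext a b
  exact hHz a b (Nat.lt_succ_of_le (Finset.le_sup (Finset.mem_univ b)))

end Homotopy

section MinimalResolution

variable (A : Type u) [CommRing A] [IsLocalRing A]

/-- `M` is a nonzero module having a finite minimal free resolution of length `r`. -/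
def HasMinimalResolution : ℕ → ∀ (M : Type u) [AddCommGroup M] [Module A M], Prop
  | 0, M, _, _ => Module.Free A M ∧ Module.Finite A M ∧ Nontrivial M
  | r + 1, M, _, _ => ∃ (n : ℕ) (φ : (Fin n → A) →ₗ[A] M), 0 < n ∧ Function.Surjective φ ∧
      (∀ x ∈ LinearMap.ker φ, ∀ i, x i ∈ maximalIdeal A) ∧
      HasMinimalResolution r (LinearMap.ker φ)

variable {A}

theorem exists_minimal_cover (M : Type u) [AddCommGroup M] [Module A M] [Module.Finite A M]
    [Nontrivial M] : ∃ (n : ℕ) (φ : (Fin n → A) →ₗ[A] M), 0 < n ∧ Function.Surjective φ ∧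
      ∀ x ∈ LinearMap.ker φ, ∀ i, x i ∈ maximalIdeal A := by
  let k := ResidueField A
  let b := Module.finBasis k (k ⊗[A] M)
  choose f hf using fun i =>
    TensorProduct.mk_surjective A M k residue_surjective (b i)
  have hspan := span_eq_top_of_tmul_eq_basis f b hf
  refine ⟨_, Fintype.linearCombination A f, ?_, ?_, fun x hx i => ?_⟩
  · rw [Module.finrank_pos_iff]
    exact not_subsingleton_iff_nontrivial.1 fun h => not_subsingleton M
      (subsingleton_tensorProduct.1 h)
  · rw [← LinearMap.range_eq_top, Fintype.range_linearCombination, hspan]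
  · rw [LinearMap.mem_ker, Fintype.linearCombination_apply] at hx
    have h1 : ∑ j, residue A (x j) • b j = 0 := by
      have h2 := congrArg (fun m : M => (1 : k) ⊗ₜ[A] m) hx
      simp only [TensorProduct.tmul_sum, TensorProduct.tmul_zero, TensorProduct.tmul_smul] at h2
      rw [← h2]
      refine Finset.sum_congr rfl fun j _ => ?_
      rw [← hf j]
      exact algebraMap_smul k (x j) (_ : k ⊗[A] M)
    exact (residue_eq_zero_iff _).1 (Fintype.linearIndependent_iff.1 b.linearIndependent _ h1 i)

theorem HasMinimalResolution.exists_isMatrixResolution {r : ℕ} {M : Type u} [AddCommGroup M]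
    [Module A M] (h : HasMinimalResolution A r M) :
    ∃ (ι : Type) (_ : Fintype ι) (_ : DecidableEq ι) (deg : ι → ℕ) (D : Matrix ι ι A)
      (ε : (ι → A) →ₗ[A] M), IsMatrixResolution deg D ε ∧ (∀ b, deg b ≤ r) ∧
      ∃ a, deg a = 0 ∧ ∀ b, D a b ∈ maximalIdeal A := by
  induction r generalizing M with
  | zero =>
    obtain ⟨h1, h2, h3⟩ := h
    let b := Module.finBasis A M
    refine ⟨Fin (Module.finrank A M), inferInstance, inferInstance, fun _ => 0, 0,
      b.equivFun.symm.toLinearMap, ⟨fun a b h => absurd rfl h, zero_mul 0,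
        fun _ h => absurd rfl h, fun v => ?_, fun m => ⟨b.equivFun m, ?_, ?_⟩, fun v _ hv => ?_⟩,
      fun _ => le_rfl, ⟨b.index_nonempty.some, rfl, fun _ => Ideal.zero_mem _⟩⟩
    · rw [Matrix.zero_mulVec, map_zero]
    · rw [Matrix.zero_mulVec]
    · exact b.equivFun.symm_apply_apply m
    · exact ⟨0, by rw [Matrix.mulVec_zero]; exact ((LinearEquiv.map_eq_zero_iff _).1 hv).symm⟩
  | succ r ih =>
    obtain ⟨n, φ, hn, hφ, hmin, hker⟩ := h
    obtain ⟨ι, _, _, deg, D, ε, hres, hdeg, -⟩ := ih hker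
    let Φ : Matrix (Fin n) ι A := fun i b => (ε (Pi.single b 1)).1 i
    have hΦ : ∀ v, Φ.mulVec v = (ε v).1 := by
      intro v
      rw [LinearMap.apply_eq_sum_smul_single]
      funext i
      simp only [Matrix.mulVec, dotProduct, Φ, Submodule.coe_sum, Finset.sum_apply,
        Submodule.coe_smul, Pi.smul_apply, smul_eq_mul]
      exact Finset.sum_congr rfl fun b _ => mul_comm _ _
    have hΦD : Φ * D = 0 := by
      rw [← Matrix.mulVec_injective.eq_iff]
      funext v
      rw [← Matrix.mulVec_mulVec, hΦ, hres.aug_mulVec, Matrix.zero_mulVec]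
      rfl
    let D' : Matrix (Fin n ⊕ ι) (Fin n ⊕ ι) A := Matrix.fromBlocks 0 Φ 0 D
    have hD' : ∀ v : Fin n ⊕ ι → A,
        D'.mulVec v = Sum.elim ((ε (v ∘ Sum.inr)).1) (D.mulVec (v ∘ Sum.inr)) := by
      intro v
      rw [Matrix.fromBlocks_mulVec, Matrix.zero_mulVec, Matrix.zero_mulVec, zero_add, zero_add, hΦ]
    have hzero : ∀ v, D'.mulVec v = 0 ↔ ε (v ∘ Sum.inr) = 0 ∧ D.mulVec (v ∘ Sum.inr) = 0 := by
      intro v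
      rw [hD']
      constructor
      · intro h
        exact ⟨Subtype.ext (funext fun i => congrFun h (Sum.inl i)),
          funext fun i => congrFun h (Sum.inr i)⟩
      · rintro ⟨h1, h2⟩
        rw [h1, h2]
        funext i
        cases i <;> rfl
    refine ⟨Fin n ⊕ ι, inferInstance, inferInstance, Sum.elim (fun _ => 0) (fun b => deg b + 1), D',
      φ ∘ₗ LinearMap.funLeft A A Sum.inl, ⟨?_, ?_, ?_, ?_, ?_, ?_⟩, ?_, ?_⟩
    · rintro (a | a) (b | b) h
      · exact absurd rfl h
      · by_contra hcon
        refine h ?_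
        have hb : deg b ≠ 0 := fun hb => hcon (by simp [hb])
        change (ε (Pi.single b 1)).1 a = 0
        rw [hres.aug_single b hb]
        rfl
      · exact absurd rfl h
      · simpa using hres.lowering a b h
    · simp [D', Matrix.fromBlocks_multiply, hΦD, hres.mul_self]
    · rintro (b | b) h
      · exact absurd rfl h
      · rw [LinearMap.comp_apply]
        convert map_zero φ
        funext i
        simp [LinearMap.funLeft]
    · intro v
      rw [hD']
      exact (ε (v ∘ Sum.inr)).2
    · intro m
      obtain ⟨x, rfl⟩ := hφ m
      refine ⟨Sum.elim x 0, (hzero _).2 ⟨?_, ?_⟩, ?_⟩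
      · rw [Sum.elim_comp_inr, map_zero]
      · rw [Sum.elim_comp_inr, Matrix.mulVec_zero]
      · rfl
    · intro v hv hεv
      obtain ⟨h1, h2⟩ := (hzero v).1 hv
      obtain ⟨w, hw⟩ := hres.exact _ h2 h1
      obtain ⟨t, ht, htε⟩ := hres.aug_surjective ((⟨v ∘ Sum.inl, hεv⟩ : LinearMap.ker φ) - ε w)
      refine ⟨Sum.elim 0 (w + t), ?_⟩
      rw [hD', Sum.elim_comp_inr, map_add, htε, Matrix.mulVec_add, ht, hw, add_zero,
        add_sub_cancel]
      exact Sum.elim_comp_inl_inr v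
    · rintro (b | b)
      · exact Nat.zero_le _
      · exact Nat.succ_le_succ (hdeg b)
    · refine ⟨Sum.inl ⟨0, hn⟩, rfl, ?_⟩
      rintro (b | b)
      · exact Ideal.zero_mem _
      · exact hmin _ (ε (Pi.single b 1)).2 _

end MinimalResolution

section Support

variable {A : Type u} [CommRing A]

theorem Module.mem_support_tensorProduct {M : Type v} {N : Type w} [AddCommGroup M] [Module A M]
    [AddCommGroup N] [Module A N] [Module.Finite A M] [Module.Finite A N] {p : PrimeSpectrum A}
    (hM : p ∈ Module.support A M) (hN : p ∈ Module.support A N) :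
    p ∈ Module.support A (M ⊗[A] N) := by
  rw [Module.mem_support_iff_nontrivial_residueField_tensorProduct] at hM hN ⊢
  let K := p.asIdeal.ResidueField
  have e := TensorProduct.AlgebraTensorModule.distribBaseChange A K M N
  have : Nontrivial ((K ⊗[A] M) ⊗[K] (K ⊗[A] N)) :=
    (Module.FaithfullyFlat.nontrivial_tensorProduct_iff_right K _).2 hN
  exact e.toEquiv.nontrivial

theorem HasMinimalResolution.finite [IsLocalRing A] {r : ℕ} {M : Type u} [AddCommGroup M]
    [Module A M] (h : HasMinimalResolution A r M) : Module.Finite A M := by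
  cases r with
  | zero => exact h.2.1
  | succ r =>
    obtain ⟨n, φ, -, hφ, -⟩ := h
    exact Module.Finite.of_surjective φ hφ

/-- The intersection theorem for a module of finite projective dimension. -/
theorem supportDim_le_supportDim_tensorProduct_add [IsNoetherianRing A] [IsLocalRing A] {r : ℕ}
    {M N : Type u} [AddCommGroup M] [Module A M] [AddCommGroup N] [Module A N]
    [Module.Finite A N] (h : HasMinimalResolution A r M) :
    Module.supportDim A N ≤ Module.supportDim A (M ⊗[A] N) + r := by
  have hfin := h.finite
  obtain ⟨ι, _, _, deg, D, ε, hres, hdeg, a, ha, haD⟩ := h.exists_isMatrixResolution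
  refine iSup_le fun l => ?_
  have hl : (l.length : WithBot ℕ∞) ≤ Module.supportDim A N :=
    le_iSup (fun l : LTSeries (Module.support A N) => (l.length : WithBot ℕ∞)) l
  obtain ⟨P, hP, hlP⟩ := exists_mem_support_le_supportDim_quotient hl
  rw [Module.supportDim_quotient_eq_ringKrullDim] at hlP
  refine hlP.trans ?_
  let B := A ⧸ P.asIdeal
  have hsurj : Function.Surjective (Ideal.Quotient.mk P.asIdeal) := Ideal.Quotient.mk_surjective
  have : IsLocalRing B := IsLocalRing.of_surjective' (Ideal.Quotient.mk P.asIdeal) hsurj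
  have hloc : IsLocalHom (Ideal.Quotient.mk P.asIdeal) := IsLocalHom.of_surjective _ hsurj
  have key := ringKrullDim_le_ringKrullDim_quotient_add
    (hres.lowering.map (Ideal.Quotient.mk P.asIdeal)) (map_mul_self_eq_zero hres.mul_self _) hdeg ha
    (fun b hu => haD b (isUnit_of_map_unit (Ideal.Quotient.mk P.asIdeal) _ hu))
  refine key.trans (add_le_add_left ?_ _)
  let J := nullHtpyIdeal deg (D.map (Ideal.Quotient.mk P.asIdeal))
  let π : A →+* B ⧸ J := (Ideal.Quotient.mk J).comp (Ideal.Quotient.mk P.asIdeal)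
  have hπ : Function.Surjective π := Ideal.Quotient.mk_surjective.comp hsurj
  have hmem : ∀ q : PrimeSpectrum (B ⧸ J),
      PrimeSpectrum.comap π q ∈ Module.support A (M ⊗[A] N) := by
    intro q
    refine Module.mem_support_tensorProduct ?_ ?_
    · rw [Module.mem_support_iff_of_finite]
      intro z hz
      have hzJ : Ideal.Quotient.mk P.asIdeal z ∈ J :=
        (hres.nullHtpy fun m => Module.mem_annihilator.1 hz m).map _
      have h0 : π z = 0 := Ideal.Quotient.eq_zero_iff_mem.2 hzJ
      change π z ∈ q.asIdeal
      rw [h0]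
      exact q.asIdeal.zero_mem
    · rw [Module.mem_support_iff_of_finite] at hP ⊢
      intro z hz
      have h0 : π z = 0 := by
        change Ideal.Quotient.mk J (Ideal.Quotient.mk P.asIdeal z) = 0
        rw [Ideal.Quotient.eq_zero_iff_mem.2 (hP hz), map_zero]
      change π z ∈ q.asIdeal
      rw [h0]
      exact q.asIdeal.zero_mem
  exact Order.krullDim_le_of_strictMono
    (fun q : PrimeSpectrum (B ⧸ J) => (⟨PrimeSpectrum.comap π q, hmem q⟩ :
      Module.support A (M ⊗[A] N)))
    fun q q' hqq => RingHom.strictMono_comap_of_surjective hπ hqq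

end Support

section ProjDim

variable {A : Type u} [CommRing A]

theorem CategoryTheory.ProjectiveResolution.exists_d_comp_eq_of_isZero_ext {X : ModuleCat.{u} A}
    (P : ProjectiveResolution X) {n : ℕ} {Y : ModuleCat.{u} A}
    (h : Limits.IsZero (((Ext A (ModuleCat.{u} A) (n + 1)).obj (Opposite.op X)).obj Y))
    (f : P.complex.X (n + 1) ⟶ Y) (hf : P.complex.d (n + 2) (n + 1) ≫ f = 0) :
    ∃ g : P.complex.X n ⟶ Y, P.complex.d (n + 1) n ≫ g = f := by
  have h1 := h.of_iso (P.isoExt (R := A) (n + 1) Y).symm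
  rw [← HomologicalComplex.exactAt_iff_isZero_homology,
    HomologicalComplex.exactAt_iff' _ n (n + 1) (n + 2) (by simp) (by simp),
    ShortComplex.moduleCat_exact_iff] at h1
  obtain ⟨g, hg⟩ := h1 f hf
  exact ⟨g, hg⟩

theorem hasProjectiveDimensionLT_of_isZero_ext {X : ModuleCat.{u} A} {d : ℕ}
    (h : ∀ i : ℕ, d < i → ∀ Y : ModuleCat.{u} A,
      Limits.IsZero (((Ext A (ModuleCat.{u} A) i).obj (Opposite.op X)).obj Y)) :
    HasProjectiveDimensionLT X (d + 1) := by
  let P := ProjectiveResolution.of X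
  rw [hasProjectiveDimensionLT_iff]
  rintro (_ | i) hi Y e
  · omega
  · obtain ⟨f, hf, rfl⟩ := P.extMk_surjective e (i + 2) rfl
    rw [P.extMk_eq_zero_iff _ _ _ _ i rfl]
    exact P.exists_d_comp_eq_of_isZero_ext (h (i + 1) (by omega) Y) f hf

theorem HasMinimalResolution.exists_of_hasProjectiveDimensionLT [IsNoetherianRing A]
    [IsLocalRing A] {d : ℕ} {M : Type u} [AddCommGroup M] [Module A M] [Module.Finite A M]
    [Nontrivial M] (h : HasProjectiveDimensionLT (ModuleCat.of A M) (d + 1)) :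
    ∃ r, HasMinimalResolution A r M := by
  induction d generalizing M with
  | zero =>
    have hproj : Projective (ModuleCat.of A M) :=
      projective_iff_hasProjectiveDimensionLT_one.2 h
    have : Module.Projective A M := (IsProjective.iff_projective M).2 hproj
    exact ⟨0, Module.free_of_flat_of_isLocalRing, inferInstance, inferInstance⟩
  | succ d ih =>
    obtain ⟨n, φ, hn, hφ, hmin⟩ := exists_minimal_cover (A := A) M
    by_cases hker : Nontrivial (LinearMap.ker φ)
    · have hfree : Projective φ.shortComplexKer.X₂ :=
        (IsProjective.iff_projective (Fin n → A)).1 inferInstance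
      have : HasProjectiveDimensionLT (ModuleCat.of A (LinearMap.ker φ)) (d + 1) :=
        ((LinearMap.shortExact_shortComplexKer hφ).hasProjectiveDimensionLT_X₃_iff d hfree).1 h
      obtain ⟨r, hr⟩ := ih this
      exact ⟨r + 1, n, φ, hn, hφ, hmin, hr⟩
    · rw [not_nontrivial_iff_subsingleton, Submodule.subsingleton_iff_eq_bot,
        LinearMap.ker_eq_bot] at hker
      have : Module.Free A M := Module.Free.of_equiv (LinearEquiv.ofBijective φ ⟨hker, hφ⟩)
      exact ⟨0, this, inferInstance, inferInstance⟩

end ProjDim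

section Tor

variable {A : Type u} [CommRing A]

/-- If the first maps are exact after tensoring with `M` and the second ones after tensoring with
`F`, then a kernel element of `F → M` tensored up which dies in `F ⊗ Q₀` is a boundary. -/
theorem exists_lTensor_ker_eq {F M Q₀ Q₁ Q₂ Q₃ : Type u} [AddCommGroup F] [Module A F]
    [AddCommGroup M] [Module A M] [AddCommGroup Q₀] [Module A Q₀] [AddCommGroup Q₁] [Module A Q₁]
    [AddCommGroup Q₂] [Module A Q₂] [AddCommGroup Q₃] [Module A Q₃] {φ : F →ₗ[A] M}
    (hφ : Function.Surjective φ) {d₁ : Q₁ →ₗ[A] Q₀} {d₂ : Q₂ →ₗ[A] Q₁} {d₃ : Q₃ →ₗ[A] Q₂}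
    (hd : d₂ ∘ₗ d₃ = 0)
    (hF : Function.Exact (d₂.lTensor F) (d₁.lTensor F))
    (hM : Function.Exact (d₃.lTensor M) (d₂.lTensor M))
    (hinj : Function.Injective ((LinearMap.ker φ).subtype.rTensor Q₁))
    {x : LinearMap.ker φ ⊗[A] Q₁}
    (hx : d₁.lTensor F ((LinearMap.ker φ).subtype.rTensor Q₁ x) = 0) :
    ∃ x', d₂.lTensor (LinearMap.ker φ) x' = x := by
  have hex : Function.Exact (LinearMap.ker φ).subtype φ := LinearMap.exact_subtype_ker_map φ
  have comm : ∀ {Q Q' : Type u} [AddCommGroup Q] [Module A Q] [AddCommGroup Q'] [Module A Q']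
      {F' M' : Type u} [AddCommGroup F'] [Module A F'] [AddCommGroup M'] [Module A M']
      (ψ : F' →ₗ[A] M') (d : Q →ₗ[A] Q') (t : F' ⊗[A] Q),
      d.lTensor M' (ψ.rTensor Q t) = ψ.rTensor Q' (d.lTensor F' t) := by
    intros
    rw [← LinearMap.comp_apply, ← LinearMap.comp_apply, LinearMap.rTensor_comp_lTensor,
      LinearMap.lTensor_comp_rTensor]
  obtain ⟨y, hy⟩ := (hF _).1 hx
  have hy0 : d₂.lTensor M (φ.rTensor Q₂ y) = 0 := by
    rw [comm, hy]
    exact (rTensor_exact Q₁ hex hφ _).2 ⟨x, rfl⟩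
  obtain ⟨w', hw'⟩ := (hM _).1 hy0
  obtain ⟨w, rfl⟩ := LinearMap.rTensor_surjective Q₃ hφ w'
  have hker : φ.rTensor Q₂ (y - d₃.lTensor F w) = 0 := by
    rw [map_sub, ← comm, hw', sub_self]
  obtain ⟨x', hx'⟩ := (rTensor_exact Q₂ hex hφ _).1 hker
  refine ⟨x', hinj ?_⟩
  rw [← comm, hx', map_sub, hy, ← LinearMap.comp_apply, ← LinearMap.lTensor_comp, hd,
    LinearMap.lTensor_zero, LinearMap.zero_apply, sub_zero]

/-- The homology in positive degrees of `M ⊗ P` vanishes. -/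
def IsTorAcyclic (M : Type u) [AddCommGroup M] [Module A M] {N : ModuleCat.{u} A}
    (P : ProjectiveResolution N) : Prop :=
  ∀ i, Function.Exact (LinearMap.lTensor M (P.complex.d (i + 2) (i + 1)).hom)
    (LinearMap.lTensor M (P.complex.d (i + 1) i).hom)

variable {M : Type u} [AddCommGroup M] [Module A M] {N : ModuleCat.{u} A}
  (P : ProjectiveResolution N)

theorem isTorAcyclic_of_isZero_tor
    (h : ∀ i, Limits.IsZero (((Tor (ModuleCat.{u} A) (i + 1)).obj (ModuleCat.of A M)).obj N)) :
    IsTorAcyclic M P := by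
  intro i
  have h1 := (h i).of_iso (P.isoLeftDerivedObj
    ((MonoidalCategory.tensoringLeft (ModuleCat.{u} A)).obj (ModuleCat.of A M)) (i + 1)).symm
  have h2 := (HomologicalComplex.exactAt_iff_isZero_homology _ _).2 h1
  rw [HomologicalComplex.exactAt_iff' _ (i + 2) (i + 1) i (by simp) (by simp),
    ShortComplex.ShortExact.moduleCat_exact_iff_function_exact] at h2
  exact h2

theorem CategoryTheory.ProjectiveResolution.exact_d (i : ℕ) :
    Function.Exact (P.complex.d (i + 2) (i + 1)).hom (P.complex.d (i + 1) i).hom :=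
  (ShortComplex.ShortExact.moduleCat_exact_iff_function_exact _).1 (P.exact_succ i)

theorem CategoryTheory.ProjectiveResolution.flat (i : ℕ) : Module.Flat A (P.complex.X i) := by
  have : Module.Projective A (P.complex.X i) :=
    (IsProjective.iff_projective (P.complex.X i)).2 (P.projective i)
  infer_instance

variable {P} {F : Type u} [AddCommGroup F] [Module A F] {φ : F →ₗ[A] M}

theorem IsTorAcyclic.ker [Module.Flat A F] (h : IsTorAcyclic M P) (hφ : Function.Surjective φ) :
    IsTorAcyclic (LinearMap.ker φ) P := by
  intro i x
  have := P.flat (i + 1)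
  have hinj : Function.Injective ((LinearMap.ker φ).subtype.rTensor (P.complex.X (i + 1))) :=
    Module.Flat.rTensor_preserves_injective_linearMap _ (Submodule.subtype_injective _)
  constructor
  · intro hx
    refine exists_lTensor_ker_eq hφ (P.exact_d (i + 1)).linearMap_comp_eq_zero
      (Module.Flat.lTensor_exact F (P.exact_d i)) (h (i + 1)) hinj ?_
    rw [← LinearMap.comp_apply, LinearMap.lTensor_comp_rTensor, ← LinearMap.rTensor_comp_lTensor,
      LinearMap.comp_apply, hx, map_zero]
  · rintro ⟨y, rfl⟩
    rw [← LinearMap.comp_apply, ← LinearMap.lTensor_comp, (P.exact_d i).linearMap_comp_eq_zero,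
      LinearMap.lTensor_zero, LinearMap.zero_apply]

theorem IsTorAcyclic.rTensor_injective [Module.Flat A F] (h : IsTorAcyclic M P)
    (hφ : Function.Surjective φ) :
    Function.Injective ((LinearMap.ker φ).subtype.rTensor N) := by
  have := P.flat 0
  have hinj : Function.Injective ((LinearMap.ker φ).subtype.rTensor (P.complex.X 0)) :=
    Module.Flat.rTensor_preserves_injective_linearMap _ (Submodule.subtype_injective _)
  let g : P.complex.X 0 →ₗ[A] N := (P.π.f 0).hom
  have hg : Function.Surjective g := by
    exact (ModuleCat.epi_iff_surjective (P.π.f 0)).1 inferInstance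
  have hex : Function.Exact (P.complex.d 1 0).hom g :=
    (ShortComplex.ShortExact.moduleCat_exact_iff_function_exact _).1 P.exact₀
  rw [injective_iff_map_eq_zero]
  intro t ht
  obtain ⟨x, rfl⟩ := LinearMap.lTensor_surjective (LinearMap.ker φ) hg t
  obtain ⟨x', rfl⟩ := exists_lTensor_ker_eq hφ (P.exact_d 0).linearMap_comp_eq_zero
    (Module.Flat.lTensor_exact F hex) (h 0) hinj (x := x) (by
      rw [← LinearMap.comp_apply, LinearMap.lTensor_comp_rTensor,
        ← LinearMap.rTensor_comp_lTensor, LinearMap.comp_apply, ht])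
  rw [← LinearMap.comp_apply, ← LinearMap.lTensor_comp, hex.linearMap_comp_eq_zero,
    LinearMap.lTensor_zero, LinearMap.zero_apply]

end Tor

section ExtMap

variable {A : Type u} [CommRing A] (k : ModuleCat.{u} A) (i : ℕ)
variable {X Y Z : Type u} [AddCommGroup X] [Module A X] [AddCommGroup Y] [Module A Y]
  [AddCommGroup Z] [Module A Z]

/-- The map on `Ext^i(k, -)` induced by a linear map, as a linear function of that map. -/
def extMap : (X →ₗ[A] Y) →ₗ[A] (Abelian.Ext k (ModuleCat.of A X) i →ₗ[A]
    Abelian.Ext k (ModuleCat.of A Y) i) :=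
  LinearMap.mk₂ A (fun f e => e.comp (Abelian.Ext.mk₀ (ModuleCat.ofHom f)) (add_zero i))
    (fun f g e => by rw [ModuleCat.ofHom_add, Abelian.Ext.mk₀_add, Abelian.Ext.comp_add])
    (fun c f e => by
      rw [show ModuleCat.ofHom (c • f) = c • ModuleCat.ofHom f from rfl, Abelian.Ext.mk₀_smul,
        Abelian.Ext.comp_smul])
    (fun f e e' => by rw [Abelian.Ext.add_comp])
    (fun c f e => by rw [Abelian.Ext.smul_comp])

theorem extMap_apply (f : X →ₗ[A] Y) (e : Abelian.Ext k (ModuleCat.of A X) i) :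
    extMap k i f e = e.comp (Abelian.Ext.mk₀ (ModuleCat.ofHom f)) (add_zero i) := rfl

theorem extMap_id (e : Abelian.Ext k (ModuleCat.of A X) i) :
    extMap k i LinearMap.id e = e := by
  rw [extMap_apply, ModuleCat.ofHom_id, Abelian.Ext.comp_mk₀_id]

theorem extMap_comp (g : Y →ₗ[A] Z) (f : X →ₗ[A] Y) (e : Abelian.Ext k (ModuleCat.of A X) i) :
    extMap k i (g ∘ₗ f) e = extMap k i g (extMap k i f e) := by
  simp only [extMap_apply, ModuleCat.ofHom_comp, ← Abelian.Ext.mk₀_comp_mk₀,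
    Abelian.Ext.comp_assoc_of_third_deg_zero]

variable {k i}

theorem smul_ext_eq_zero_of_mem_annihilator {a : A} (ha : a ∈ Module.annihilator A k)
    (e : Abelian.Ext k (ModuleCat.of A X) i) : a • e = 0 := by
  have h : a • 𝟙 k = 0 := by
    simp [← ModuleCat.lsmul_eq_smul_id, Module.mem_annihilator_iff_lsmul_eq_zero.mp ha]
  have h' : a • e = (Abelian.Ext.mk₀ (a • 𝟙 k)).comp e (zero_add i) := by
    simp [Abelian.Ext.mk₀_smul]
  rw [h', h, Abelian.Ext.mk₀_zero, Abelian.Ext.zero_comp]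

theorem subsingleton_ext_of_retract {f : X →ₗ[A] Y} {g : Y →ₗ[A] X} (h : g ∘ₗ f = LinearMap.id)
    (hY : Subsingleton (Abelian.Ext k (ModuleCat.of A Y) i)) :
    Subsingleton (Abelian.Ext k (ModuleCat.of A X) i) := by
  refine subsingleton_of_forall_eq 0 fun e => ?_
  rw [← extMap_id k i e, ← h, extMap_comp, Subsingleton.elim (extMap k i f e) 0, map_zero]

theorem extMap_injective_of_exact {f : X →ₗ[A] Y} {g : Y →ₗ[A] Z} (hf : Function.Injective f)
    (hfg : Function.Exact f g) (hg : Function.Surjective g)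
    (hZ : ∀ j, j + 1 = i → Subsingleton (Abelian.Ext k (ModuleCat.of A Z) j)) :
    Function.Injective (extMap k i f) := by
  let S : ShortComplex (ModuleCat.{u} A) := ShortComplex.mk (ModuleCat.ofHom f) (ModuleCat.ofHom g)
    (by rw [← ModuleCat.ofHom_comp, hfg.linearMap_comp_eq_zero]; rfl)
  have hS : S.ShortExact := ModuleCat.shortComplex_shortExact S hfg hf hg
  rw [injective_iff_map_eq_zero]
  intro e he
  cases i with
  | zero =>
    have : Mono S.f := hS.mono_f
    exact Abelian.Ext.postcomp_mk₀_injective_of_mono k S.f (by rw [map_zero]; exact he)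
  | succ j =>
    have := hZ j rfl
    obtain ⟨y, rfl⟩ := Abelian.Ext.covariant_sequence_exact₁ k hS e he rfl
    rw [Subsingleton.elim (α := Abelian.Ext k (ModuleCat.of A Z) j) y 0]
    exact Abelian.Ext.zero_comp k j _ _ _

end ExtMap

section Tensor

variable {A : Type u} [CommRing A] {k : ModuleCat.{u} A} {i : ℕ}
variable {M F N : Type u} [AddCommGroup M] [Module A M] [AddCommGroup F] [Module A F]
  [AddCommGroup N] [Module A N]

theorem rTensor_smulRight (f : M →ₗ[A] A) (x : F) :
    (f.smulRight x).rTensor N = TensorProduct.mk A F N x ∘ₗ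
      (TensorProduct.lid A N).toLinearMap ∘ₗ f.rTensor N := by
  ext m n
  simp [TensorProduct.smul_tmul']

theorem subsingleton_ext_of_free_tensorProduct [Module.Free A M] [Nontrivial M]
    (h : Subsingleton (Abelian.Ext k (ModuleCat.of A (M ⊗[A] N)) i)) :
    Subsingleton (Abelian.Ext k (ModuleCat.of A N) i) := by
  let b := Module.Free.chooseBasis A M
  obtain ⟨j⟩ := b.index_nonempty
  refine subsingleton_ext_of_retract (f := TensorProduct.mk A M N (b j))
    (g := (TensorProduct.lid A N).toLinearMap ∘ₗ (b.coord j).rTensor N) ?_ h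
  ext n
  simp

theorem subsingleton_ext_free_tensorProduct [Module.Free A M] [Module.Finite A M]
    (h : Subsingleton (Abelian.Ext k (ModuleCat.of A N) i)) :
    Subsingleton (Abelian.Ext k (ModuleCat.of A (M ⊗[A] N)) i) := by
  classical
  let b := Module.Free.chooseBasis A M
  have hid : (LinearMap.id : M →ₗ[A] M) = ∑ j, (b.coord j).smulRight (b j) := by
    refine LinearMap.ext fun x => ?_
    simp [LinearMap.sum_apply, b.sum_repr]
  refine subsingleton_of_forall_eq 0 fun e => ?_
  rw [← extMap_id k i e, ← LinearMap.rTensor_id, hid, ← LinearMap.coe_rTensorHom, map_sum, map_sum,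
    LinearMap.sum_apply]
  refine Finset.sum_eq_zero fun j _ => ?_
  rw [LinearMap.coe_rTensorHom, rTensor_smulRight, extMap_comp,
    Subsingleton.elim (extMap k i _ e) 0, map_zero]

theorem extMap_rTensor_eq_zero [Module.Free A M] [Module.Finite A M] {n : ℕ}
    {ψ : M →ₗ[A] (Fin n → A)} (hψ : ∀ x l, ψ x l ∈ Module.annihilator A k) :
    extMap k i (ψ.rTensor N) = 0 := by
  classical
  let b := Module.Free.chooseBasis A M
  have hid : ψ = ∑ j, ∑ l, ψ (b j) l • (b.coord j).smulRight (Pi.single l (1 : A)) := by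
    refine b.ext fun j => funext fun l => ?_
    rw [LinearMap.sum_apply, Finset.sum_eq_single j]
    · simp [LinearMap.sum_apply, Finset.sum_apply, Pi.single_apply]
    · intro c _ hc
      simp [LinearMap.sum_apply, hc.symm]
    · simp
  ext e
  rw [hid, ← LinearMap.coe_rTensorHom]
  simp only [map_sum, map_smul, LinearMap.sum_apply, LinearMap.smul_apply, LinearMap.zero_apply]
  exact Finset.sum_eq_zero fun j _ => Finset.sum_eq_zero fun l _ =>
    smul_ext_eq_zero_of_mem_annihilator (hψ _ _) _

theorem extMap_rTensor_injective {K : Type u} [AddCommGroup K] [Module A K] {ι : K →ₗ[A] F}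
    {φ : F →ₗ[A] M} (hι : Function.Injective (ι.rTensor N)) (hex : Function.Exact ι φ)
    (hφ : Function.Surjective φ)
    (h : ∀ j, j + 1 = i → Subsingleton (Abelian.Ext k (ModuleCat.of A (M ⊗[A] N)) j)) :
    Function.Injective (extMap k i (ι.rTensor N)) :=
  extMap_injective_of_exact (f := ι.rTensor N) (g := φ.rTensor N) hι (rTensor_exact N hex hφ)
    (LinearMap.rTensor_surjective N hφ) h

theorem subsingleton_ext_of_minimal_cover {K : Type u} [AddCommGroup K] [Module A K] {n r s : ℕ}
    {ι : K →ₗ[A] (Fin n → A)} {φ : (Fin n → A) →ₗ[A] M} (hι : Function.Injective (ι.rTensor N))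
    (hex : Function.Exact ι φ) (hφ : Function.Surjective φ)
    (hmin : ∀ x l, ι x l ∈ Module.annihilator A k)
    (hfree : r = 0 → Module.Free A K ∧ Module.Finite A K ∧ Nontrivial K)
    (hs : ∀ i < s, Subsingleton (Abelian.Ext k (ModuleCat.of A (M ⊗[A] N)) i))
    (ih : ∀ t, (∀ i < t, Subsingleton (Abelian.Ext k (ModuleCat.of A (K ⊗[A] N)) i)) →
      ∀ i < t + r, Subsingleton (Abelian.Ext k (ModuleCat.of A N) i)) :
    ∀ i < s + (r + 1), Subsingleton (Abelian.Ext k (ModuleCat.of A N) i) := by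
  have hinj : ∀ i ≤ s, Function.Injective (extMap k i (ι.rTensor N)) := fun i hi =>
    extMap_rTensor_injective hι hex hφ fun j hj => hs j (by omega)
  have hK : ∀ i ≤ s, Subsingleton (Abelian.Ext k (ModuleCat.of A N) i) →
      Subsingleton (Abelian.Ext k (ModuleCat.of A (K ⊗[A] N)) i) := by
    intro i hi h
    have := subsingleton_ext_free_tensorProduct (M := Fin n → A) h
    exact (hinj i hi).subsingleton
  have hN : ∀ j ≤ s + 1, ∀ i < j, Subsingleton (Abelian.Ext k (ModuleCat.of A N) i) := by
    intro j
    induction j with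
    | zero => exact fun _ i hi => absurd hi (Nat.not_lt_zero i)
    | succ j ihj =>
      intro hj i hi
      have hlt := ihj (by omega)
      rcases Nat.lt_succ_iff_lt_or_eq.1 hi with hi | rfl
      · exact hlt i hi
      rcases Nat.eq_zero_or_pos r with hr | hr
      · obtain ⟨_, _, _⟩ := hfree hr
        refine subsingleton_ext_of_free_tensorProduct (M := K) ?_
        refine subsingleton_of_forall_eq 0 fun e => hinj i (by omega) ?_
        rw [extMap_rTensor_eq_zero hmin, LinearMap.zero_apply, LinearMap.zero_apply]
      · exact ih i (fun i' hi' => hK i' (by omega) (hlt i' hi')) i (by omega)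
  have hlast := ih (s + 1) fun i hi => hK i (by omega) (hN _ le_rfl i hi)
  exact fun i hi => hlast i (by omega)

variable [IsLocalRing A] {P : ProjectiveResolution (ModuleCat.of A N)}

theorem HasMinimalResolution.subsingleton_ext {r : ℕ}
    (hk : maximalIdeal A ≤ Module.annihilator A k) {s : ℕ}
    (h : HasMinimalResolution A r M) (hP : IsTorAcyclic M P)
    (hs : ∀ i < s, Subsingleton (Abelian.Ext k (ModuleCat.of A (M ⊗[A] N)) i)) :
    ∀ i < s + r, Subsingleton (Abelian.Ext k (ModuleCat.of A N) i) := by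
  induction r generalizing M s with
  | zero =>
    obtain ⟨_, _, _⟩ := h
    exact fun i hi => subsingleton_ext_of_free_tensorProduct (hs i hi)
  | succ r ih =>
    obtain ⟨n, φ, -, hφ, hmin, hres⟩ := h
    have hPinj : Function.Injective ((LinearMap.ker φ).subtype.rTensor N) :=
      hP.rTensor_injective hφ
    refine subsingleton_ext_of_minimal_cover hPinj (LinearMap.exact_subtype_ker_map φ) hφ
      (fun x l => hk (hmin x x.2 l)) ?_ hs fun t ht => ih hres (hP.ker hφ) ht
    rintro rfl
    exact hres

end Tensor

section Depth

variable {A : Type u} [CommRing A] [IsNoetherianRing A] [IsLocalRing A]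
variable {M N : Type u} [AddCommGroup M] [Module A M] [AddCommGroup N] [Module A N]

theorem maximalIdeal_smul_top_lt_top [Module.Finite A N] [Nontrivial N] :
    maximalIdeal A • (⊤ : Submodule A N) < ⊤ := by
  refine lt_top_iff_ne_top.2 fun h => ?_
  exact top_ne_bot (Submodule.eq_bot_of_le_smul_of_le_jacobson_bot (maximalIdeal A)
    (⊤ : Submodule A N) Module.Finite.fg_top h.ge (maximalIdeal_le_jacobson _))

theorem exists_isRegular_iff_subsingleton_ext [Module.Finite A N] [Nontrivial N] (n : ℕ) :
    (∃ rs : List A, rs.length = n ∧ (∀ r ∈ rs, r ∈ maximalIdeal A) ∧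
      RingTheory.Sequence.IsRegular N rs) ↔
    ∀ i < n, Subsingleton (Abelian.Ext (ModuleCat.of A (Shrink.{u} (A ⧸ maximalIdeal A)))
      (ModuleCat.of A N) i) :=
  (ModuleCat.exists_isRegular_tfae (maximalIdeal A) n (ModuleCat.of A N)
    maximalIdeal_smul_top_lt_top).out 3 1

theorem nontrivial_tensorProduct_of_isLocalRing [Module.Finite A M] [Nontrivial M]
    [Module.Finite A N] [Nontrivial N] : Nontrivial (M ⊗[A] N) := by
  rw [← Module.nonempty_support_iff (R := A)]
  exact ⟨closedPoint A, Module.mem_support_tensorProduct (closedPoint_mem_support A M)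
    (closedPoint_mem_support A N)⟩

theorem HasMinimalResolution.localDepth_tensorProduct_add_le {r : ℕ}
    [Module.Finite A M] [Nontrivial M] [Module.Finite A N] [Nontrivial N]
    {P : ProjectiveResolution (ModuleCat.of A N)}
    (h : HasMinimalResolution A r M) (hP : IsTorAcyclic M P) :
    localDepth A (M ⊗[A] N) + r ≤ localDepth A N := by
  have := nontrivial_tensorProduct_of_isLocalRing (A := A) (M := M) (N := N)
  have hk : maximalIdeal A ≤
      Module.annihilator A (ModuleCat.of A (Shrink.{u} (A ⧸ maximalIdeal A))) := by
    have : Module.annihilator A (Shrink.{u} (A ⧸ maximalIdeal A)) = maximalIdeal A := by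
      rw [(Shrink.linearEquiv A (A ⧸ maximalIdeal A)).annihilator_eq, Ideal.annihilator_quotient]
    exact this.ge
  have hne : ({n : ℕ∞ | ∃ rs : List A, (rs.length : ℕ∞) = n ∧ (∀ r ∈ rs, r ∈ maximalIdeal A) ∧
      RingTheory.Sequence.IsRegular (M ⊗[A] N) rs}).Nonempty :=
    ⟨0, [], rfl, by simp, RingTheory.Sequence.IsRegular.nil A _⟩
  rw [localDepth, idealDepth, ENat.sSup_add hne]
  refine iSup₂_le ?_
  rintro _ ⟨rs, rfl, hrs, hreg⟩
  obtain ⟨rs', hlen, hrs', hreg'⟩ := (exists_isRegular_iff_subsingleton_ext (N := N) _).2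
    (h.subsingleton_ext hk hP ((exists_isRegular_iff_subsingleton_ext _).1 ⟨rs, rfl, hrs, hreg⟩))
  refine le_sSup ⟨rs', ?_, hrs', hreg'⟩
  rw [hlen, Nat.cast_add]

theorem HasMinimalResolution.isLocalACM {r : ℕ}
    [Module.Finite A M] [Nontrivial M] [Module.Finite A N] [Nontrivial N]
    {P : ProjectiveResolution (ModuleCat.of A N)}
    (h : HasMinimalResolution A r M) (hP : IsTorAcyclic M P) (hMN : IsLocalACM A (M ⊗[A] N)) :
    IsLocalACM A N := by
  have h1 : supportDim A N ≤ supportDim A (M ⊗[A] N) + r :=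
    supportDim_le_supportDim_tensorProduct_add h
  have h2 : (localDepth A (M ⊗[A] N) : WithBot ℕ∞) + r ≤ localDepth A N := by
    exact_mod_cast h.localDepth_tensorProduct_add_le hP
  calc supportDim A N ≤ supportDim A (M ⊗[A] N) + r := h1
    _ ≤ (localDepth A (M ⊗[A] N) : WithBot ℕ∞) + 1 + r := by gcongr; exact hMN
    _ = (localDepth A (M ⊗[A] N) : WithBot ℕ∞) + r + 1 := add_right_comm _ _ _
    _ ≤ localDepth A N + 1 := by gcongr

theorem IsLocalACM.of_linearEquiv (e : M ≃ₗ[A] N) (h : IsLocalACM A M) : IsLocalACM A N := by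
  have h1 : supportDim A N = supportDim A M := by
    rw [supportDim, supportDim, e.support_eq]
  have h2 : localDepth A N = localDepth A M := by
    simp only [localDepth, idealDepth, e.isRegular_congr]
  rw [IsLocalACM, h1, h2]
  exact h

theorem exists_hasMinimalResolution_of_projDim_ne_top [Module.Finite A M] [Nontrivial M]
    (h : projDim A M ≠ ⊤) : ∃ r, HasMinimalResolution A r M := by
  obtain ⟨_, ⟨d, rfl, hd⟩⟩ : {n : ℕ∞ | ∃ d : ℕ, n = d ∧ ∀ i : ℕ, d < i → ∀ Y : ModuleCat.{u} A,
      Subsingleton (((Ext A (ModuleCat.{u} A) i).obj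
        (Opposite.op (ModuleCat.of A M))).obj Y)}.Nonempty := by
    by_contra hempty
    rw [Set.not_nonempty_iff_eq_empty] at hempty
    exact h (by rw [projDim, hempty, sInf_empty])
  exact HasMinimalResolution.exists_of_hasProjectiveDimensionLT
    (hasProjectiveDimensionLT_of_isZero_ext fun i hi Y =>
      have := hd i hi Y
      ModuleCat.isZero_of_subsingleton _)

end Depth

theorem almostCM_of_tensor_almostCM_finite_projDim
    (A : Type u) [CommRing A] [IsNoetherianRing A] [IsLocalRing A] :
    (∀ (M N : Type u) [AddCommGroup M] [Module A M] [AddCommGroup N] [Module A N],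
      Module.Finite A M → Nontrivial M → Module.Finite A N → Nontrivial N →
      (∀ i : ℕ, 0 < i → Subsingleton (TorGroup A M N i)) →
      projDim A M ≠ ⊤ → IsLocalACM A (M ⊗[A] N) → IsLocalACM A N) ∧
    ((∀ (M : Type u) [AddCommGroup M] [Module A M],
      Module.Finite A M → Nontrivial M → projDim A M ≠ ⊤ → IsLocalACM A M →
      IsLocalACM A A)) := by
  constructor
  · intro M N _ _ _ _ _ _ _ _ htor hpd hacm
    obtain ⟨r, hr⟩ := exists_hasMinimalResolution_of_projDim_ne_top hpd
    refine hr.isLocalACM (isTorAcyclic_of_isZero_tor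
      (projectiveResolution (ModuleCat.of A N)) fun i => ?_) hacm
    have : Subsingleton (((Tor (ModuleCat.{u} A) (i + 1)).obj (ModuleCat.of A M)).obj
      (ModuleCat.of A N)) := htor (i + 1) i.succ_pos
    exact ModuleCat.isZero_of_subsingleton _
  · intro M _ _ _ _ hpd hacm
    obtain ⟨r, hr⟩ := exists_hasMinimalResolution_of_projDim_ne_top hpd
    have : Projective (ModuleCat.of A A) :=
      (IsProjective.iff_projective (ModuleCat.of A A)).1 inferInstance
    exact hr.isLocalACM (isTorAcyclic_of_isZero_tor
      (projectiveResolution (ModuleCat.of A A)) fun i => isZero_Tor_succ_of_projective _ _ _ i)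
      (hacm.of_linearEquiv (TensorProduct.rid A M).symm)

end
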